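/- As functions on the upper half-plane, 2·j₆'(τ) - G₂^{(6*)}(τ) = (7/24)E₂^{(6)}(τ) + (13/12)E₂^{(3)}(2τ) - (1/8)E₂^{(2)}(3τ), where j₆'(τ) = (2πi)^{-1} d/dτ j₆(τ) and E₂^{(N)}(τ) = NE₂(Nτ) - E₂(τ). In particular, 2·j₆' - G₂^{(6*)} lies in the 3-dimensional space M₂(Γ₀(6)) of holomorphic modular forms of weight 2 on Γ₀(6), which is spanned by E₂^{(6)}(τ), E₂^{(3)}(2τ), E₂^{(2)}(3τ). -/

import Mathlib

open Complex Matrix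

noncomputable section

/-- `SL(2, ℝ)`. -/
abbrev SL2R := Matrix.SpecialLinearGroup (Fin 2) ℝ

/-- `q = e^{2πiz}` (also used as `ζ = e^{2πiz}`). -/
def qc (z : ℂ) : ℂ := Complex.exp (2 * Real.pi * Complex.I * z)

/-- The Dedekind eta function `η(z) = q^{1/24} ∏_{n ≥ 1} (1 - q^n)` (intended for `Im z > 0`). -/
def dedekindEta (z : ℂ) : ℂ :=
  Complex.exp (Real.pi * Complex.I * z / 12) *
    ∏' n : ℕ, (1 - Complex.exp (2 * Real.pi * Complex.I * ((n : ℂ) + 1) * z))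

/-- The hauptmodul `j_N` of `Γ₀(N)` for `N ∈ {2, 3, 5, 7, 13, 6, 10}`. -/
def jn (N : ℕ) (z : ℂ) : ℂ :=
  if N = 6 then (dedekindEta (2 * z) * dedekindEta (3 * z) ^ 3 / (dedekindEta z * dedekindEta (6 * z) ^ 3)) ^ 3 - 3
  else if N = 10 then dedekindEta (2 * z) * dedekindEta (5 * z) ^ 5 / (dedekindEta z * dedekindEta (10 * z) ^ 5) - 1
  else (dedekindEta z / dedekindEta ((N : ℂ) * z)) ^ (24 / (N - 1)) + 24 / ((N : ℂ) - 1)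

/-- The hauptmodul `j_N^*` of the Fricke group `Γ₀^*(N)` for `N ∈ {2, 3, 5, 7, 13, 6, 10}`. -/
def jnStar (N : ℕ) (z : ℂ) : ℂ :=
  if N = 6 then
    (dedekindEta z * dedekindEta (3 * z) / (dedekindEta (2 * z) * dedekindEta (6 * z))) ^ 6 + 6 +
      2 ^ 6 * (dedekindEta (2 * z) * dedekindEta (6 * z) / (dedekindEta z * dedekindEta (3 * z))) ^ 6
  else if N = 10 then
    (dedekindEta z * dedekindEta (5 * z) / (dedekindEta (2 * z) * dedekindEta (10 * z))) ^ 4 + 4 +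
      2 ^ 4 * (dedekindEta (2 * z) * dedekindEta (10 * z) / (dedekindEta z * dedekindEta (5 * z))) ^ 4
  else
    (dedekindEta z / dedekindEta ((N : ℂ) * z)) ^ (24 / (N - 1)) + 24 / ((N : ℂ) - 1) +
      (N : ℂ) ^ (12 / (N - 1)) * (dedekindEta ((N : ℂ) * z) / dedekindEta z) ^ (24 / (N - 1))

/-- `f` has the `q`-expansion `f(τ) = Σ_{n ≥ n₀} (a n) q^n` on the upper half-plane. -/
def HasQExp (f : ℂ → ℂ) (a : ℤ → ℂ) (n₀ : ℤ) : Prop :=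
  (∀ n < n₀, a n = 0) ∧
    ∀ τ : ℂ, 0 < τ.im →
      HasSum (fun m : ℕ => a (n₀ + m) * qc τ ^ (n₀ + (m : ℤ))) (f τ)

/-- `Γ₀(N)` viewed as a subgroup of `SL(2, ℝ)`. -/
def Gamma0SL2R (N : ℕ) : Subgroup SL2R :=
  (CongruenceSubgroup.Gamma0 N).map
    (Matrix.SpecialLinearGroup.map (Int.castRingHom ℝ))

/-- The set of Atkin–Lehner matrices `W_e` of level `N`:
`W_e = e^{-1/2} [[xe, y], [zN, we]]`, `x, y, z, w ∈ ℤ` (determinant `1` being automatic). -/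
def atkinLehnerSet (N e : ℕ) : Set SL2R :=
  { g | ∃ x y z w : ℤ,
      g.1 = (Real.sqrt e)⁻¹ • !![(x : ℝ) * e, (y : ℝ); (z : ℝ) * N, (w : ℝ) * e] }

/-- The Fricke group `Γ₀^*(N)`, generated by `Γ₀(N)` and all Atkin–Lehner involutions `W_e`
for `e ∣ N` with `gcd(e, N/e) = 1`. -/
def FrickeGroup (N : ℕ) : Subgroup SL2R :=
  Subgroup.closure
    ((Gamma0SL2R N : Set SL2R) ∪
      ⋃ e ∈ {e : ℕ | e ∣ N ∧ Nat.Coprime e (N / e)}, atkinLehnerSet N e)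

/-- The Gram matrix of the integral binary quadratic form `[a, b, c]`. -/
def formMat (a b c : ℤ) : Matrix (Fin 2) (Fin 2) ℝ :=
  !![(a : ℝ), (b : ℝ) / 2; (b : ℝ) / 2, (c : ℝ)]

/-- `𝒬_{d,N}`: positive definite integral binary quadratic forms `[a, b, c]` of
discriminant `-d` with `N ∣ a`. -/
def QdN (d : ℤ) (N : ℕ) : Set (Matrix (Fin 2) (Fin 2) ℝ) :=
  { M | ∃ a b c : ℤ, M = formMat a b c ∧ 0 < a ∧ b ^ 2 - 4 * a * c = -d ∧ (N : ℤ) ∣ a }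

/-- `𝒬_{d,N,h}`: members of `𝒬_{d,N}` with `b ≡ h (mod 2N)`. -/
def QdNh (d : ℤ) (N : ℕ) (h : ℤ) : Set (Matrix (Fin 2) (Fin 2) ℝ) :=
  { M | ∃ a b c : ℤ, M = formMat a b c ∧ 0 < a ∧ b ^ 2 - 4 * a * c = -d ∧ (N : ℤ) ∣ a ∧
      (b : ZMod (2 * N)) = (h : ZMod (2 * N)) }

/-- Orbit relation of the (right) action `Q ↦ Q ∘ g`, i.e. `M ↦ gᵀ M g`, of `Γ ≤ SL(2, ℝ)`
on a set `S` of Gram matrices of quadratic forms. -/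
def formRel (Γ : Subgroup SL2R) (S : Set (Matrix (Fin 2) (Fin 2) ℝ)) (Q Q' : S) : Prop :=
  ∃ g ∈ Γ, Q'.1 = (g.1)ᵀ * Q.1 * g.1

/-- The CM point `α_Q` of a positive definite form (as a point of `ℂ`; it lies in the upper
half-plane): `α_Q = (-b + i √d) / (2a) = (-(b/2) + i √(det M)) / a`. -/
def cmPointC (M : Matrix (Fin 2) (Fin 2) ℝ) : ℂ :=
  ((-(M 0 1) : ℝ) + Complex.I * Real.sqrt M.det) / ((M 0 0 : ℝ) : ℂ)

/-- The order of the stabilizer of the form `M` in `Γ/{±1}` (the stabilizer in `Γ` contains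
`±1` and has twice the cardinality). -/
def stabOrder (Γ : Subgroup SL2R) (M : Matrix (Fin 2) (Fin 2) ℝ) : ℕ :=
  Nat.card { g : SL2R // g ∈ Γ ∧ (g.1)ᵀ * M * g.1 = M } / 2

/-- The modular trace `Σ_{Q ∈ S/Γ} f(α_Q) / |Γ̄_Q|`. -/
def classTrace (Γ : Subgroup SL2R) (f : ℂ → ℂ)
    (S : Set (Matrix (Fin 2) (Fin 2) ℝ)) : ℂ :=
  ∑ᶠ O : Quot (formRel Γ S),
    f (cmPointC (Quot.out O).1) / (stabOrder Γ (Quot.out O).1 : ℂ)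

/-- `t₂^{(N*)}(d)`, where `P` is the polynomial with `φ₂(j_N^*) = P(j_N^*)`;
includes the paper's conventions at nonpositive indices. -/
def t2Star (N : ℕ) (P : Polynomial ℂ) (d : ℤ) : ℂ :=
  if 0 < d then
    classTrace (FrickeGroup N) (fun z => Polynomial.eval (jnStar N z) P) (QdN d N)
  else if d = 0 then (if N = 2 then 5 else if N = 6 ∨ N = 10 then 5 / 2 else 3)
  else if d = -1 then -1
  else if d = -4 then -2
  else 0

/-- `σ₁^{(N)}(x) = Σ_{d ∣ x, N ∤ d} d` for `x ∈ ℤ_{>0}`, `(N-1)/24` at `x = 0`, and `0`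
off `ℤ_{≥0}`. -/
def sigmaN (N : ℕ) (x : ℚ) : ℂ :=
  if x = 0 then ((N : ℂ) - 1) / 24
  else if 0 < x ∧ x.den = 1 then
    ∑ d ∈ (Nat.divisors x.num.toNat).filter (fun d => ¬ N ∣ d), (d : ℂ)
  else 0

/-- `σ₁(x) = Σ_{d ∣ x} d` for `x ∈ ℤ_{>0}` and `0` otherwise. -/
def sigmaQ (x : ℚ) : ℂ :=
  if 0 < x ∧ x.den = 1 then ∑ d ∈ Nat.divisors x.num.toNat, (d : ℂ) else 0

/-- A weakly holomorphic Jacobi form of weight `k` and index `m`. -/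
structure WeakJacobiForm (k : ℤ) (m : ℕ) where
  toFun : ℂ → ℂ → ℂ
  holo : DifferentiableOn ℂ (fun p : ℂ × ℂ => toFun p.1 p.2)
      ({τ : ℂ | 0 < τ.im} ×ˢ (Set.univ : Set ℂ))
  slash_inv : ∀ a b c d : ℤ, a * d - b * c = 1 → ∀ τ z : ℂ, 0 < τ.im →
    ((c : ℂ) * τ + d) ^ (-k) *
        Complex.exp (-(2 * Real.pi * Complex.I * m * c * z ^ 2) / ((c : ℂ) * τ + d)) *
        toFun (((a : ℂ) * τ + b) / ((c : ℂ) * τ + d)) (z / ((c : ℂ) * τ + d)) =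
      toFun τ z
  elliptic : ∀ lm mu : ℤ, ∀ τ z : ℂ, 0 < τ.im →
    Complex.exp (2 * Real.pi * Complex.I * m * ((lm : ℂ) ^ 2 * τ + 2 * lm * z)) *
        toFun τ (z + lm * τ + mu) = toFun τ z
  coeff : ℤ → ℤ → ℂ
  coeff_neg_finite : {n : ℤ | n < 0 ∧ ∃ r : ℤ, coeff n r ≠ 0}.Finite
  expansion : ∀ τ z : ℂ, 0 < τ.im →
    HasSum (fun p : ℤ × ℤ => coeff p.1 p.2 * qc τ ^ p.1 * qc z ^ p.2) (toFun τ z)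

/-- Meromorphy of weight `k` at all cusps: at each cusp `γ∞`, the function `F|_k γ` has a
Fourier expansion in fractional powers of `q` with only finitely many negative terms. -/
def MeromAtCusps (k : ℤ) (F : ℂ → ℂ) : Prop :=
  ∀ a b c d : ℤ, a * d - b * c = 1 →
    ∃ (M : ℕ) (cs : ℤ → ℂ) (n₀ : ℤ), 0 < M ∧
      ∀ τ : ℂ, 0 < τ.im →
        HasSum
          (fun j : ℕ => cs (n₀ + j) *
            Complex.exp (2 * Real.pi * Complex.I * τ / M) ^ (n₀ + (j : ℤ)))
          (((c : ℂ) * τ + d) ^ (-k) * F (((a : ℂ) * τ + b) / ((c : ℂ) * τ + d)))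

/-- The Möbius action of an element of `SL(2, ℝ)` on `ℂ`. -/
def moebius (g : SL2R) (z : ℂ) : ℂ :=
  ((g.1 0 0 : ℝ) * z + ((g.1 0 1 : ℝ) : ℂ)) / ((g.1 1 0 : ℝ) * z + ((g.1 1 1 : ℝ) : ℂ))

/-- A weakly holomorphic modular function on `Γ`: holomorphic on the upper half-plane,
`Γ`-invariant, with poles only at the cusps. -/
def IsWeaklyHolModularFn (Γ : Subgroup SL2R) (f : ℂ → ℂ) : Prop :=
  DifferentiableOn ℂ f {z : ℂ | 0 < z.im} ∧
    (∀ g ∈ Γ, ∀ z : ℂ, 0 < z.im → f (moebius g z) = f z) ∧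
    MeromAtCusps 0 f

/-- The set `L_{h, d/4N}` of vectors
`X = [[b + h/2N, c/N], [-a, -(b + h/2N)]]`, `a, b, c ∈ ℤ`, of norm `q(X) = d/4N`. -/
def LhSet (N : ℕ) (h d : ℤ) : Set (Matrix (Fin 2) (Fin 2) ℝ) :=
  { X | ∃ a b c : ℤ,
      X = !![(b : ℝ) + (h : ℝ) / (2 * N), (c : ℝ) / N;
             -(a : ℝ), -((b : ℝ) + (h : ℝ) / (2 * N))] ∧
      (2 * b * N + h) ^ 2 - 4 * a * c * N = -d }

/-- The map `X ↦ N ⬝ [[0,-1],[1,0]] ⬝ X` from vectors to Gram matrices of quadratic forms. -/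
def vecToForm (N : ℕ) (X : Matrix (Fin 2) (Fin 2) ℝ) : Matrix (Fin 2) (Fin 2) ℝ :=
  (N : ℝ) • (!![(0 : ℝ), -1; 1, 0] * X)

/-- Orbit relation of `Γ` acting by conjugation `g.X = g X g⁻¹` on a set `S` of vectors. -/
def vecRel (Γ : Subgroup SL2R) (S : Set (Matrix (Fin 2) (Fin 2) ℝ)) (X X' : S) : Prop :=
  ∃ g ∈ Γ, X'.1 = g.1 * X.1 * (g⁻¹).1

/-- The Heegner point `D_X ∈ ℍ` of a vector `X` of positive norm. -/
def heegnerC (X : Matrix (Fin 2) (Fin 2) ℝ) : ℂ :=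
  ((X 0 0 / X 1 0 : ℝ) : ℂ) + Complex.I * Real.sqrt (X.det / (X 1 0) ^ 2)

/-- The order of the stabilizer of the vector `X` in `Γ/{±1}`. -/
def vecStabOrder (Γ : Subgroup SL2R) (X : Matrix (Fin 2) (Fin 2) ℝ) : ℕ :=
  Nat.card { g : SL2R // g ∈ Γ ∧ g.1 * X * (g⁻¹).1 = X } / 2

/-- The modular trace `t_f(h, m) = Σ_{X ∈ Γ\L_{h,m}} f(D_X) / |Γ̄_X|`. -/
def vecTrace (Γ : Subgroup SL2R) (f : ℂ → ℂ) (S : Set (Matrix (Fin 2) (Fin 2) ℝ)) : ℂ :=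
  ∑ᶠ O : Quot (vecRel Γ S), f (heegnerC (Quot.out O).1) / (vecStabOrder Γ (Quot.out O).1 : ℂ)

/-- The weight-2 Eisenstein series `E₂(z) = 1 - 24 Σ_{n ≥ 1} σ₁(n) qⁿ`. -/
def E2 (z : ℂ) : ℂ :=
  1 - 24 * ∑' n : ℕ, (∑ d ∈ Nat.divisors (n + 1), (d : ℂ)) * qc z ^ (n + 1)

/-- `E₂^{(N)}(z) = N E₂(Nz) - E₂(z)`. -/
def E2N (N : ℕ) (z : ℂ) : ℂ := (N : ℂ) * E2 ((N : ℂ) * z) - E2 z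

end

namespace LevelSix

open Complex Matrix Filter Topology Asymptotics

/-- The Möbius action of an integral matrix. -/
noncomputable def mob (M : Matrix (Fin 2) (Fin 2) ℤ) (z : ℂ) : ℂ :=
  (M 0 0 * z + M 0 1) / (M 1 0 * z + M 1 1)

/-- The automorphy denominator of an integral matrix. -/
noncomputable def den (M : Matrix (Fin 2) (Fin 2) ℤ) (z : ℂ) : ℂ := M 1 0 * z + M 1 1

lemma den_ne_zero {M : Matrix (Fin 2) (Fin 2) ℤ} (hM : 0 < M.det) {z : ℂ} (hz : 0 < z.im) :
    den M z ≠ 0 := by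
  intro h
  have him := congrArg Complex.im h
  have hre := congrArg Complex.re h
  simp [den] at him hre
  rw [det_fin_two] at hM
  rcases him with h0 | h0
  · simp [h0] at hre
    simp [h0, hre] at hM
  · exact hz.ne' h0

lemma mob_im {M : Matrix (Fin 2) (Fin 2) ℤ} (z : ℂ) :
    (mob M z).im = M.det * z.im / normSq (den M z) := by
  rw [mob, div_im, det_fin_two]
  simp [den]
  ring

lemma mob_im_pos {M : Matrix (Fin 2) (Fin 2) ℤ} (hM : 0 < M.det) {z : ℂ} (hz : 0 < z.im) :
    0 < (mob M z).im := by
  rw [mob_im]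
  have := normSq_pos.2 (den_ne_zero hM hz)
  have : (0 : ℝ) < M.det := by exact_mod_cast hM
  positivity

lemma den_mul (M N : Matrix (Fin 2) (Fin 2) ℤ) (hN : 0 < N.det) {z : ℂ} (hz : 0 < z.im) :
    den (M * N) z = den M (mob N z) * den N z := by
  have h : (N 1 0 : ℂ) * z + N 1 1 ≠ 0 := den_ne_zero hN hz
  simp only [den, mob, mul_apply, Fin.sum_univ_two, Int.cast_add, Int.cast_mul]
  field_simp
  ring

lemma mob_mul (M N : Matrix (Fin 2) (Fin 2) ℤ) (hN : 0 < N.det) {z : ℂ} (hz : 0 < z.im) :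
    mob (M * N) z = mob M (mob N z) := by
  have h : den N z ≠ 0 := den_ne_zero hN hz
  have h1 : mob (M * N) z = (M 0 0 * mob N z + M 0 1) * den N z / den (M * N) z := by
    have h : (N 1 0 : ℂ) * z + N 1 1 ≠ 0 := den_ne_zero hN hz
    rw [mob, ← den]
    congr 1
    simp only [den, mob, mul_apply, Fin.sum_univ_two, Int.cast_add, Int.cast_mul]
    field_simp
    ring
  rw [h1, den_mul M N hN hz, mul_div_mul_right _ _ h]
  rfl

@[simp] lemma mob_one (z : ℂ) : mob 1 z = z := by simp [mob]

lemma mob_smul {k : ℤ} (hk : k ≠ 0) (M : Matrix (Fin 2) (Fin 2) ℤ) (z : ℂ) :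
    mob (k • M) z = mob M z := by
  have : (k : ℂ) ≠ 0 := by exact_mod_cast hk
  simp only [mob, Matrix.smul_apply, smul_eq_mul, Int.cast_mul, mul_assoc]
  rw [← mul_add, ← mul_add, mul_div_mul_left _ _ this]

@[simp] lemma mob_neg (M : Matrix (Fin 2) (Fin 2) ℤ) (z : ℂ) : mob (-M) z = mob M z := by
  simpa using mob_smul (k := -1) (by norm_num) M z

/-- Membership in `Γ₀(6)`. -/
def InG (γ : Matrix (Fin 2) (Fin 2) ℤ) : Prop := γ.det = 1 ∧ 6 ∣ γ 1 0

lemma InG.one : InG 1 := by simp [InG]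

lemma InG.mul {γ δ : Matrix (Fin 2) (Fin 2) ℤ} (hγ : InG γ) (hδ : InG δ) : InG (γ * δ) := by
  refine ⟨by rw [det_mul, hγ.1, hδ.1, one_mul], ?_⟩
  simp only [mul_apply, Fin.sum_univ_two]
  exact dvd_add (hγ.2.mul_right _) (hδ.2.mul_left _)

lemma InG.adj {γ : Matrix (Fin 2) (Fin 2) ℤ} (hγ : InG γ) : InG γ.adjugate := by
  refine ⟨by simp [det_adjugate, hγ.1], ?_⟩
  rw [adjugate_fin_two]
  simpa using hγ.2

lemma InG.adj_mul {γ : Matrix (Fin 2) (Fin 2) ℤ} (hγ : InG γ) : γ.adjugate * γ = 1 := by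
  rw [adjugate_mul, hγ.1, one_smul]

lemma InG.mul_adj {γ : Matrix (Fin 2) (Fin 2) ℤ} (hγ : InG γ) : γ * γ.adjugate = 1 := by
  rw [mul_adjugate, hγ.1, one_smul]

lemma InG.det_pos {γ : Matrix (Fin 2) (Fin 2) ℤ} (hγ : InG γ) : 0 < γ.det := by
  rw [hγ.1]; norm_num

lemma InG.neg {γ : Matrix (Fin 2) (Fin 2) ℤ} (hγ : InG γ) : InG (-γ) := by
  refine ⟨?_, by simpa using hγ.2⟩
  rw [← hγ.1, det_fin_two, det_fin_two]
  simp

/-- Standard Atkin–Lehner matrices of level `6`. -/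
def W (e : ℕ) : Matrix (Fin 2) (Fin 2) ℤ :=
  if e = 2 then !![2, -1; 6, -2] else if e = 3 then !![3, -2; 6, -3]
  else if e = 6 then !![0, -1; 6, 0] else 1

lemma W_one : W 1 = 1 := by simp [W]
lemma W_two : W 2 = !![2, -1; 6, -2] := by simp [W]
lemma W_three : W 3 = !![3, -2; 6, -3] := by simp [W]
lemma W_six : W 6 = !![0, -1; 6, 0] := by simp [W]

/-- The exact divisors of `6`. -/
def E6 : Finset ℕ := {1, 2, 3, 6}

lemma W_det {e : ℕ} (he : e ∈ E6) : (W e).det = e := by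
  simp only [E6, Finset.mem_insert, Finset.mem_singleton] at he
  rcases he with rfl | rfl | rfl | rfl <;> simp [W, det_fin_two]

lemma W_det_pos (e : ℕ) : 0 < (W e).det := by
  unfold W
  split_ifs <;> simp [det_fin_two]

lemma mob_W_W (e : ℕ) {z : ℂ} (hz : 0 < z.im) : mob (W e) (mob (W e) z) = z := by
  rw [← mob_mul _ _ (W_det_pos e) hz]
  unfold W
  split_ifs
  · rw [show (!![2, -1; 6, -2] * !![2, -1; 6, -2] : Matrix (Fin 2) (Fin 2) ℤ) = (-2 : ℤ) • 1 by
      decide, mob_smul (by norm_num), mob_one]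
  · rw [show (!![3, -2; 6, -3] * !![3, -2; 6, -3] : Matrix (Fin 2) (Fin 2) ℤ) = (-3 : ℤ) • 1 by
      decide, mob_smul (by norm_num), mob_one]
  · rw [show (!![0, -1; 6, 0] * !![0, -1; 6, 0] : Matrix (Fin 2) (Fin 2) ℤ) = (-6 : ℤ) • 1 by
      decide, mob_smul (by norm_num), mob_one]
  · simp

/-- A general Atkin–Lehner matrix factors through the standard one. -/
lemma exists_mul_W {e : ℕ} (he : e ∈ E6) (x y z w : ℤ)
    (hdet : x * w * e - y * z * (6 / e : ℕ) = 1) :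
    ∃ γ, InG γ ∧ !![e * x, y; 6 * z, e * w] = γ * W e := by
  simp only [E6, Finset.mem_insert, Finset.mem_singleton] at he
  rcases he with rfl | rfl | rfl | rfl <;> norm_num at hdet
  · refine ⟨!![x, y; 6 * z, w], ⟨?_, by simp⟩, by simp [W_one]⟩
    rw [det_fin_two_of]; linarith
  · refine ⟨!![-2 * x - 3 * y, x + y; -6 * (z + w), 3 * z + 2 * w], ⟨?_, ?_⟩, ?_⟩
    · rw [det_fin_two_of]; linear_combination hdet
    · simp [dvd_mul_right]
    · rw [W_two]; ext i j; fin_cases i <;> fin_cases j <;> simp [mul_apply] <;> ring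
  · refine ⟨!![-3 * x - 2 * y, 2 * x + y; -6 * (z + w), 4 * z + 3 * w], ⟨?_, ?_⟩, ?_⟩
    · rw [det_fin_two_of]; linear_combination hdet
    · simp [dvd_mul_right]
    · rw [W_three]; ext i j; fin_cases i <;> fin_cases j <;> simp [mul_apply] <;> ring
  · refine ⟨!![-y, x; -6 * w, z], ⟨?_, ?_⟩, ?_⟩
    · rw [det_fin_two_of]; linear_combination hdet
    · simp [dvd_mul_right]
    · rw [W_six]; ext i j; fin_cases i <;> fin_cases j <;> simp [mul_apply] <;> ring

/-- Conjugation by an Atkin–Lehner matrix preserves the Eichler order. -/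
lemma exists_W_conj (e : ℕ) (M : Matrix (Fin 2) (Fin 2) ℤ) (hM : 6 ∣ M 1 0) :
    ∃ N : Matrix (Fin 2) (Fin 2) ℤ, M * W e = W e * N ∧ N.det = M.det ∧ 6 ∣ N 1 0 := by
  obtain ⟨c, hc⟩ := hM
  obtain ⟨a, b, d, rfl⟩ : ∃ a b d, M = !![a, b; 6 * c, d] :=
    ⟨M 0 0, M 0 1, M 1 1, by rw [← hc]; exact eta_fin_two M⟩
  unfold W
  split_ifs
  · refine ⟨!![-2 * a - 6 * b + 6 * c + 3 * d, a + 2 * b - 3 * c - d;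
      -6 * a - 18 * b + 12 * c + 6 * d, 3 * a + 6 * b - 6 * c - 2 * d], ?_, ?_, ?_⟩
    · ext i j; fin_cases i <;> fin_cases j <;> simp [mul_apply] <;> ring
    · simp only [det_fin_two_of]; ring
    · exact ⟨-a - 3 * b + 2 * c + d, by simp; ring⟩
  · refine ⟨!![-3 * a - 6 * b + 12 * c + 4 * d, 2 * a + 3 * b - 8 * c - 2 * d;
      -6 * a - 12 * b + 18 * c + 6 * d, 4 * a + 6 * b - 12 * c - 3 * d], ?_, ?_, ?_⟩
    · ext i j; fin_cases i <;> fin_cases j <;> simp [mul_apply] <;> ring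
    · simp only [det_fin_two_of]; ring
    · exact ⟨-a - 2 * b + 3 * c + d, by simp; ring⟩
  · refine ⟨!![d, -c; -6 * b, a], ?_, ?_, ?_⟩
    · ext i j; fin_cases i <;> fin_cases j <;> simp [mul_apply] <;> try ring
    · simp only [det_fin_two_of]; ring
    · exact ⟨-b, by simp⟩
  · exact ⟨!![a, b; 6 * c, d], by simp, rfl, ⟨c, by simp⟩⟩

lemma mob_adjugate_mob {M : Matrix (Fin 2) (Fin 2) ℤ} (hM : 0 < M.det) {z : ℂ} (hz : 0 < z.im) :
    mob M.adjugate (mob M z) = z := by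
  rw [← mob_mul _ _ hM hz, adjugate_mul, mob_smul hM.ne', mob_one]

/-- Every point of the upper half-plane is equivalent, up to an Atkin–Lehner involution, to a point
of imaginary part at least `1/12`. -/
lemma exists_reduction {z : ℂ} (hz : 0 < z.im) :
    ∃ e ∈ E6, ∃ γ, InG γ ∧ ∃ w : ℂ, 1 / 12 ≤ w.im ∧ z = mob γ (mob (W e) w) := by
  obtain ⟨γ₀, hγ⟩ := ModularGroup.exists_one_half_le_im_smul ⟨z, hz⟩
  have hdet : γ₀ 0 0 * γ₀ 1 1 - γ₀ 0 1 * γ₀ 1 0 = 1 := by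
    rw [← det_fin_two]; exact γ₀.2
  set c := γ₀ 1 0 with hc
  set d := γ₀ 1 1 with hd
  have him : 1 / 2 ≤ z.im / normSq ((c : ℂ) * z + d) := by
    have := ModularGroup.im_smul_eq_div_normSq γ₀ ⟨z, hz⟩
    rw [this] at hγ
    exact hγ
  obtain ⟨e, he, z', hz', hcop⟩ : ∃ e ∈ E6, ∃ z' : ℤ, c = z' * (6 / e : ℕ) ∧ IsCoprime (e : ℤ) c := by
    have h6 : ((c.gcd 6 : ℕ) : ℤ) ∣ c := Int.gcd_dvd_left ..
    have h6' : c.gcd 6 ∣ 6 := by exact_mod_cast Int.gcd_dvd_right c 6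
    have hle : c.gcd 6 ≤ 6 := Nat.le_of_dvd (by norm_num) h6'
    obtain ⟨z', hz'⟩ := h6
    refine ⟨6 / c.gcd 6, ?_, z', ?_, ?_⟩
    · generalize c.gcd 6 = g at *
      interval_cases g <;> simp_all [E6]
    · rw [Nat.div_div_self h6' (by norm_num), mul_comm]; exact hz'
    · rw [Int.isCoprime_iff_gcd_eq_one, Int.gcd_comm]
      have h5 : Nat.gcd c.natAbs 6 = c.gcd 6 := by rfl
      rw [Int.gcd, Int.natAbs_natCast]
      generalize hg : c.gcd 6 = g at *
      have hmod : Nat.gcd (c.natAbs % 6) 6 = g := by rw [← h5, Nat.gcd_comm c.natAbs 6, Nat.gcd_rec 6 c.natAbs]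
      have hr : c.natAbs % 6 < 6 := Nat.mod_lt _ (by norm_num)
      have key : ∀ m, 6 / g ∣ 6 → m = c.natAbs % 6 → Nat.gcd m (6 / g) = 1 →
          Nat.gcd c.natAbs (6 / g) = 1 := by
        intro m h6 hm h1
        rw [← h1, hm, Nat.gcd_comm, Nat.gcd_comm _ (6 / g), Nat.gcd_rec, Nat.gcd_rec (6 / g) (_ % 6),
          Nat.mod_mod_of_dvd _ h6]
      refine key _ (Nat.div_dvd_of_dvd h6') rfl ?_
      generalize c.natAbs % 6 = m at *
      subst hmod
      interval_cases m <;> rfl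
  have hcd : IsCoprime d c := ⟨γ₀ 0 0, -γ₀ 0 1, by linarith⟩
  obtain ⟨x, y, hxy⟩ := hcop.mul_left hcd
  have he0 : 0 < (e : ℤ) ∧ (e : ℤ) ≤ 6 := by
    simp only [E6, Finset.mem_insert, Finset.mem_singleton] at he
    rcases he with rfl | rfl | rfl | rfl <;> norm_num
  have hediv : ((6 / e : ℕ) : ℤ) * e = 6 := by
    simp only [E6, Finset.mem_insert, Finset.mem_singleton] at he
    rcases he with rfl | rfl | rfl | rfl <;> norm_num
  obtain ⟨γ, hγG, hγW⟩ := exists_mul_W he d y (-z') x (by rw [hz'] at hxy; linear_combination hxy)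
  set V : Matrix (Fin 2) (Fin 2) ℤ := !![e * x, -y; 6 * z', e * d] with hV
  have hVdet : V.det = e := by
    rw [hV, det_fin_two_of]
    rw [hz'] at hxy
    linear_combination (e : ℤ) * hxy - y * z' * hediv
  have hVpos : 0 < V.det := by rw [hVdet]; exact he0.1
  refine ⟨e, he, γ, hγG, mob V z, ?_, ?_⟩
  · rw [mob_im, hVdet]
    have hden : den V z = e * ((c : ℂ) * z + d) := by
      have : (6 * z' : ℤ) = e * c := by rw [hz']; linear_combination -z' * hediv
      simp only [den, hV, of_apply, cons_val', cons_val_zero, cons_val_one, this, cons_val_fin_one]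
      push_cast; ring
    rw [hden, normSq_mul, normSq_natCast]
    have h1 : (0 : ℝ) < e := by exact_mod_cast he0.1
    have h2 : (e : ℝ) ≤ 6 := by exact_mod_cast he0.2
    have : ((e : ℤ) : ℝ) * z.im / ((e : ℝ) * e * normSq ((c : ℂ) * z + d)) =
        (z.im / normSq ((c : ℂ) * z + d)) / e := by
      push_cast; field_simp
    rw [this, le_div_iff₀ h1]
    linarith
  · rw [← mob_mul _ _ (W_det_pos e) (mob_im_pos hVpos hz), ← hγW]
    conv_lhs => rw [← mob_adjugate_mob hVpos hz]
    congr 1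
    rw [hV, adjugate_fin_two_of]
    simp

variable {f : ℂ → ℂ}

lemma periodic_int (h1 : ∀ z : ℂ, 0 < z.im → f (z + 1) = f z) (k : ℤ) {z : ℂ} (hz : 0 < z.im) :
    f (z + k) = f z := by
  have key : ∀ n : ℕ, ∀ z : ℂ, 0 < z.im → f (z + n) = f z := by
    intro n
    induction n with
    | zero => simp
    | succ n ih =>
      intro z hz
      rw [Nat.cast_succ, ← add_assoc, h1 _ (by simpa using hz), ih z hz]
  obtain ⟨n, rfl | rfl⟩ := k.eq_nat_or_neg
  · exact_mod_cast key n z hz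
  · rw [← key n (z + ((-n : ℤ) : ℂ)) (by simpa using hz)]
    push_cast
    rw [neg_add_cancel_right]

lemma exists_abs_add_mul_le (a : ℤ) {c : ℤ} (hc : c ≠ 0) :
    ∃ k : ℤ, |a + 6 * c * k| ≤ 3 * |c| := by
  refine ⟨-round ((a : ℚ) / (6 * c)), ?_⟩
  have h := abs_sub_round ((a : ℚ) / (6 * c))
  have hcq : (c : ℚ) ≠ 0 := by exact_mod_cast hc
  have h2 : (a : ℚ) + 6 * c * (-round ((a : ℚ) / (6 * c)) : ℤ) =
      6 * c * ((a : ℚ) / (6 * c) - round ((a : ℚ) / (6 * c))) := by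
    push_cast; field_simp; ring
  have h3 : |(a : ℚ) + 6 * c * (-round ((a : ℚ) / (6 * c)) : ℤ)| ≤ 3 * |(c : ℚ)| := by
    rw [h2, abs_mul, abs_mul]
    have : |(6 : ℚ)| = 6 := by norm_num
    rw [this]
    nlinarith [abs_nonneg (c : ℚ)]
  exact_mod_cast h3

set_option maxHeartbeats 400000 in
/-- A function on the upper half-plane is invariant under `Γ₀(6)` as soon as it is `1`-periodic
at the three cusps `∞`, `W₃ ∞` and `W₆ ∞`. -/
lemma invariant_of_periodic (h1 : ∀ z : ℂ, 0 < z.im → f (z + 1) = f z)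
    (h3 : ∀ z : ℂ, 0 < z.im → f (mob (W 3) (z + 1)) = f (mob (W 3) z))
    (h6 : ∀ z : ℂ, 0 < z.im → f (mob (W 6) (z + 1)) = f (mob (W 6) z))
    {γ : Matrix (Fin 2) (Fin 2) ℤ} (hγ : InG γ) {z : ℂ} (hz : 0 < z.im) :
    f (mob γ z) = f z := by
  have hmul : ∀ δ γ : Matrix (Fin 2) (Fin 2) ℤ, δ.det = 1 → γ.det = 1 →
      (∀ z : ℂ, 0 < z.im → f (mob δ z) = f z) →
      (∀ z : ℂ, 0 < z.im → f (mob (δ * γ) z) = f z) → ∀ z : ℂ, 0 < z.im → f (mob γ z) = f z := by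
    intro δ γ hδ hγ h h' z hz
    rw [← h' z hz, mob_mul _ _ (by rw [hγ]; norm_num) hz, h _ (mob_im_pos (by rw [hγ]; norm_num) hz)]
  have hT : ∀ k : ℤ, ∀ z : ℂ, 0 < z.im → f (mob !![1, k; 0, 1] z) = f z := by
    intro k z hz
    simpa [mob] using periodic_int h1 k hz
  have hconj : ∀ e, (∀ z : ℂ, 0 < z.im → f (mob (W e) (z + 1)) = f (mob (W e) z)) → ∀ k : ℤ,
      ∀ z : ℂ, 0 < z.im → f (mob (W e * (!![1, k; 0, 1] * W e)) z) = f z := by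
    intro e he k z hz
    have hd : (0 : ℤ) < det !![1, k; 0, 1] := by simp
    have hW := mob_im_pos (W_det_pos e) hz
    rw [mob_mul _ _ (by rw [det_mul]; exact mul_pos hd (W_det_pos e)) hz, mob_mul _ _ (W_det_pos e) hz]
    have := periodic_int (f := fun z => f (mob (W e) z)) he k hW
    simp only [mob_W_W e hz] at this
    rw [← this]
    congr 2
    simp [mob]
  have hV : ∀ k : ℤ, ∀ z : ℂ, 0 < z.im → f (mob !![1, 0; 6 * k, 1] z) = f z := by
    intro k z hz
    rw [← hconj 6 h6 (-k) z hz, ← mob_smul (k := -6) (by norm_num)]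
    congr 2
    rw [W_six]; ext i j; fin_cases i <;> fin_cases j <;> simp [mul_apply]
    ring
  have hg : ∀ z : ℂ, 0 < z.im → f (mob !![5, 2; 12, 5] z) = f z := by
    intro z hz
    have h := hconj 3 h3 1 (z + 1) (by simpa using hz)
    rw [h1 z hz] at h
    rw [← h, show (!![5, 2; 12, 5] : Matrix (Fin 2) (Fin 2) ℤ) = !![5, -3; 12, -7] * !![1, 1; 0, 1] by
      decide, mob_mul _ _ (by simp) hz, ← mob_smul (k := 3) (by norm_num)]
    congr 2
    · rw [W_three]; decide
    · simp [mob]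
  have hg' : ∀ z : ℂ, 0 < z.im → f (mob !![5, -2; -12, 5] z) = f z := by
    apply hmul !![5, 2; 12, 5] _ (by simp [det_fin_two]) (by simp [det_fin_two]) hg
    intro z hz
    rw [show (!![5, 2; 12, 5] * !![5, -2; -12, 5] : Matrix (Fin 2) (Fin 2) ℤ) = 1 by decide, mob_one]
  have main : ∀ n : ℕ, ∀ a b c d : ℤ, c.natAbs = n → a * d - 6 * b * c = 1 →
      ∀ z : ℂ, 0 < z.im → f (mob !![a, b; 6 * c, d] z) = f z := by
    intro n
    induction n using Nat.strong_induction_on with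
    | _ n ih =>
    intro a b c d hcn hdet
    rcases eq_or_ne c 0 with rfl | hc
    · have had : a * d = 1 := by linarith
      intro z hz
      rcases Int.eq_one_or_neg_one_of_mul_eq_one' had with ⟨rfl, rfl⟩ | ⟨rfl, rfl⟩
      · exact hT b z hz
      · rw [← mob_neg, ← hT (-b) z hz]
        congr 2
        ext i j; fin_cases i <;> fin_cases j <;> simp
    have hsmall : ∀ a b d : ℤ, a * d - 6 * b * c = 1 → |a| ≤ 3 * |c| →
        ∀ z : ℂ, 0 < z.im → f (mob !![a, b; 6 * c, d] z) = f z := by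
      intro a b d hdet ha
      have hred : ∀ p r s t : ℤ, p * t - 6 * r * s = 1 →
          (∀ z : ℂ, 0 < z.im → f (mob !![p, r; 6 * s, t] z) = f z) → (s * a + t * c).natAbs < n →
          ∀ z : ℂ, 0 < z.im → f (mob !![a, b; 6 * c, d] z) = f z := by
        intro p r s t hpt hinv hlt
        refine hmul !![p, r; 6 * s, t] _ (by rw [det_fin_two_of]; linarith)
          (by rw [det_fin_two_of]; linarith) hinv ?_
        intro z hz
        rw [← ih _ hlt (p * a + r * (6 * c)) (p * b + r * d) (s * a + t * c) (6 * s * b + t * d) rfl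
          (by linear_combination (a * d - 6 * b * c) * hpt + hdet) z hz]
        congr 2
        ext i j; fin_cases i <;> fin_cases j <;> simp [mul_apply]
        ring
      have ha0 : a ≠ 0 := by rintro rfl; have : 6 * (b * c) = -1 := by linarith
                             omega
      have ha2 : |a| ≠ 2 * |c| := by
        intro h
        have : ∃ k, a = 2 * k := by
          rcases abs_choice a with h1 | h1 <;> rcases abs_choice c with h2 | h2 <;>
            first | exact ⟨c, by omega⟩ | exact ⟨-c, by omega⟩
        obtain ⟨k, rfl⟩ := this
        have : 2 * (k * d) - 6 * (b * c) = 1 := by linarith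
        omega
      have ha3 : |a| ≠ 3 * |c| := by
        intro h
        have : ∃ k, a = 3 * k := by
          rcases abs_choice a with h1 | h1 <;> rcases abs_choice c with h2 | h2 <;>
            first | exact ⟨c, by omega⟩ | exact ⟨-c, by omega⟩
        obtain ⟨k, rfl⟩ := this
        have : 3 * (k * d) - 6 * (b * c) = 1 := by linarith
        omega
      rcases lt_or_gt_of_ne ha2 with h | h
      · have : (a + c).natAbs < n ∨ (-a + c).natAbs < n := by
          rcases abs_cases a with h1 | h1 <;> rcases abs_cases c with h2 | h2 <;> omega
        rcases this with h | h
        · exact hred 1 0 1 1 (by norm_num) (hV 1) (by simpa using h)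
        · exact hred 1 0 (-1) 1 (by norm_num) (hV (-1)) (by simpa using h)
      · have : (2 * a + 5 * c).natAbs < n ∨ (-2 * a + 5 * c).natAbs < n := by
          rcases abs_cases a with h1 | h1 <;> rcases abs_cases c with h2 | h2 <;> omega
        rcases this with h | h
        · exact hred 5 2 2 5 (by norm_num)
            (by rw [show (6 * 2 : ℤ) = 12 by norm_num]; exact hg) h
        · exact hred 5 (-2) (-2) 5 (by norm_num)
            (by rw [show (6 * (-2) : ℤ) = -12 by norm_num]; exact hg') h
    obtain ⟨k, hk⟩ := exists_abs_add_mul_le a hc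
    have hd : det !![a, b; 6 * c, d] = 1 := by rw [det_fin_two_of]; linear_combination hdet
    have hk1 : det !![1, k; 0, 1] = 1 := by simp
    refine hmul !![1, k; 0, 1] !![a, b; 6 * c, d] hk1 hd (hT k) ?_
    intro z hz
    rw [← hsmall (a + 6 * c * k) (b + k * d) d (by linear_combination hdet) hk z hz]
    congr 2
    ext i j; fin_cases i <;> fin_cases j <;> simp [mul_apply]
    ring
  obtain ⟨c, hc⟩ := hγ.2
  have hdet := hγ.1
  rw [det_fin_two, hc] at hdet
  have := main _ (γ 0 0) (γ 0 1) c (γ 1 1) rfl (by linarith) z hz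
  rwa [← hc, ← eta_fin_two γ] at this

/-- The upper half-plane as a subset of `ℂ`. -/
def UH : Set ℂ := {z : ℂ | 0 < z.im}

lemma isOpen_UH : IsOpen UH := isOpen_lt continuous_const Complex.continuous_im

lemma UH_mem_nhds {z : ℂ} (hz : 0 < z.im) : UH ∈ 𝓝 z := isOpen_UH.mem_nhds hz

lemma isPreconnected_UH : IsPreconnected UH := (convex_halfSpace_im_gt 0).isPreconnected

/-- Neighbourhoods of `i∞`. -/
abbrev atInf : Filter ℂ := comap Complex.im atTop

lemma eventually_im_gt (A : ℝ) : ∀ᶠ z in atInf, A < z.im := tendsto_comap.eventually_gt_atTop A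

instance : atInf.NeBot := by
  refine comap_neBot fun s hs => ?_
  obtain ⟨A, hA⟩ := mem_atTop_sets.1 hs
  exact ⟨A * I, hA _ (by simp)⟩

lemma qc_eq_qParam (z : ℂ) : qc z = Function.Periodic.qParam 1 z := by
  simp [qc, Function.Periodic.qParam]

lemma qc_ne_zero (z : ℂ) : qc z ≠ 0 := exp_ne_zero _

lemma norm_qc (z : ℂ) : ‖qc z‖ = Real.exp (-2 * Real.pi * z.im) := by
  rw [qc_eq_qParam, Function.Periodic.norm_qParam, div_one]

lemma norm_qc_lt_one {z : ℂ} (hz : 0 < z.im) : ‖qc z‖ < 1 := by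
  rw [qc_eq_qParam]; exact Function.Periodic.norm_qParam_lt_one one_pos hz

lemma qc_mem_ball {z : ℂ} (hz : 0 < z.im) : qc z ∈ Metric.ball (0 : ℂ) 1 := by
  simpa using norm_qc_lt_one hz

lemma tendsto_qc : Tendsto qc atInf (𝓝[≠] 0) := by
  have := Function.Periodic.qParam_tendsto (h := 1) one_pos
  exact this.congr fun z => (qc_eq_qParam z).symm

lemma tendsto_qc' : Tendsto qc atInf (𝓝 0) := tendsto_nhds_of_tendsto_nhdsWithin tendsto_qc

lemma differentiable_qc : Differentiable ℂ qc := by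
  unfold qc; fun_prop

lemma qc_add_one (z : ℂ) : qc (z + 1) = qc z := by
  simp only [qc, mul_add, mul_one, Complex.exp_add, Complex.exp_two_pi_mul_I]

lemma exists_qc_eq {q : ℂ} (h0 : q ≠ 0) (h1 : ‖q‖ < 1) : ∃ z : ℂ, 0 < z.im ∧ qc z = q := by
  have hz : qc (Function.Periodic.invQParam 1 q) = q := by
    rw [qc_eq_qParam]; exact Function.Periodic.qParam_right_inv one_ne_zero h0
  refine ⟨Function.Periodic.invQParam 1 q, ?_, hz⟩
  rw [Function.Periodic.im_invQParam]
  have := Real.log_neg (norm_pos_iff.2 h0) h1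
  have hpi := Real.pi_pos
  have : 0 < 1 / (2 * Real.pi) * (-Real.log ‖q‖) := by
    apply mul_pos (by positivity); linarith
  convert this using 1; ring

/-- A function of the upper half-plane that stays bounded at `i∞`. -/
def BddInf (f : ℂ → ℂ) : Prop := ∃ C : ℝ, ∀ᶠ z in atInf, ‖f z‖ ≤ C

lemma BddInf.of_tendsto {f : ℂ → ℂ} {c : ℂ} (h : Tendsto f atInf (𝓝 c)) : BddInf f := by
  refine ⟨‖c‖ + 1, ?_⟩
  filter_upwards [h.norm.eventually_le_const (lt_add_one _)] with z hz using hz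

/-- A `1`-periodic holomorphic function bounded at `i∞` is a holomorphic function of `q`. -/
lemma exists_cuspFunction {f : ℂ → ℂ} (hf : DifferentiableOn ℂ f UH)
    (h1 : ∀ z : ℂ, 0 < z.im → f (z + 1) = f z) (hb : BddInf f) :
    ∃ g : ℂ → ℂ, DifferentiableOn ℂ g (Metric.ball 0 1) ∧ ∀ z : ℂ, 0 < z.im → f z = g (qc z) := by
  classical
  set F : ℂ → ℂ := fun z => if 0 < z.im then f z else 0 with hF
  have hFf : ∀ z : ℂ, 0 < z.im → F z = f z := fun z hz => by simp [hF, hz]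
  have hper : Function.Periodic F ((1 : ℝ) : ℂ) := by
    intro z
    by_cases hz : 0 < z.im
    · simp [hF, hz, h1 z hz]
    · simp [hF, hz]
  have hd : ∀ z : ℂ, 0 < z.im → DifferentiableAt ℂ F z := fun z hz =>
    (hf.differentiableAt (UH_mem_nhds hz)).congr_of_eventuallyEq
      (by filter_upwards [UH_mem_nhds hz] with w hw using hFf w hw)
  have hbF : Filter.BoundedAtFilter atInf F := by
    obtain ⟨C, hC⟩ := hb
    refine Asymptotics.IsBigO.of_bound C ?_
    filter_upwards [hC, eventually_im_gt 0] with z hz h0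
    simpa [hFf z h0] using hz
  refine ⟨Function.Periodic.cuspFunction 1 F, ?_, ?_⟩
  · intro q hq
    rcases eq_or_ne q 0 with rfl | h0
    · refine (Function.Periodic.differentiableAt_cuspFunction_zero one_pos hper ?_ hbF).differentiableWithinAt
      filter_upwards [eventually_im_gt 0] with z hz using hd z hz
    · obtain ⟨z, hz, rfl⟩ := exists_qc_eq h0 (by simpa using hq)
      rw [qc_eq_qParam]
      exact (Function.Periodic.differentiableAt_cuspFunction one_ne_zero hper (hd z hz)).differentiableWithinAt
  · intro z hz
    rw [qc_eq_qParam, Function.Periodic.eq_cuspFunction one_ne_zero hper, hFf z hz]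

/-- Invariance under `Γ₀(6)`. -/
def Inv (f : ℂ → ℂ) : Prop := ∀ γ, InG γ → ∀ z : ℂ, 0 < z.im → f (mob γ z) = f z

lemma Inv.add_one {f : ℂ → ℂ} (hf : Inv f) {z : ℂ} (hz : 0 < z.im) : f (z + 1) = f z := by
  have := hf !![1, 1; 0, 1] ⟨by simp, by simp⟩ z hz
  simpa [mob] using this

lemma Inv.comp_W {f : ℂ → ℂ} (hf : Inv f) (e : ℕ) : Inv (fun z => f (mob (W e) z)) := by
  intro γ hγ z hz
  obtain ⟨N, hN, hNd, hN6⟩ := exists_W_conj e γ hγ.2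
  have hw := mob_im_pos (W_det_pos e) hz
  have hNG : InG N := ⟨by rw [hNd, hγ.1], hN6⟩
  have : mob (W e) (mob γ z) = mob N (mob (W e) z) := by
    conv_lhs => rw [← mob_W_W e hz]
    rw [← mob_mul _ _ (W_det_pos e) hw, hN, mob_mul _ _ hNG.det_pos hw,
      mob_W_W e (mob_im_pos hNG.det_pos hw)]
  simp only [this, hf N hNG _ hw]

lemma differentiableAt_mob {M : Matrix (Fin 2) (Fin 2) ℤ} (hM : 0 < M.det) {z : ℂ} (hz : 0 < z.im) :
    DifferentiableAt ℂ (mob M) z := by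
  unfold mob
  exact DifferentiableAt.div (by fun_prop) (by fun_prop) (den_ne_zero hM hz)

lemma differentiableOn_comp_mob {f : ℂ → ℂ} (hf : DifferentiableOn ℂ f UH)
    {M : Matrix (Fin 2) (Fin 2) ℤ} (hM : 0 < M.det) :
    DifferentiableOn ℂ (fun z => f (mob M z)) UH := by
  intro z hz
  exact ((hf.differentiableAt (UH_mem_nhds (mob_im_pos hM hz))).comp z
    (differentiableAt_mob hM hz)).differentiableWithinAt

/-- A holomorphic function on the compact modular curve is constant. -/
lemma eq_const_of_bdd {f : ℂ → ℂ} (hf : DifferentiableOn ℂ f UH) (hinv : Inv f)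
    (hb : ∀ e ∈ E6, BddInf (fun z => f (mob (W e) z))) : ∃ c, ∀ z : ℂ, 0 < z.im → f z = c := by
  have hg : ∀ e ∈ E6, ∃ g : ℂ → ℂ, DifferentiableOn ℂ g (Metric.ball 0 1) ∧
      ∀ z : ℂ, 0 < z.im → f (mob (W e) z) = g (qc z) := fun e he =>
    exists_cuspFunction (differentiableOn_comp_mob hf (W_det_pos e))
      (fun z hz => (hinv.comp_W e).add_one hz) (hb e he)
  choose! g hgd hgq using hg
  set r : ℝ := Real.exp (-2 * Real.pi * (1 / 12)) with hr
  have hr1 : r < 1 := by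
    rw [hr, Real.exp_lt_one_iff]; nlinarith [Real.pi_pos]
  have hmax : ∀ e ∈ E6, ∃ x ∈ Metric.closedBall (0 : ℂ) r,
      IsMaxOn (fun y => ‖g e y‖) (Metric.closedBall 0 r) x := fun e he =>
    (isCompact_closedBall 0 r).exists_isMaxOn ⟨0, by simp [hr, Real.exp_nonneg]⟩
      (((hgd e he).continuousOn.mono (Metric.closedBall_subset_ball hr1)).norm)
  choose! x hx hxmax using hmax
  obtain ⟨e, he, hemax⟩ := E6.exists_max_image (fun e => ‖g e (x e)‖) ⟨1, by simp [E6]⟩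
  have hle : ∀ z : ℂ, 0 < z.im → ‖f z‖ ≤ ‖g e (x e)‖ := by
    intro z hz
    obtain ⟨e', he', γ, hγ, w, hw, rfl⟩ := exists_reduction hz
    have hw0 : 0 < w.im := by linarith
    rw [hinv γ hγ _ (mob_im_pos (W_det_pos e') hw0), hgq e' he' w hw0]
    refine le_trans (hxmax e' he' ?_) (hemax e' he')
    rw [mem_closedBall_zero_iff, norm_qc, hr, Real.exp_le_exp]
    nlinarith [Real.pi_pos]
  have hxb : x e ∈ Metric.ball (0 : ℂ) 1 := Metric.closedBall_subset_ball hr1 (hx e he)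
  have hmx : IsMaxOn (norm ∘ g e) (Metric.ball 0 1) (x e) := by
    intro q hq
    rcases eq_or_ne q 0 with rfl | h0
    · exact hxmax e he (by simp [hr, Real.exp_nonneg])
    · obtain ⟨z, hz, rfl⟩ := exists_qc_eq h0 (by simpa using hq)
      change ‖g e (qc z)‖ ≤ ‖g e (x e)‖
      rw [← hgq e he z hz]
      exact hle _ (mob_im_pos (W_det_pos e) hz)
  have hconst := Complex.eqOn_of_isPreconnected_of_isMaxOn_norm (convex_ball (0 : ℂ) 1).isPreconnected
    Metric.isOpen_ball (hgd e he) hxb hmx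
  refine ⟨g e (x e), fun z hz => ?_⟩
  have hz' := mob_im_pos (W_det_pos e) hz
  have := hgq e he _ hz'
  rw [mob_W_W e hz] at this
  rw [this]
  exact hconst (qc_mem_ball hz')

lemma dedekindEta_eq_eta (z : ℂ) : dedekindEta z = ModularForm.eta z := by
  unfold dedekindEta ModularForm.eta
  simp only [ModularForm.eta_q_eq_cexp, Function.Periodic.qParam]
  congr 2
  push_cast; ring

lemma eta_ne_zero {z : ℂ} (hz : 0 < z.im) : dedekindEta z ≠ 0 := by
  rw [dedekindEta_eq_eta]; exact ModularForm.eta_ne_zero hz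

lemma differentiableAt_eta {z : ℂ} (hz : 0 < z.im) : DifferentiableAt ℂ dedekindEta z := by
  rw [show dedekindEta = ModularForm.eta from funext dedekindEta_eq_eta]
  exact ModularForm.differentiableAt_eta_of_mem_upperHalfPlaneSet hz

/-- The Euler product `∏ (1 - qⁿ)`. -/
noncomputable def euler (q : ℂ) : ℂ := ∏' n : ℕ, (1 - q ^ (n + 1))

lemma differentiableOn_euler : DifferentiableOn ℂ euler (Metric.ball 0 1) :=
  ModularForm.differentiableOn_tprod_one_sub_pow

lemma dedekindEta_eq (z : ℂ) : dedekindEta z = exp (Real.pi * I * z / 12) * euler (qc z) := by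
  unfold dedekindEta euler qc
  congr 2
  ext n
  rw [← Complex.exp_nat_mul]
  congr 2
  push_cast; ring

lemma euler_zero : euler 0 = 1 := by simp [euler]

lemma euler_ne_zero {q : ℂ} (hq : q ∈ Metric.ball (0 : ℂ) 1) : euler q ≠ 0 := by
  rcases eq_or_ne q 0 with rfl | h0
  · simp [euler_zero]
  · obtain ⟨z, hz, rfl⟩ := exists_qc_eq h0 (by simpa using hq)
    have := eta_ne_zero hz
    rw [dedekindEta_eq] at this
    exact right_ne_zero_of_mul this

lemma norm_euler_sub_le {q : ℂ} (hq : ‖q‖ ≤ 1 / 2) :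
    ‖euler q - (1 - q) * (1 - q ^ 2)‖ ≤ 16 * ‖q‖ ^ 3 := by
  have hq1 : ‖q‖ < 1 := by linarith
  have hm : Multipliable fun n : ℕ => 1 - q ^ (n + 2 + 1) := by
    apply multipliable_one_add_of_summable (f := fun n => -q ^ (n + 2 + 1))
    simpa using (summable_nat_add_iff 3).mpr (summable_geometric_of_lt_one (norm_nonneg _) hq1)
  have hsplit : euler q = (1 - q) * (1 - q ^ 2) * ∏' n : ℕ, (1 - q ^ (n + 2 + 1)) := by
    have := Multipliable.prod_mul_tprod_nat_mul' (f := fun n : ℕ => 1 - q ^ (n + 1)) (k := 2) hm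
    rw [euler, ← this]
    simp [Finset.prod_range_succ]
  have hbound : ∀ s : Finset ℕ, ‖∏ n ∈ s, (1 - q ^ (n + 2 + 1)) - 1‖ ≤ 4 * ‖q‖ ^ 3 := by
    intro s
    have h1 := Finset.norm_prod_one_add_sub_one_le s (fun n => -q ^ (n + 2 + 1))
    simp only [← sub_eq_add_neg] at h1
    refine h1.trans ?_
    have h2 : ∑ n ∈ s, ‖-q ^ (n + 2 + 1)‖ ≤ 2 * ‖q‖ ^ 3 := by
      have hs := (summable_geometric_of_lt_one (norm_nonneg q) hq1)
      calc ∑ n ∈ s, ‖-q ^ (n + 2 + 1)‖ = ‖q‖ ^ 3 * ∑ n ∈ s, ‖q‖ ^ n := by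
            rw [Finset.mul_sum]
            refine Finset.sum_congr rfl fun n _ => ?_
            rw [norm_neg, norm_pow]; ring
        _ ≤ ‖q‖ ^ 3 * 2 := by
            gcongr
            refine (hs.sum_le_tsum s fun _ _ => by positivity).trans ?_
            rw [tsum_geometric_of_lt_one (norm_nonneg q) hq1, inv_le_comm₀ (by linarith) (by norm_num)]
            linarith
        _ = _ := by ring
    have h3 : ‖q‖ ^ 3 ≤ (1 / 2) ^ 3 := by gcongr
    have h4 : 0 ≤ ∑ n ∈ s, ‖-q ^ (n + 2 + 1)‖ := Finset.sum_nonneg fun _ _ => norm_nonneg _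
    have h5 := Real.abs_exp_sub_one_le (x := ∑ n ∈ s, ‖-q ^ (n + 2 + 1)‖)
      (by rw [abs_of_nonneg h4]; linarith)
    rw [abs_of_nonneg h4] at h5
    have := le_abs_self (Real.exp (∑ n ∈ s, ‖-q ^ (n + 2 + 1)‖) - 1)
    linarith
  have hlim : ‖∏' n : ℕ, (1 - q ^ (n + 2 + 1)) - 1‖ ≤ 4 * ‖q‖ ^ 3 :=
    le_of_tendsto ((hm.hasProd.sub_const 1).norm) (Eventually.of_forall hbound)
  rw [hsplit, ← mul_sub_one, norm_mul]
  have h6 : ‖(1 - q) * (1 - q ^ 2)‖ ≤ 2 * 2 := by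
    rw [norm_mul]
    gcongr
    · refine (norm_sub_le _ _).trans ?_
      rw [norm_one]; linarith
    · refine (norm_sub_le _ _).trans ?_
      rw [norm_one, norm_pow]
      nlinarith [norm_nonneg q]
  calc _ ≤ 2 * 2 * (4 * ‖q‖ ^ 3) := by gcongr
    _ = _ := by ring

/-- Modularity of `η²⁴` under `SL₂(ℤ)`. -/
lemma eta_pow_mob {a b c d : ℤ} (hdet : a * d - b * c = 1) {z : ℂ} (hz : 0 < z.im) :
    dedekindEta ((a * z + b) / (c * z + d)) ^ 24 = (c * z + d) ^ 12 * dedekindEta z ^ 24 := by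
  set γ : SpecialLinearGroup (Fin 2) ℤ := ⟨!![a, b; c, d], by rw [det_fin_two_of]; linarith⟩ with hγ
  have h := congrFun (SlashInvariantForm.slash_action_generators_SL2Z ModularForm.discriminant_S_invariant
    ModularForm.discriminant_T_invariant γ) ⟨z, hz⟩
  rw [ModularForm.SL_slash_apply] at h
  have h1 : ((γ • (⟨z, hz⟩ : UpperHalfPlane) : UpperHalfPlane) : ℂ) = (a * z + b) / (c * z + d) := by
    rw [UpperHalfPlane.coe_specialLinearGroup_apply]
    simp [hγ]
  have h2 : UpperHalfPlane.denom γ (⟨z, hz⟩ : UpperHalfPlane) = c * z + d := by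
    rw [ModularGroup.denom_apply]
    simp [hγ]
  simp only [ModularForm.discriminant, h1, h2, ← dedekindEta_eq_eta] at h
  have h3 : (c : ℂ) * z + d ≠ 0 :=
    den_ne_zero (M := !![a, b; c, d]) (by rw [det_fin_two_of]; linarith) hz
  have h4 : dedekindEta ((a * z + b) / (c * z + d)) ^ 24 * (((c : ℂ) * z + d) ^ 12)⁻¹ =
      dedekindEta z ^ 24 := by
    rw [← h]; norm_cast
  rw [← h4, mul_left_comm, mul_inv_cancel₀ (pow_ne_zero _ h3), mul_one]

/-- Eta quotients of level `6`. -/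
noncomputable def etaQuot (r₁ r₂ r₃ r₆ : ℤ) (z : ℂ) : ℂ :=
  dedekindEta z ^ r₁ * dedekindEta (2 * z) ^ r₂ * dedekindEta (3 * z) ^ r₃ * dedekindEta (6 * z) ^ r₆

/-- The holomorphic part of the `q`-expansion of an eta quotient of level `6`. -/
noncomputable def eulerQuot (r₁ r₂ r₃ r₆ : ℤ) (q : ℂ) : ℂ :=
  euler q ^ r₁ * euler (q ^ 2) ^ r₂ * euler (q ^ 3) ^ r₃ * euler (q ^ 6) ^ r₆

lemma pow_mem_ball {q : ℂ} (hq : q ∈ Metric.ball (0 : ℂ) 1) {k : ℕ} (hk : k ≠ 0) :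
    q ^ k ∈ Metric.ball (0 : ℂ) 1 := by
  rw [mem_ball_zero_iff] at hq ⊢
  rw [norm_pow]; exact pow_lt_one₀ (norm_nonneg _) hq hk

lemma eulerQuot_zero (r₁ r₂ r₃ r₆ : ℤ) : eulerQuot r₁ r₂ r₃ r₆ 0 = 1 := by
  simp [eulerQuot, euler_zero]

lemma eulerQuot_ne_zero (r₁ r₂ r₃ r₆ : ℤ) {q : ℂ} (hq : q ∈ Metric.ball (0 : ℂ) 1) :
    eulerQuot r₁ r₂ r₃ r₆ q ≠ 0 := by
  have h2 := euler_ne_zero (pow_mem_ball hq two_ne_zero)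
  have h3 := euler_ne_zero (pow_mem_ball hq three_ne_zero)
  have h6 := euler_ne_zero (pow_mem_ball hq (k := 6) (by norm_num))
  have h1 := euler_ne_zero hq
  unfold eulerQuot
  exact mul_ne_zero (mul_ne_zero (mul_ne_zero (zpow_ne_zero _ h1) (zpow_ne_zero _ h2))
    (zpow_ne_zero _ h3)) (zpow_ne_zero _ h6)

lemma differentiableOn_euler_pow {k : ℕ} (hk : k ≠ 0) :
    DifferentiableOn ℂ (fun q => euler (q ^ k)) (Metric.ball 0 1) :=
  differentiableOn_euler.comp (by fun_prop) fun _ hq => pow_mem_ball hq hk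

lemma differentiableOn_eulerQuot (r₁ r₂ r₃ r₆ : ℤ) :
    DifferentiableOn ℂ (eulerQuot r₁ r₂ r₃ r₆) (Metric.ball 0 1) := by
  unfold eulerQuot
  refine ((DifferentiableOn.mul ?_ ?_).mul ?_).mul ?_
  · exact differentiableOn_euler.zpow (Or.inl fun q hq => euler_ne_zero hq)
  · exact (differentiableOn_euler_pow two_ne_zero).zpow
      (Or.inl fun q hq => euler_ne_zero (pow_mem_ball hq two_ne_zero))
  · exact (differentiableOn_euler_pow three_ne_zero).zpow
      (Or.inl fun q hq => euler_ne_zero (pow_mem_ball hq three_ne_zero))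
  · exact (differentiableOn_euler_pow (k := 6) (by norm_num)).zpow
      (Or.inl fun q hq => euler_ne_zero (pow_mem_ball hq (by norm_num)))

lemma natCast_mul_im_pos {k : ℕ} (hk : 0 < k) {z : ℂ} (hz : 0 < z.im) : 0 < ((k : ℂ) * z).im := by
  simp; positivity

lemma etaQuot_ne_zero (r₁ r₂ r₃ r₆ : ℤ) {z : ℂ} (hz : 0 < z.im) : etaQuot r₁ r₂ r₃ r₆ z ≠ 0 := by
  have h2 := eta_ne_zero (natCast_mul_im_pos (k := 2) (by norm_num) hz)
  have h3 := eta_ne_zero (natCast_mul_im_pos (k := 3) (by norm_num) hz)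
  have h6 := eta_ne_zero (natCast_mul_im_pos (k := 6) (by norm_num) hz)
  have h1 := eta_ne_zero hz
  unfold etaQuot
  exact mul_ne_zero (mul_ne_zero (mul_ne_zero (zpow_ne_zero _ h1) (zpow_ne_zero _ h2))
    (zpow_ne_zero _ h3)) (zpow_ne_zero _ h6)

lemma differentiableOn_eta_mul {k : ℕ} (hk : 0 < k) :
    DifferentiableOn ℂ (fun z => dedekindEta (k * z)) UH := fun z hz =>
  (DifferentiableAt.comp z (differentiableAt_eta (natCast_mul_im_pos hk hz))
    (by fun_prop)).differentiableWithinAt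

lemma differentiableOn_etaQuot (r₁ r₂ r₃ r₆ : ℤ) :
    DifferentiableOn ℂ (etaQuot r₁ r₂ r₃ r₆) UH := by
  have key : ∀ k : ℕ, 0 < k → ∀ r : ℤ, DifferentiableOn ℂ (fun z => dedekindEta (k * z) ^ r) UH :=
    fun k hk r => (differentiableOn_eta_mul hk).zpow
      (Or.inl fun z hz => eta_ne_zero (natCast_mul_im_pos hk hz))
  have h1 := key 1 one_pos r₁
  simp only [Nat.cast_one, one_mul] at h1
  exact ((h1.mul (key 2 (by norm_num) r₂)).mul (key 3 (by norm_num) r₃)).mul (key 6 (by norm_num) r₆)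

lemma qc_natCast_mul (k : ℕ) (z : ℂ) : qc (k * z) = qc z ^ k := by
  unfold qc
  rw [← Complex.exp_nat_mul]
  congr 1; ring

lemma etaQuot_eq {r₁ r₂ r₃ r₆ m : ℤ} (h : r₁ + 2 * r₂ + 3 * r₃ + 6 * r₆ = 24 * m) (z : ℂ) :
    etaQuot r₁ r₂ r₃ r₆ z = qc z ^ m * eulerQuot r₁ r₂ r₃ r₆ (qc z) := by
  have key : ∀ (k : ℕ) (r : ℤ), dedekindEta (k * z) ^ r =
      exp (r * (k * (Real.pi * I * z / 12))) * euler (qc z ^ k) ^ r := by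
    intro k r
    rw [dedekindEta_eq, mul_zpow, qc_natCast_mul, ← Complex.exp_int_mul]
    congr 2; ring
  have h1 := key 1 r₁
  simp only [Nat.cast_one, one_mul, pow_one] at h1
  have hq : qc z ^ m = exp (r₁ * (Real.pi * I * z / 12)) *
      exp (r₂ * ((2 : ℕ) * (Real.pi * I * z / 12))) * exp (r₃ * ((3 : ℕ) * (Real.pi * I * z / 12))) *
      exp (r₆ * ((6 : ℕ) * (Real.pi * I * z / 12))) := by
    rw [qc, ← Complex.exp_int_mul, ← Complex.exp_add, ← Complex.exp_add, ← Complex.exp_add]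
    congr 1
    have : (r₁ : ℂ) + 2 * r₂ + 3 * r₃ + 6 * r₆ = 24 * m := by exact_mod_cast h
    push_cast
    linear_combination (-(Real.pi * I * z / 12)) * this
  rw [hq, etaQuot, eulerQuot, h1]
  have h2 := key 2 r₂
  have h3 := key 3 r₃
  have h6 := key 6 r₆
  simp only [Nat.cast_ofNat] at h2 h3 h6 ⊢
  rw [h2, h3, h6]
  ring

lemma constant_of_pow_eq {h : ℂ → ℂ} (hc : ContinuousOn h UH) {K : ℂ} {n : ℕ} (hn : 0 < n)
    (hK : ∀ z ∈ UH, h z ^ n = K) : ∃ c, ∀ z ∈ UH, h z = c := by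
  have hfin : {x : ℂ | x ^ n = K}.Finite := by
    have := (Polynomial.nthRoots n K).toFinset.finite_toSet
    refine this.subset fun x hx => ?_
    simpa [Polynomial.mem_nthRoots hn] using hx
  have hI : I ∈ UH := by simp [UH]
  exact ⟨h I, fun z hz => isPreconnected_UH.constant_of_mapsTo hfin.isDiscrete hc hK hz hI⟩

/-- The transformation behaviour of eta quotients under an Atkin–Lehner matrix, provided that
of the individual factors. -/
lemma etaQuot_W_of_perm (e : ℕ) {r₁ r₂ r₃ r₆ s₁ s₂ s₃ s₆ k : ℤ} (hs : r₁ + r₂ + r₃ + r₆ = 2 * k)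
    (σ : Equiv.Perm (Fin 4)) (ρ : Fin 4 → ℂ) (hρ : ∀ i, ρ i ≠ 0)
    (hσ : ∀ i, ![s₁, s₂, s₃, s₆] (σ i) = ![r₁, r₂, r₃, r₆] i)
    (h : ∀ i, ∀ z ∈ UH, dedekindEta (![1, 2, 3, 6] i * mob (W e) z) ^ 24 =
      (ρ i * den (W e) z) ^ 12 * dedekindEta (![1, 2, 3, 6] (σ i) * z) ^ 24) :
    ∃ c : ℂ, c ≠ 0 ∧ ∀ z : ℂ, 0 < z.im →
      etaQuot r₁ r₂ r₃ r₆ (mob (W e) z) = c * den (W e) z ^ k * etaQuot s₁ s₂ s₃ s₆ z := by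
  have hprod : ∀ (r₁ r₂ r₃ r₆ : ℤ) z, etaQuot r₁ r₂ r₃ r₆ z =
      ∏ i : Fin 4, dedekindEta (![1, 2, 3, 6] i * z) ^ (![r₁, r₂, r₃, r₆] i) := by
    intro r₁ r₂ r₃ r₆ z
    simp [Fin.prod_univ_four, etaQuot]
  have hsum : ∑ i, ![r₁, r₂, r₃, r₆] i = 2 * k := by rw [Fin.sum_univ_four]; simpa using hs
  set K : ℂ := ∏ i, (ρ i ^ 12) ^ (![r₁, r₂, r₃, r₆] i) with hK
  set g : ℂ → ℂ := fun z => etaQuot r₁ r₂ r₃ r₆ (mob (W e) z) /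
    (den (W e) z ^ k * etaQuot s₁ s₂ s₃ s₆ z) with hg
  have hden : ∀ z ∈ UH, den (W e) z ≠ 0 := fun z hz => den_ne_zero (W_det_pos e) hz
  have hgc : ContinuousOn g UH := by
    refine ContinuousOn.div ?_ (ContinuousOn.mul ?_ ?_) ?_
    · exact (differentiableOn_comp_mob (differentiableOn_etaQuot _ _ _ _) (W_det_pos e)).continuousOn
    · refine ContinuousOn.zpow₀ (by unfold den; fun_prop) _ fun z hz => Or.inl (hden z hz)
    · exact (differentiableOn_etaQuot _ _ _ _).continuousOn
    · exact fun z hz => mul_ne_zero (zpow_ne_zero _ (hden z hz)) (etaQuot_ne_zero _ _ _ _ hz)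
  have hgK : ∀ z ∈ UH, g z ^ 24 = K := by
    intro z hz
    have hd := hden z hz
    have hne := etaQuot_ne_zero s₁ s₂ s₃ s₆ hz
    have h1 : etaQuot r₁ r₂ r₃ r₆ (mob (W e) z) ^ 24 =
        K * (den (W e) z ^ k * etaQuot s₁ s₂ s₃ s₆ z) ^ 24 := by
      have h2 : (den (W e) z ^ k) ^ 24 = ∏ i, (den (W e) z ^ 12) ^ (![r₁, r₂, r₃, r₆] i) := by
        have : ∀ s : Finset (Fin 4), ∏ i ∈ s, (den (W e) z ^ 12) ^ (![r₁, r₂, r₃, r₆] i) =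
            (den (W e) z ^ 12) ^ (∑ i ∈ s, ![r₁, r₂, r₃, r₆] i) := by
          intro s
          induction s using Finset.induction_on with
          | empty => simp
          | insert a s ha ih =>
            rw [Finset.prod_insert ha, Finset.sum_insert ha, ih, zpow_add₀ (pow_ne_zero _ hd)]
        rw [this, hsum, ← zpow_natCast, ← zpow_natCast, ← _root_.zpow_mul, ← _root_.zpow_mul]
        congr 1; push_cast; ring
      rw [mul_pow, h2, hprod, hprod, ← Finset.prod_pow, ← Finset.prod_pow, hK,
        ← Equiv.prod_comp σ (fun i => (dedekindEta (![1, 2, 3, 6] i * z) ^ _) ^ 24),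
        ← Finset.prod_mul_distrib, ← Finset.prod_mul_distrib]
      refine Finset.prod_congr rfl fun i _ => ?_
      rw [hσ i]
      have hpow : ∀ (x : ℂ) (r : ℤ), (x ^ r) ^ 24 = (x ^ 24) ^ r := by
        intro x r
        rw [← zpow_natCast, ← zpow_natCast, ← _root_.zpow_mul, ← _root_.zpow_mul, mul_comm]
      rw [hpow, hpow, h i z hz, ← mul_assoc, ← mul_zpow, ← mul_zpow, mul_pow]
    rw [hg]
    simp only
    rw [div_pow, h1, mul_div_cancel_right₀]
    exact pow_ne_zero _ (mul_ne_zero (zpow_ne_zero _ hd) hne)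
  obtain ⟨c, hc⟩ := constant_of_pow_eq hgc (by norm_num) hgK
  have hI : I ∈ UH := by simp [UH]
  refine ⟨c, ?_, fun z hz => ?_⟩
  · rintro rfl
    have h1 := hgK I hI
    rw [hc I hI, zero_pow (by norm_num)] at h1
    exact Finset.prod_ne_zero_iff.2 (fun i _ => zpow_ne_zero _ (pow_ne_zero _ (hρ i))) h1.symm
  · rw [← hc z hz, hg]
    have hne := etaQuot_ne_zero s₁ s₂ s₃ s₆ hz
    have := zpow_ne_zero k (hden z hz)
    field_simp

/-- `η²⁴` at `t = γ w` in terms of `w`, with a rescaled automorphy factor. -/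
lemma eta_pow_of_eq {a b c d : ℤ} (hdet : a * d - b * c = 1) {w t ρ D : ℂ} (hw : 0 < w.im)
    (hden : (c : ℂ) * w + d = ρ * D) (hnum : t * (ρ * D) = a * w + b) :
    dedekindEta t ^ 24 = (ρ * D) ^ 12 * dedekindEta w ^ 24 := by
  have h3 : (c : ℂ) * w + d ≠ 0 :=
    den_ne_zero (M := !![a, b; c, d]) (by rw [det_fin_two_of]; linarith) hw
  rw [← hden, ← eta_pow_mob hdet hw]
  congr 2
  rw [eq_div_iff h3, hden, hnum]


lemma etaQuot_W_two {r₁ r₂ r₃ r₆ k : ℤ} (hs : r₁ + r₂ + r₃ + r₆ = 2 * k) :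
    ∃ c : ℂ, c ≠ 0 ∧ ∀ z : ℂ, 0 < z.im →
      etaQuot r₁ r₂ r₃ r₆ (mob (W 2) z) = c * den (W 2) z ^ k * etaQuot r₂ r₁ r₆ r₃ z := by
  refine etaQuot_W_of_perm 2 hs (Equiv.swap 0 1 * Equiv.swap 2 3) ![1, 1 / 2, 1, 1 / 2] ?_ ?_ ?_
  · intro i; fin_cases i <;> simp
  · intro i; fin_cases i <;> simp [Equiv.swap_apply_def]
  · intro i z hz
    have hz : 0 < z.im := hz
    have hd : (6 * z - 2 : ℂ) ≠ 0 := by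
      have := den_ne_zero (W_det_pos 2) hz
      simpa [den, W_two, sub_eq_add_neg] using this
    have hd' : (z * 6 - 2 : ℂ) ≠ 0 := by rwa [mul_comm]
    fin_cases i
    · refine eta_pow_of_eq (a := 1) (b := -1) (c := 3) (d := -2) (by norm_num) ?_ ?_ ?_ <;>
        simp [Equiv.swap_apply_def, mob, den, W_two, ← sub_eq_add_neg, hz] <;> field_simp <;> ring
    · refine eta_pow_of_eq (a := 2) (b := -1) (c := 3) (d := -1) (by norm_num) ?_ ?_ ?_ <;>
        simp [Equiv.swap_apply_def, mob, den, W_two, ← sub_eq_add_neg, hz] <;> field_simp <;> ring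
    · refine eta_pow_of_eq (a := 1) (b := -3) (c := 1) (d := -2) (by norm_num) ?_ ?_ ?_ <;>
        simp [Equiv.swap_apply_def, mob, den, W_two, ← sub_eq_add_neg, hz] <;> field_simp <;> ring
    · refine eta_pow_of_eq (a := 2) (b := -3) (c := 1) (d := -1) (by norm_num) ?_ ?_ ?_ <;>
        simp [Equiv.swap_apply_def, mob, den, W_two, ← sub_eq_add_neg, hz] <;> field_simp <;> ring

lemma etaQuot_W_three {r₁ r₂ r₃ r₆ k : ℤ} (hs : r₁ + r₂ + r₃ + r₆ = 2 * k) :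
    ∃ c : ℂ, c ≠ 0 ∧ ∀ z : ℂ, 0 < z.im →
      etaQuot r₁ r₂ r₃ r₆ (mob (W 3) z) = c * den (W 3) z ^ k * etaQuot r₃ r₆ r₁ r₂ z := by
  refine etaQuot_W_of_perm 3 hs (Equiv.swap 0 2 * Equiv.swap 1 3) ![1, 1, 1 / 3, 1 / 3] ?_ ?_ ?_
  · intro i; fin_cases i <;> simp
  · intro i; fin_cases i <;> simp [Equiv.swap_apply_def]
  · intro i z hz
    have hz : 0 < z.im := hz
    have hd : (6 * z - 3 : ℂ) ≠ 0 := by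
      have := den_ne_zero (W_det_pos 3) hz
      simpa [den, W_three, sub_eq_add_neg] using this
    have hd' : (z * 6 - 3 : ℂ) ≠ 0 := by rwa [mul_comm]
    fin_cases i
    · refine eta_pow_of_eq (a := 1) (b := -2) (c := 2) (d := -3) (by norm_num) ?_ ?_ ?_ <;>
        simp [Equiv.swap_apply_def, mob, den, W_three, ← sub_eq_add_neg, hz] <;> field_simp <;> ring
    · refine eta_pow_of_eq (a := 1) (b := -4) (c := 1) (d := -3) (by norm_num) ?_ ?_ ?_ <;>
        simp [Equiv.swap_apply_def, mob, den, W_three, ← sub_eq_add_neg, hz] <;> field_simp <;> ring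
    · refine eta_pow_of_eq (a := 3) (b := -2) (c := 2) (d := -1) (by norm_num) ?_ ?_ ?_ <;>
        simp [Equiv.swap_apply_def, mob, den, W_three, ← sub_eq_add_neg, hz] <;> field_simp <;> ring
    · refine eta_pow_of_eq (a := 3) (b := -4) (c := 1) (d := -1) (by norm_num) ?_ ?_ ?_ <;>
        simp [Equiv.swap_apply_def, mob, den, W_three, ← sub_eq_add_neg, hz] <;> field_simp <;> ring

lemma etaQuot_W_six {r₁ r₂ r₃ r₆ k : ℤ} (hs : r₁ + r₂ + r₃ + r₆ = 2 * k) :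
    ∃ c : ℂ, c ≠ 0 ∧ ∀ z : ℂ, 0 < z.im →
      etaQuot r₁ r₂ r₃ r₆ (mob (W 6) z) = c * den (W 6) z ^ k * etaQuot r₆ r₃ r₂ r₁ z := by
  refine etaQuot_W_of_perm 6 hs (Equiv.swap 0 3 * Equiv.swap 1 2) ![1, 1 / 2, 1 / 3, 1 / 6] ?_ ?_ ?_
  · intro i; fin_cases i <;> simp
  · intro i; fin_cases i <;> simp [Equiv.swap_apply_def]
  · intro i z hz
    have hz : 0 < z.im := hz
    have hd : z ≠ 0 := by rintro rfl; simp at hz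
    fin_cases i <;>
      refine eta_pow_of_eq (a := 0) (b := -1) (c := 1) (d := 0) (by norm_num) ?_ ?_ ?_ <;>
        simp [Equiv.swap_apply_def, mob, den, W_six, hz] <;> field_simp <;> ring

/-- `G = C + o(q²)` at `i∞`. -/
def Near (G : ℂ → ℂ) (C : ℂ) : Prop := (fun z => G z - C) =o[atInf] fun z => qc z ^ 2

lemma tendsto_qc_pow {k : ℕ} (hk : k ≠ 0) : Tendsto (fun z => qc z ^ k) atInf (𝓝 0) := by
  simpa [hk] using tendsto_qc'.pow k

lemma Near.tendsto {G : ℂ → ℂ} {C : ℂ} (h : Near G C) : Tendsto G atInf (𝓝 C) := by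
  have := (h.isBigO.trans_tendsto (tendsto_qc_pow two_ne_zero)).add_const C
  simpa using this

lemma Near.mul {G H : ℂ → ℂ} {C D : ℂ} (h : Near G C) (h' : Near H D) :
    Near (fun z => G z * H z) (C * D) := by
  have h1 : (fun z => (G z - C) * H z) =o[atInf] fun z => qc z ^ 2 * 1 :=
    h.mul_isBigO (h'.tendsto.isBigO_one ℂ)
  have h2 : (fun z => C * (H z - D)) =o[atInf] fun z => qc z ^ 2 := h'.const_mul_left C
  simp only [mul_one] at h1
  refine (h1.add h2).congr_left fun z => ?_
  ring

lemma Near.inv {G : ℂ → ℂ} {C : ℂ} (h : Near G C) (hC : C ≠ 0) :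
    Near (fun z => (G z)⁻¹) C⁻¹ := by
  have h1 : (fun z => (G z - C) * (-(G z)⁻¹ * C⁻¹)) =o[atInf] fun z => qc z ^ 2 * 1 :=
    h.mul_isBigO ((((h.tendsto.inv₀ hC).neg).mul_const C⁻¹).isBigO_one ℂ)
  simp only [mul_one] at h1
  refine h1.congr' ?_ EventuallyEq.rfl
  filter_upwards [h.tendsto.eventually_ne hC] with z hz
  field_simp
  ring

lemma near_const (C : ℂ) : Near (fun _ => C) C := by
  simp [Near]

lemma Near.congr' {G H : ℂ → ℂ} {C : ℂ} (h : Near G C) (hGH : ∀ᶠ z in atInf, G z = H z) : Near H C :=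
  IsLittleO.congr' h (hGH.mono fun z hz => by simp [hz]) EventuallyEq.rfl

lemma eventually_pos : ∀ᶠ z : ℂ in atInf, 0 < z.im := eventually_im_gt 0

/-- `F = C q⁻ᴺ exp(a q + L q²) (1 + o(q²))` at `i∞`. -/
def Jet (F : ℂ → ℂ) (C : ℂ) (N : ℤ) (a L : ℂ) : Prop :=
  Near (fun z => F z * qc z ^ N * exp (-(a * qc z + L * qc z ^ 2))) C

lemma Jet.congr' {F G : ℂ → ℂ} {C a L : ℂ} {N : ℤ} (h : Jet F C N a L)
    (hFG : ∀ᶠ z in atInf, F z = G z) : Jet G C N a L :=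
  Near.congr' h (hFG.mono fun z hz => by simp [hz])

lemma Jet.mul {F G : ℂ → ℂ} {C D a b L M : ℂ} {N K : ℤ} (h : Jet F C N a L) (h' : Jet G D K b M) :
    Jet (fun z => F z * G z) (C * D) (N + K) (a + b) (L + M) := by
  refine (Near.mul h h').congr' (Eventually.of_forall fun z => ?_)
  rw [zpow_add₀ (qc_ne_zero z), show -((a + b) * qc z + (L + M) * qc z ^ 2) =
    -(a * qc z + L * qc z ^ 2) + -(b * qc z + M * qc z ^ 2) by ring, Complex.exp_add]
  ring

lemma Jet.inv {F : ℂ → ℂ} {C a L : ℂ} {N : ℤ} (h : Jet F C N a L) (hC : C ≠ 0) :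
    Jet (fun z => (F z)⁻¹) C⁻¹ (-N) (-a) (-L) := by
  refine (Near.inv h hC).congr' (Eventually.of_forall fun z => ?_)
  rw [mul_inv, mul_inv, _root_.zpow_neg, ← Complex.exp_neg]
  congr 2
  ring

lemma jet_const (C : ℂ) : Jet (fun _ => C) C 0 0 0 := by
  simpa [Jet] using near_const C

lemma Jet.pow {F : ℂ → ℂ} {C a L : ℂ} {N : ℤ} (h : Jet F C N a L) (k : ℕ) :
    Jet (fun z => F z ^ k) (C ^ k) (k * N) (k * a) (k * L) := by
  induction k with
  | zero => simpa using jet_const 1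
  | succ k ih =>
    have := ih.mul h
    simp only [← pow_succ] at this
    convert this using 1 <;> push_cast <;> ring

lemma Jet.zpow {F : ℂ → ℂ} {C a L : ℂ} {N : ℤ} (h : Jet F C N a L) (hC : C ≠ 0) (k : ℤ) :
    Jet (fun z => F z ^ k) (C ^ k) (k * N) (k * a) (k * L) := by
  rcases Int.eq_nat_or_neg k with ⟨n, rfl | rfl⟩
  · simpa using h.pow n
  · have := (h.pow n).inv (pow_ne_zero n hC)
    simpa using this

lemma Jet.prod {ι : Type*} (s : Finset ι) {F : ι → ℂ → ℂ} {C a L : ι → ℂ} {N : ι → ℤ}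
    (h : ∀ i ∈ s, Jet (F i) (C i) (N i) (a i) (L i)) :
    Jet (fun z => ∏ i ∈ s, F i z) (∏ i ∈ s, C i) (∑ i ∈ s, N i) (∑ i ∈ s, a i) (∑ i ∈ s, L i) := by
  classical
  induction s using Finset.induction_on with
  | empty => simpa using jet_const 1
  | insert i s hi ih =>
    have := (h i (Finset.mem_insert_self i s)).mul
      (ih fun j hj => h j (Finset.mem_insert_of_mem hj))
    simpa only [Finset.prod_insert hi, Finset.sum_insert hi] using this

lemma exp_expansion (a L : ℂ) :
    (fun z => exp (a * qc z + L * qc z ^ 2) - (1 + a * qc z + (L + a ^ 2 / 2) * qc z ^ 2))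
      =o[atInf] fun z => qc z ^ 2 := by
  have hx : Tendsto (fun z => a * qc z + L * qc z ^ 2) atInf (𝓝 0) := by
    simpa using (tendsto_qc'.const_mul a).add ((tendsto_qc_pow two_ne_zero).const_mul L)
  have h1 := (Complex.exp_sub_sum_range_isBigO_pow 3).comp_tendsto hx
  have hq3 : (fun z => qc z ^ 3) =o[atInf] fun z => qc z ^ 2 := by
    have : (fun z => qc z ^ 2 * qc z) =o[atInf] fun z => qc z ^ 2 * 1 :=
      (isBigO_refl _ _).mul_isLittleO ((isLittleO_one_iff ℂ).2 tendsto_qc')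
    simpa [← pow_succ] using this
  have hxq : (fun z => a * qc z + L * qc z ^ 2) =O[atInf] qc := by
    have : (fun z => (a + L * qc z) * qc z) =O[atInf] fun z => 1 * qc z := by
      refine IsBigO.mul ?_ (isBigO_refl _ _)
      exact (((tendsto_qc'.const_mul L).const_add a).isBigO_one ℂ)
    simp only [one_mul] at this
    exact this.congr_left fun z => by ring
  have h2 : (fun z => exp (a * qc z + L * qc z ^ 2) - (1 + (a * qc z + L * qc z ^ 2) +
      (a * qc z + L * qc z ^ 2) ^ 2 / 2)) =o[atInf] fun z => qc z ^ 2 := by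
    refine ((h1.trans (hxq.pow 3)).trans_isLittleO hq3).congr_left fun z => ?_
    simp [Finset.sum_range_succ]
  have h3 : (fun z => (a * L + L ^ 2 / 2 * qc z) * qc z ^ 3) =o[atInf] fun z => 1 * qc z ^ 2 :=
    IsBigO.mul_isLittleO ((((tendsto_qc'.const_mul (L ^ 2 / 2)).const_add (a * L)).isBigO_one ℂ)) hq3
  simp only [one_mul] at h3
  refine (h2.add h3).congr_left fun z => ?_
  ring

lemma Jet.expansion {F : ℂ → ℂ} {C a L : ℂ} {N : ℤ} (h : Jet F C N a L) :
    (fun z => F z * qc z ^ N - C * (1 + a * qc z + (L + a ^ 2 / 2) * qc z ^ 2))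
      =o[atInf] fun z => qc z ^ 2 := by
  have hexp : Tendsto (fun z => exp (a * qc z + L * qc z ^ 2)) atInf (𝓝 (exp 0)) := by
    refine (Complex.continuous_exp.tendsto 0).comp ?_
    simpa using (tendsto_qc'.const_mul a).add ((tendsto_qc_pow two_ne_zero).const_mul L)
  have h1 : (fun z => (F z * qc z ^ N * exp (-(a * qc z + L * qc z ^ 2)) - C) *
      exp (a * qc z + L * qc z ^ 2)) =o[atInf] fun z => qc z ^ 2 * 1 :=
    IsLittleO.mul_isBigO h (hexp.isBigO_one ℂ)
  simp only [mul_one] at h1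
  refine (h1.add ((exp_expansion a L).const_mul_left C)).congr_left fun z => ?_
  rw [Complex.exp_neg]
  have := Complex.exp_ne_zero (a * qc z + L * qc z ^ 2)
  field_simp
  ring

lemma jet_of_expansion {F : ℂ → ℂ} {C a b : ℂ} {N : ℤ}
    (h : (fun z => F z * qc z ^ N - C * (1 + a * qc z + b * qc z ^ 2))
      =o[atInf] fun z => qc z ^ 2) : Jet F C N a (b - a ^ 2 / 2) := by
  have hexp : Tendsto (fun z => exp (-(a * qc z + (b - a ^ 2 / 2) * qc z ^ 2))) atInf (𝓝 (exp 0)) := by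
    refine (Complex.continuous_exp.tendsto 0).comp ?_
    simpa using ((tendsto_qc'.const_mul a).add
      ((tendsto_qc_pow two_ne_zero).const_mul (b - a ^ 2 / 2))).neg
  have h1 := ((exp_expansion a (b - a ^ 2 / 2)).const_mul_left C)
  have h2 : (fun z => (F z * qc z ^ N - C * exp (a * qc z + (b - a ^ 2 / 2) * qc z ^ 2)) *
      exp (-(a * qc z + (b - a ^ 2 / 2) * qc z ^ 2))) =o[atInf] fun z => qc z ^ 2 * 1 := by
    refine IsLittleO.mul_isBigO ((h.sub h1).congr_left fun z => ?_) (hexp.isBigO_one ℂ)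
    ring
  simp only [mul_one] at h2
  refine IsLittleO.congr_left h2 fun z => ?_
  simp only [Complex.exp_neg]
  have := Complex.exp_ne_zero (a * qc z + (b - a ^ 2 / 2) * qc z ^ 2)
  rw [sub_mul, mul_assoc C, mul_inv_cancel₀ this, mul_one]

lemma Jet.unique {F : ℂ → ℂ} {C D a b L M : ℂ} {N K : ℤ} (h : Jet F C N a L) (h' : Jet F D K b M)
    (hC : C ≠ 0) (hD : D ≠ 0) : N = K ∧ a = b ∧ L = M := by
  have hneg : ∀ {C D a b L M : ℂ} {N K : ℤ}, Jet F C N a L → Jet F D K b M → C ≠ 0 → D ≠ 0 →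
      ¬ N < K := by
    intro C D a b L M N K h h' hC hD hlt
    have h1 := h'.mul (h.inv hC)
    have h2 : Tendsto (fun z => F z * (F z)⁻¹) atInf (𝓝 1) := by
      have hne : ∀ᶠ z in atInf, F z ≠ 0 := by
        filter_upwards [(Near.tendsto h).eventually_ne hC] with z hz h0
        simp [h0] at hz
      exact tendsto_const_nhds.congr' (hne.mono fun z hz => (mul_inv_cancel₀ hz).symm)
    have hexp : Tendsto (fun z => exp (-((b + -a) * qc z + (M + -L) * qc z ^ 2))) atInf (𝓝 (exp 0)) := by
      refine (Complex.continuous_exp.tendsto 0).comp ?_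
      simpa using ((tendsto_qc'.const_mul (b + -a)).add
        ((tendsto_qc_pow two_ne_zero).const_mul (M + -L))).neg
    obtain ⟨k, hk⟩ : ∃ k : ℕ, K + -N = k := ⟨(K - N).toNat, by omega⟩
    have hk0 : k ≠ 0 := by omega
    have h3 := (h2.mul (tendsto_qc_pow hk0)).mul hexp
    have h4 := Near.tendsto h1
    rw [hk] at h4
    simp only [zpow_natCast] at h4
    have := tendsto_nhds_unique h3 h4
    simp at this
    exact this.elim hD hC
  have hNK : N = K := le_antisymm (not_lt.1 (hneg h' h hD hC)) (not_lt.1 (hneg h h' hC hD))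
  subst hNK
  have e1 := h.expansion.sub h'.expansion
  have key : ∀ {α β γ : ℂ}, (fun z => α + β * qc z + γ * qc z ^ 2) =o[atInf] (fun z => qc z ^ 2) →
      α = 0 ∧ β = 0 ∧ γ = 0 := by
    intro α β γ ho
    have hα : α = 0 := by
      have t1 : Tendsto (fun z => α + β * qc z + γ * qc z ^ 2) atInf (𝓝 0) :=
        ho.isBigO.trans_tendsto (tendsto_qc_pow two_ne_zero)
      have t2 : Tendsto (fun z => α + β * qc z + γ * qc z ^ 2) atInf (𝓝 (α + β * 0 + γ * 0)) :=
        ((tendsto_qc'.const_mul β).const_add α).add ((tendsto_qc_pow two_ne_zero).const_mul γ)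
      simpa using tendsto_nhds_unique t2 t1
    subst hα
    have t0 := ho.tendsto_div_nhds_zero
    have hβ : β = 0 := by
      have t1 := t0.mul tendsto_qc'
      have t2 : Tendsto (fun z => β + γ * qc z) atInf (𝓝 (β + γ * 0)) :=
        (tendsto_qc'.const_mul γ).const_add β
      have t3 := t2.congr' (f₂ := fun x => (0 + β * qc x + γ * qc x ^ 2) / qc x ^ 2 * qc x) ?_
      · simpa using tendsto_nhds_unique t3 t1
      refine Eventually.of_forall fun z => ?_
      have := qc_ne_zero z
      field_simp
      ring
    subst hβ
    refine ⟨rfl, rfl, ?_⟩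
    refine tendsto_nhds_unique (tendsto_const_nhds (x := γ)) (t0.congr fun z => ?_)
    have := qc_ne_zero z
    field_simp
    ring
  obtain ⟨h1, h2, h3⟩ := key (α := C - D) (β := C * a - D * b)
    (γ := C * (L + a ^ 2 / 2) - D * (M + b ^ 2 / 2)) (e1.neg_left.congr_left fun z => by ring)
  obtain rfl : C = D := sub_eq_zero.1 h1
  have hab : a = b := mul_left_cancel₀ hC (sub_eq_zero.1 h2)
  subst hab
  refine ⟨rfl, rfl, ?_⟩
  have := mul_left_cancel₀ hC (sub_eq_zero.1 h3)
  exact add_right_cancel this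

lemma qc_pow_three_isLittleO : (fun z => qc z ^ 3) =o[atInf] fun z => qc z ^ 2 := by
  have : (fun z => qc z ^ 2 * qc z) =o[atInf] fun z => qc z ^ 2 * 1 :=
    (isBigO_refl _ _).mul_isLittleO ((isLittleO_one_iff ℂ).2 tendsto_qc')
  simpa [← pow_succ] using this

lemma jet_euler_pow {k : ℕ} (hk : k ≠ 0) : Jet (fun z => euler (qc z ^ k)) 1 0
    (if k = 1 then -1 else 0) (if k = 1 then -3 / 2 else if k = 2 then -1 else 0) := by
  have h1 : (fun q : ℂ => euler q - (1 - q) * (1 - q ^ 2)) =O[𝓝 0] fun q => q ^ 3 := by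
    refine IsBigO.of_bound 16 ?_
    filter_upwards [Metric.closedBall_mem_nhds (0 : ℂ) (show (0 : ℝ) < 1 / 2 by norm_num)] with q hq
    rw [norm_pow]
    exact norm_euler_sub_le (by simpa using hq)
  have h2 := h1.comp_tendsto (tendsto_qc_pow hk)
  have h3 : (fun z => (qc z ^ k) ^ 3) =O[atInf] fun z => qc z ^ 3 := by
    have : (fun z => (qc z ^ (k - 1)) ^ 3 * qc z ^ 3) =O[atInf] fun z => 1 * qc z ^ 3 := by
      refine IsBigO.mul ?_ (isBigO_refl _ _)
      exact ((tendsto_qc'.pow (k - 1)).pow 3).isBigO_one ℂ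
    simp only [one_mul] at this
    refine this.congr_left fun z => ?_
    rw [← mul_pow, ← pow_succ, Nat.sub_add_cancel (Nat.one_le_iff_ne_zero.2 hk)]
  have h4 := (h2.trans h3).trans_isLittleO qc_pow_three_isLittleO
  have main : (fun z => euler (qc z ^ k) - (1 + (if k = 1 then -1 else 0) * qc z +
      (if k = 1 then -1 else if k = 2 then -1 else 0) * qc z ^ 2)) =o[atInf] fun z => qc z ^ 2 := by
    have h5 : ∀ m : ℕ, 3 ≤ m → (fun z => qc z ^ m) =o[atInf] fun z => qc z ^ 2 := by
      intro m hm
      have : (fun z => qc z ^ (m - 3) * qc z ^ 3) =o[atInf] fun z => 1 * qc z ^ 2 :=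
        ((tendsto_qc'.pow (m - 3)).isBigO_one ℂ).mul_isLittleO qc_pow_three_isLittleO
      simpa [← pow_add, Nat.sub_add_cancel hm] using this
    have h6 : ∀ z, (1 - qc z ^ k) * (1 - (qc z ^ k) ^ 2) = 1 - qc z ^ k - qc z ^ (2 * k) +
        qc z ^ (3 * k) := by intro z; ring
    rcases lt_trichotomy k 2 with h | rfl | h
    · obtain rfl : k = 1 := by omega
      refine (h4.add (h5 3 le_rfl)).congr_left fun z => ?_
      simp
      ring
    · refine ((h4.sub (h5 4 (by norm_num))).add (h5 6 (by norm_num))).congr_left fun z => ?_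
      simp
      ring
    · refine (((h4.sub (h5 k h)).sub (h5 (2 * k) (by omega))).add
        (h5 (3 * k) (by omega))).congr_left fun z => ?_
      simp only [Function.comp, h6]
      rw [if_neg (by omega), if_neg (by omega), if_neg (by omega)]
      ring
  have := jet_of_expansion (F := fun z => euler (qc z ^ k)) (C := 1) (N := 0)
    (a := if k = 1 then -1 else 0) (b := if k = 1 then -1 else if k = 2 then -1 else 0)
    (by simpa only [zpow_zero, mul_one, one_mul] using main)
  convert this using 1
  split_ifs <;> norm_num

lemma jet_etaQuot {r₁ r₂ r₃ r₆ m : ℤ} (h : r₁ + 2 * r₂ + 3 * r₃ + 6 * r₆ = 24 * m) :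
    Jet (etaQuot r₁ r₂ r₃ r₆) 1 (-m) (-r₁) (-3 / 2 * r₁ - r₂) := by
  have hq : Jet (fun z => qc z ^ m) 1 (-m) 0 0 := by
    refine (near_const 1).congr' (Eventually.of_forall fun z => ?_)
    simp [mul_inv_cancel₀ (zpow_ne_zero m (qc_ne_zero z))]
  have h1 := (jet_euler_pow one_ne_zero).zpow one_ne_zero r₁
  have h2 := (jet_euler_pow two_ne_zero).zpow one_ne_zero r₂
  have h3 := (jet_euler_pow three_ne_zero).zpow one_ne_zero r₃
  have h6 := (jet_euler_pow (k := 6) (by norm_num)).zpow one_ne_zero r₆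
  have := (hq.mul (((h1.mul h2).mul h3).mul h6)).congr' (G := etaQuot r₁ r₂ r₃ r₆)
    (Eventually.of_forall fun z => by rw [etaQuot_eq h]; simp [eulerQuot])
  convert this using 1 <;> simp
  ring

lemma tendsto_eulerQuot (r₁ r₂ r₃ r₆ : ℤ) :
    Tendsto (fun z => eulerQuot r₁ r₂ r₃ r₆ (qc z)) atInf (𝓝 1) := by
  have h := (differentiableOn_eulerQuot r₁ r₂ r₃ r₆).continuousOn.continuousAt
    (Metric.ball_mem_nhds (0 : ℂ) one_pos)
  have h2 := h.tendsto.comp tendsto_qc'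
  rwa [eulerQuot_zero] at h2

lemma tendsto_qc_zpow {m : ℤ} (hm : 0 ≤ m) : ∃ c, Tendsto (fun z => qc z ^ m) atInf (𝓝 c) := by
  obtain ⟨k, rfl⟩ := Int.eq_ofNat_of_zero_le hm
  exact ⟨_, by simpa using tendsto_qc'.pow k⟩

lemma bddInf_etaQuot {r₁ r₂ r₃ r₆ m : ℤ} (h : r₁ + 2 * r₂ + 3 * r₃ + 6 * r₆ = 24 * m) (hm : 0 ≤ m)
    (c : ℂ) : ∃ l, Tendsto (fun z => c * etaQuot r₁ r₂ r₃ r₆ z) atInf (𝓝 l) := by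
  obtain ⟨d, hd⟩ := tendsto_qc_zpow hm
  refine ⟨_, ((hd.mul (tendsto_eulerQuot r₁ r₂ r₃ r₆)).const_mul c).congr fun z => ?_⟩
  rw [etaQuot_eq h]

lemma etaQuot_add_one {r₁ r₂ r₃ r₆ m : ℤ} (h : r₁ + 2 * r₂ + 3 * r₃ + 6 * r₆ = 24 * m) (z : ℂ) :
    etaQuot r₁ r₂ r₃ r₆ (z + 1) = etaQuot r₁ r₂ r₃ r₆ z := by
  rw [etaQuot_eq h, etaQuot_eq h, qc_add_one]

lemma etaQuot_inv {r₁ r₂ r₃ r₆ m m₃ m₆ : ℤ} (h0 : r₁ + r₂ + r₃ + r₆ = 0)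
    (h : r₁ + 2 * r₂ + 3 * r₃ + 6 * r₆ = 24 * m) (h3 : r₃ + 2 * r₆ + 3 * r₁ + 6 * r₂ = 24 * m₃)
    (h6 : r₆ + 2 * r₃ + 3 * r₂ + 6 * r₁ = 24 * m₆) : Inv (etaQuot r₁ r₂ r₃ r₆) := by
  intro γ hγ z hz
  obtain ⟨c3, -, hc3⟩ := etaQuot_W_three (k := 0) (by rw [h0, mul_zero])
  obtain ⟨c6, -, hc6⟩ := etaQuot_W_six (k := 0) (by rw [h0, mul_zero])
  refine invariant_of_periodic (fun z _ => etaQuot_add_one h z) (fun z hz => ?_) (fun z hz => ?_) hγ hz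
  · rw [hc3 _ (by simpa using hz), hc3 z hz, etaQuot_add_one h3]; simp
  · rw [hc6 _ (by simpa using hz), hc6 z hz, etaQuot_add_one h6]; simp

lemma Jet.tendsto_sub {F G : ℂ → ℂ} {a b L M : ℂ} (hF : Jet F 1 1 a L) (hG : Jet G 1 1 b M) :
    Tendsto (fun z => F z - G z) atInf (𝓝 (a - b)) := by
  have h1 := (hF.expansion.sub hG.expansion).tendsto_div_nhds_zero.mul tendsto_qc'
  have h2 : Tendsto (fun z => (a - b) + ((L + a ^ 2 / 2) - (M + b ^ 2 / 2)) * qc z) atInf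
      (𝓝 ((a - b) + ((L + a ^ 2 / 2) - (M + b ^ 2 / 2)) * 0)) :=
    (tendsto_qc'.const_mul _).const_add _
  have h3 := h1.add h2
  simp only [mul_zero, zero_add, add_zero] at h3
  refine h3.congr fun z => ?_
  have := qc_ne_zero z
  rw [zpow_one]
  field_simp
  ring

lemma forall_E6 {p : ℕ → Prop} (h1 : p 1) (h2 : p 2) (h3 : p 3) (h6 : p 6) : ∀ e ∈ E6, p e := by
  intro e he
  simp only [E6, Finset.mem_insert, Finset.mem_singleton] at he
  rcases he with rfl | rfl | rfl | rfl <;> assumption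

lemma etaQuot_sub_eq {r₁ r₂ r₃ r₆ s₁ s₂ s₃ s₆ m₂ m₃ m₆ n₂ n₃ n₆ : ℤ}
    (hr : r₁ + r₂ + r₃ + r₆ = 0) (hs : s₁ + s₂ + s₃ + s₆ = 0)
    (hr1 : r₁ + 2 * r₂ + 3 * r₃ + 6 * r₆ = 24 * (-1)) (hs1 : s₁ + 2 * s₂ + 3 * s₃ + 6 * s₆ = 24 * (-1))
    (hr2 : r₂ + 2 * r₁ + 3 * r₆ + 6 * r₃ = 24 * m₂) (hs2 : s₂ + 2 * s₁ + 3 * s₆ + 6 * s₃ = 24 * n₂)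
    (hr3 : r₃ + 2 * r₆ + 3 * r₁ + 6 * r₂ = 24 * m₃) (hs3 : s₃ + 2 * s₆ + 3 * s₁ + 6 * s₂ = 24 * n₃)
    (hr6 : r₆ + 2 * r₃ + 3 * r₂ + 6 * r₁ = 24 * m₆) (hs6 : s₆ + 2 * s₃ + 3 * s₂ + 6 * s₁ = 24 * n₆)
    (hm : 0 ≤ m₂ ∧ 0 ≤ m₃ ∧ 0 ≤ m₆ ∧ 0 ≤ n₂ ∧ 0 ≤ n₃ ∧ 0 ≤ n₆) {z : ℂ} (hz : 0 < z.im) :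
    etaQuot r₁ r₂ r₃ r₆ z - etaQuot s₁ s₂ s₃ s₆ z = s₁ - r₁ := by
  have hlim : Tendsto (fun z => etaQuot r₁ r₂ r₃ r₆ z - etaQuot s₁ s₂ s₃ s₆ z) atInf (𝓝 (s₁ - r₁)) := by
    have j1 := jet_etaQuot hr1
    have j2 := jet_etaQuot hs1
    rw [neg_neg] at j1 j2
    have := j1.tendsto_sub j2
    rwa [show (-r₁ - -s₁ : ℂ) = s₁ - r₁ by ring] at this
  have hinv : Inv (fun z => etaQuot r₁ r₂ r₃ r₆ z - etaQuot s₁ s₂ s₃ s₆ z) := fun γ hγ z hz => by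
    simp only [etaQuot_inv hr hr1 hr3 hr6 γ hγ z hz, etaQuot_inv hs hs1 hs3 hs6 γ hγ z hz]
  obtain ⟨hm2, hm3, hm6, hn2, hn3, hn6⟩ := hm
  have hW : ∀ e ∈ E6, BddInf (fun z => etaQuot r₁ r₂ r₃ r₆ (mob (W e) z) -
      etaQuot s₁ s₂ s₃ s₆ (mob (W e) z)) := by
    refine forall_E6 ?_ ?_ ?_ ?_
    · simp only [W_one, mob_one]
      exact BddInf.of_tendsto hlim
    · obtain ⟨c, -, hc⟩ := etaQuot_W_two (k := 0) (by rw [hr, mul_zero])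
      obtain ⟨d, -, hd⟩ := etaQuot_W_two (k := 0) (by rw [hs, mul_zero])
      obtain ⟨l, hl⟩ := bddInf_etaQuot hr2 hm2 c
      obtain ⟨l', hl'⟩ := bddInf_etaQuot hs2 hn2 d
      refine BddInf.of_tendsto ((hl.sub hl').congr' (eventually_pos.mono fun z hz => ?_))
      dsimp only
      rw [hc z hz, hd z hz]; simp
    · obtain ⟨c, -, hc⟩ := etaQuot_W_three (k := 0) (by rw [hr, mul_zero])
      obtain ⟨d, -, hd⟩ := etaQuot_W_three (k := 0) (by rw [hs, mul_zero])
      obtain ⟨l, hl⟩ := bddInf_etaQuot hr3 hm3 c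
      obtain ⟨l', hl'⟩ := bddInf_etaQuot hs3 hn3 d
      refine BddInf.of_tendsto ((hl.sub hl').congr' (eventually_pos.mono fun z hz => ?_))
      dsimp only
      rw [hc z hz, hd z hz]; simp
    · obtain ⟨c, -, hc⟩ := etaQuot_W_six (k := 0) (by rw [hr, mul_zero])
      obtain ⟨d, -, hd⟩ := etaQuot_W_six (k := 0) (by rw [hs, mul_zero])
      obtain ⟨l, hl⟩ := bddInf_etaQuot hr6 hm6 c
      obtain ⟨l', hl'⟩ := bddInf_etaQuot hs6 hn6 d
      refine BddInf.of_tendsto ((hl.sub hl').congr' (eventually_pos.mono fun z hz => ?_))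
      dsimp only
      rw [hc z hz, hd z hz]; simp
  obtain ⟨c, hc⟩ := eq_const_of_bdd
    ((differentiableOn_etaQuot r₁ r₂ r₃ r₆).sub (differentiableOn_etaQuot s₁ s₂ s₃ s₆)) hinv hW
  have := tendsto_nhds_unique (tendsto_const_nhds (x := c))
    (hlim.congr' (eventually_pos.mono fun z hz => hc z hz))
  rw [← this]; exact hc z hz

/-- `(η(2z) η(3z)³ / (η(z) η(6z)³))³`, that is, `j₆ + 3`. -/
noncomputable abbrev eT : ℂ → ℂ := etaQuot (-3) 3 9 (-9)
/-- The eta quotient equal to `j₆ - 5`. -/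
noncomputable abbrev eU : ℂ → ℂ := etaQuot 5 (-1) 1 (-5)
/-- The eta quotient equal to `j₆ + 4`. -/
noncomputable abbrev eV : ℂ → ℂ := etaQuot (-4) 8 4 (-8)

lemma eT_sub_eU {z : ℂ} (hz : 0 < z.im) : eT z - eU z = 8 := by
  rw [eT, eU, etaQuot_sub_eq (m₂ := 1) (m₃ := 0) (m₆ := 0) (n₂ := 0) (n₃ := 0) (n₆ := 1)
    (by norm_num) (by norm_num) (by norm_num) (by norm_num) (by norm_num) (by norm_num)
    (by norm_num) (by norm_num) (by norm_num) (by norm_num) (by norm_num) hz]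
  norm_num

lemma eT_sub_eV {z : ℂ} (hz : 0 < z.im) : eT z - eV z = -1 := by
  rw [eT, eV, etaQuot_sub_eq (m₂ := 1) (m₃ := 0) (m₆ := 0) (n₂ := 0) (n₃ := 1) (n₆ := 0)
    (by norm_num) (by norm_num) (by norm_num) (by norm_num) (by norm_num) (by norm_num)
    (by norm_num) (by norm_num) (by norm_num) (by norm_num) (by norm_num) hz]
  norm_num

lemma jet_eT : Jet eT 1 1 3 (3 / 2) := by
  convert jet_etaQuot (r₁ := -3) (r₂ := 3) (r₃ := 9) (r₆ := -9) (m := -1) (by norm_num) using 1 <;>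
    norm_num

lemma eT_linear {a b : ℂ} (h : ∀ z : ℂ, 0 < z.im → a * eT z + b = 0) : a = 0 ∧ b = 0 := by
  have h1 : Tendsto (fun z => eT z * qc z ^ (1 : ℤ)) atInf (𝓝 1) := by
    have := (jet_eT.expansion.isBigO.trans_tendsto (tendsto_qc_pow two_ne_zero)).add
      (((tendsto_qc'.const_mul 3).const_add 1).add
        ((tendsto_qc_pow two_ne_zero).const_mul (3 / 2 + 3 ^ 2 / 2)))
    simp only [mul_zero, add_zero, zero_add] at this
    exact this.congr fun z => by ring
  have h2 : a = 0 := by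
    have h3 := (h1.const_mul a).add (tendsto_qc'.const_mul b)
    have h4 := tendsto_nhds_unique h3 ((tendsto_const_nhds (x := (0 : ℂ))).congr'
      (eventually_pos.mono fun z hz => by
        dsimp only; rw [zpow_one]; linear_combination (-qc z) * h z hz))
    simpa using h4
  refine ⟨h2, ?_⟩
  simpa [h2] using h I (by simp)

lemma etaQuot_mul {r₁ r₂ r₃ r₆ s₁ s₂ s₃ s₆ : ℤ} {z : ℂ} (hz : 0 < z.im) :
    etaQuot r₁ r₂ r₃ r₆ z * etaQuot s₁ s₂ s₃ s₆ z =
      etaQuot (r₁ + s₁) (r₂ + s₂) (r₃ + s₃) (r₆ + s₆) z := by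
  have h2 := eta_ne_zero (natCast_mul_im_pos (k := 2) (by norm_num) hz)
  have h3 := eta_ne_zero (natCast_mul_im_pos (k := 3) (by norm_num) hz)
  have h6 := eta_ne_zero (natCast_mul_im_pos (k := 6) (by norm_num) hz)
  simp only [Nat.cast_ofNat] at h2 h3 h6
  unfold etaQuot
  rw [zpow_add₀ (eta_ne_zero hz), zpow_add₀ h2, zpow_add₀ h3, zpow_add₀ h6]
  ring

lemma etaQuot_zero (z : ℂ) : etaQuot 0 0 0 0 z = 1 := by simp [etaQuot]

lemma eT_W_two {z : ℂ} (hz : 0 < z.im) : eT (mob (W 2) z) = -8 / eT z := by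
  obtain ⟨c, -, hc⟩ := etaQuot_W_two (r₁ := -3) (r₂ := 3) (r₃ := 9) (r₆ := -9) (k := 0) (by norm_num)
  obtain ⟨d, -, hd⟩ := etaQuot_W_two (r₁ := -4) (r₂ := 8) (r₃ := 4) (r₆ := -8) (k := 0) (by norm_num)
  have key : ∀ z : ℂ, 0 < z.im → eT (mob (W 2) z) * eT z = c ∧ eV (mob (W 2) z) * eT z = d * eU z := by
    intro z hz
    constructor
    · dsimp only [eT, eU, eV]
      rw [hc z hz, zpow_zero, mul_one, mul_assoc, etaQuot_mul hz]; norm_num [etaQuot_zero]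
    · dsimp only [eT, eU, eV]
      rw [hd z hz, zpow_zero, mul_one, mul_assoc, etaQuot_mul hz]; norm_num
  obtain ⟨h1, h2⟩ := eT_linear (a := 1 - d) (b := c + 8 * d) fun z hz => by
    obtain ⟨k1, k2⟩ := key z hz
    have k3 := eT_sub_eV (mob_im_pos (W_det_pos 2) hz)
    have k4 := eT_sub_eU hz
    linear_combination (-1 : ℂ) * k1 + k2 + (eT z) * k3 - d * k4
  rw [eq_div_iff (etaQuot_ne_zero _ _ _ _ hz), (key z hz).1]
  linear_combination h2 + 8 * h1

lemma eV_W_three {z : ℂ} (hz : 0 < z.im) : eV (mob (W 3) z) = 9 / eV z := by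
  obtain ⟨d, -, hd⟩ := etaQuot_W_three (r₁ := -3) (r₂ := 3) (r₃ := 9) (r₆ := -9) (k := 0) (by norm_num)
  obtain ⟨c, -, hc⟩ := etaQuot_W_three (r₁ := -4) (r₂ := 8) (r₃ := 4) (r₆ := -8) (k := 0) (by norm_num)
  have key : ∀ z : ℂ, 0 < z.im → eV (mob (W 3) z) * eV z = c ∧ eT (mob (W 3) z) * eV z = d * eU z := by
    intro z hz
    constructor
    · dsimp only [eT, eU, eV]
      rw [hc z hz, zpow_zero, mul_one, mul_assoc, etaQuot_mul hz]; norm_num [etaQuot_zero]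
    · dsimp only [eT, eU, eV]
      rw [hd z hz, zpow_zero, mul_one, mul_assoc, etaQuot_mul hz]; norm_num
  obtain ⟨h1, h2⟩ := eT_linear (a := d + 1) (b := 1 - 8 * d - c) fun z hz => by
    obtain ⟨k1, k2⟩ := key z hz
    have k3 := eT_sub_eV (mob_im_pos (W_det_pos 3) hz)
    have k4 := eT_sub_eU hz
    have k5 := eT_sub_eV hz
    linear_combination k1 - k2 + (eV z) * k3 + d * k4 + k5
  rw [eq_div_iff (etaQuot_ne_zero _ _ _ _ hz), (key z hz).1]
  linear_combination -h2 - 8 * h1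

lemma eU_W_six {z : ℂ} (hz : 0 < z.im) : eU (mob (W 6) z) = 72 / eU z := by
  obtain ⟨d, -, hd⟩ := etaQuot_W_six (r₁ := -3) (r₂ := 3) (r₃ := 9) (r₆ := -9) (k := 0) (by norm_num)
  obtain ⟨c, -, hc⟩ := etaQuot_W_six (r₁ := 5) (r₂ := -1) (r₃ := 1) (r₆ := -5) (k := 0) (by norm_num)
  have key : ∀ z : ℂ, 0 < z.im → eU (mob (W 6) z) * eU z = c ∧ eT (mob (W 6) z) * eU z = d * eV z := by
    intro z hz
    constructor
    · dsimp only [eT, eU, eV]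
      rw [hc z hz, zpow_zero, mul_one, mul_assoc, etaQuot_mul hz]; norm_num [etaQuot_zero]
    · dsimp only [eT, eU, eV]
      rw [hd z hz, zpow_zero, mul_one, mul_assoc, etaQuot_mul hz]; norm_num
  obtain ⟨h1, h2⟩ := eT_linear (a := d - 8) (b := d - c + 64) fun z hz => by
    obtain ⟨k1, k2⟩ := key z hz
    have k3 := eT_sub_eU (mob_im_pos (W_det_pos 6) hz)
    have k4 := eT_sub_eU hz
    have k5 := eT_sub_eV hz
    linear_combination k1 - k2 + (eU z) * k3 + d * k5 - 8 * k4
  rw [eq_div_iff (etaQuot_ne_zero _ _ _ _ hz), (key z hz).1]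
  linear_combination -h2 + h1

/-- The hauptmodul `j₆` of `Γ₀(6)`. -/
noncomputable def J (z : ℂ) : ℂ := eT z - 3

lemma jn_six : jn 6 = J := by
  funext z
  simp only [jn, J, eT, etaQuot, if_true]
  congr 1
  rw [div_pow, mul_pow, mul_pow, ← pow_mul, ← pow_mul]
  simp only [_root_.zpow_neg, Int.reduceNeg, Nat.reduceMul]
  rw [show ((3 : ℤ)) = ((3 : ℕ) : ℤ) from rfl, show ((9 : ℤ)) = ((9 : ℕ) : ℤ) from rfl]
  simp only [zpow_natCast]
  rw [div_eq_mul_inv, mul_inv]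
  ring

/-- The indices of the nontrivial Atkin–Lehner involutions of level 6. -/
def E6' : Finset ℕ := {2, 3, 6}

/-- The value of `j₆` at the cusp `W_e ∞`. -/
noncomputable def tE (e : ℕ) : ℂ := if e = 2 then -3 else if e = 3 then -4 else 5

/-- The constant with `(j₆(W_e z) - t_e) (j₆(z) - t_e) = κ_e`. -/
noncomputable def kE (e : ℕ) : ℂ := if e = 2 then -8 else if e = 3 then 9 else 72

lemma tE_two : tE 2 = -3 := by simp [tE]
lemma tE_three : tE 3 = -4 := by simp [tE]
lemma tE_six : tE 6 = 5 := by simp [tE]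
lemma kE_two : kE 2 = -8 := by simp [kE]
lemma kE_three : kE 3 = 9 := by simp [kE]
lemma kE_six : kE 6 = 72 := by simp [kE]

lemma kE_ne_zero (e : ℕ) : kE e ≠ 0 := by unfold kE; split_ifs <;> norm_num

lemma forall_E6' {p : ℕ → Prop} (h2 : p 2) (h3 : p 3) (h6 : p 6) : ∀ e ∈ E6', p e := by
  intro e he
  simp only [E6', Finset.mem_insert, Finset.mem_singleton] at he
  rcases he with rfl | rfl | rfl <;> assumption

lemma E6'_subset {e : ℕ} (he : e ∈ E6') : e ∈ E6 := by
  revert he; revert e; decide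

lemma J_eq_eV {z : ℂ} (hz : 0 < z.im) : J z = eV z - 4 := by
  have := eT_sub_eV hz
  rw [J]; linear_combination this

lemma J_eq_eU {z : ℂ} (hz : 0 < z.im) : J z = eU z + 5 := by
  have := eT_sub_eU hz
  rw [J]; linear_combination this

lemma J_ne_tE {e : ℕ} (he : e ∈ E6') {z : ℂ} (hz : 0 < z.im) : J z ≠ tE e := by
  refine forall_E6' (p := fun e => J z ≠ tE e) ?_ ?_ ?_ e he
  · rw [tE_two, J]; intro h
    exact etaQuot_ne_zero _ _ _ _ hz (by linear_combination h : eT z = 0)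
  · rw [tE_three, J_eq_eV hz]; intro h
    exact etaQuot_ne_zero _ _ _ _ hz (by linear_combination h : eV z = 0)
  · rw [tE_six, J_eq_eU hz]; intro h
    exact etaQuot_ne_zero _ _ _ _ hz (by linear_combination h : eU z = 0)

lemma J_sub_ne_zero {e : ℕ} (he : e ∈ E6') {z : ℂ} (hz : 0 < z.im) : J z - tE e ≠ 0 :=
  sub_ne_zero.mpr (J_ne_tE he hz)

lemma J_W {e : ℕ} (he : e ∈ E6') {z : ℂ} (hz : 0 < z.im) :
    J (mob (W e) z) = tE e + kE e / (J z - tE e) := by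
  refine forall_E6' (p := fun e => J (mob (W e) z) = tE e + kE e / (J z - tE e)) ?_ ?_ ?_ e he
  · have hW := mob_im_pos (W_det_pos 2) hz
    rw [tE_two, kE_two, J, J, eT_W_two hz]; ring
  · have hW := mob_im_pos (W_det_pos 3) hz
    rw [tE_three, kE_three, J_eq_eV hW, J_eq_eV hz, eV_W_three hz]; ring
  · have hW := mob_im_pos (W_det_pos 6) hz
    rw [tE_six, kE_six, J_eq_eU hW, J_eq_eU hz, eU_W_six hz]; ring

lemma differentiableOn_J : DifferentiableOn ℂ J UH :=
  (differentiableOn_etaQuot _ _ _ _).sub_const 3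

lemma inv_J : Inv J := fun γ hγ z hz => by
  have : Inv eT := etaQuot_inv (m := -1) (m₃ := 0) (m₆ := 0) (by norm_num) (by norm_num)
    (by norm_num) (by norm_num)
  rw [J, J, this γ hγ z hz]

lemma hasDerivAt_qc (z : ℂ) : HasDerivAt qc (2 * Real.pi * I * qc z) z := by
  have := ((hasDerivAt_id z).const_mul (2 * Real.pi * I : ℂ)).cexp
  simp only [id, mul_one] at this
  rw [mul_comm]; exact this

lemma hasDerivAt_mob {M : Matrix (Fin 2) (Fin 2) ℤ} (hM : 0 < M.det) {z : ℂ} (hz : 0 < z.im) :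
    HasDerivAt (mob M) (M.det / den M z ^ 2) z := by
  have hd := den_ne_zero hM hz
  have h1 : HasDerivAt (fun z : ℂ => (M 0 0 : ℂ) * z + M 0 1) (M 0 0) z := by
    simpa using ((hasDerivAt_id z).const_mul (M 0 0 : ℂ)).add_const (M 0 1 : ℂ)
  have h2 : HasDerivAt (fun z : ℂ => (M 1 0 : ℂ) * z + M 1 1) (M 1 0) z := by
    simpa using ((hasDerivAt_id z).const_mul (M 1 0 : ℂ)).add_const (M 1 1 : ℂ)
  refine (h1.div h2 hd).congr_deriv ?_
  rw [det_fin_two, den]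
  push_cast
  congr 1
  ring

lemma deriv_comp_mob {f : ℂ → ℂ} (hf : DifferentiableOn ℂ f UH)
    {M : Matrix (Fin 2) (Fin 2) ℤ} (hM : 0 < M.det) {z : ℂ} (hz : 0 < z.im) :
    deriv (fun w => f (mob M w)) z = deriv f (mob M z) * (M.det / den M z ^ 2) := by
  have h1 := (hf.differentiableAt (UH_mem_nhds (mob_im_pos hM hz))).hasDerivAt
  exact (h1.comp z (hasDerivAt_mob hM hz)).deriv

lemma logDeriv_etaQuot {r₁ r₂ r₃ r₆ m : ℤ} (h : r₁ + 2 * r₂ + 3 * r₃ + 6 * r₆ = 24 * m) {z : ℂ}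
    (hz : 0 < z.im) : logDeriv (etaQuot r₁ r₂ r₃ r₆) z =
      2 * Real.pi * I * (m + qc z * logDeriv (eulerQuot r₁ r₂ r₃ r₆) (qc z)) := by
  have hq := qc_mem_ball hz
  have h0 := qc_ne_zero z
  have hΦ := eulerQuot_ne_zero r₁ r₂ r₃ r₆ hq
  have h1 := ((differentiableOn_eulerQuot r₁ r₂ r₃ r₆).differentiableAt
    (Metric.isOpen_ball.mem_nhds hq)).hasDerivAt.comp z (hasDerivAt_qc z)
  have h2 := (hasDerivAt_zpow m (qc z) (Or.inl h0)).comp z (hasDerivAt_qc z)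
  have h3 := (h2.mul h1).deriv
  rw [logDeriv_apply, logDeriv_apply, etaQuot_eq h z,
    show etaQuot r₁ r₂ r₃ r₆ = fun z => qc z ^ m * eulerQuot r₁ r₂ r₃ r₆ (qc z) from
      funext fun z => etaQuot_eq h z]
  change deriv ((fun y => y ^ m) ∘ qc * eulerQuot r₁ r₂ r₃ r₆ ∘ qc) z / _ = _
  rw [h3, zpow_sub_one₀ h0]
  simp only [Function.comp]
  have := zpow_ne_zero m h0
  field_simp

/-- If `f ∘ W` is a multiple of `g`, so is the logarithmic derivative, with weight two. -/
lemma logDeriv_mob {f g : ℂ → ℂ} (hf : DifferentiableOn ℂ f UH)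
    {M : Matrix (Fin 2) (Fin 2) ℤ} (hM : 0 < M.det) {c : ℂ} (hc : c ≠ 0)
    (h : ∀ z : ℂ, 0 < z.im → f (mob M z) = c * g z) {z : ℂ} (hz : 0 < z.im) :
    logDeriv f (mob M z) = den M z ^ 2 / M.det * logDeriv g z := by
  have hd := den_ne_zero hM hz
  have hM' : (M.det : ℂ) ≠ 0 := by exact_mod_cast hM.ne'
  have h1 := deriv_comp_mob hf hM hz
  have h2 : deriv (fun w => f (mob M w)) z = c * deriv g z := by
    rw [← deriv_const_mul_field]
    exact Filter.EventuallyEq.deriv_eq (Filter.mem_of_superset (UH_mem_nhds hz) fun w hw => h w hw)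
  rw [logDeriv_apply, logDeriv_apply, h z hz]
  rw [h2] at h1
  have h3 : deriv f (mob M z) = c * deriv g z * den M z ^ 2 / M.det := by
    rw [h1]; field_simp
  rw [h3]
  by_cases hg : g z = 0
  · simp [hg]
  · field_simp

lemma tendsto_logDeriv_div {r₁ r₂ r₃ r₆ m s₁ s₂ s₃ s₆ k : ℤ}
    (h : r₁ + 2 * r₂ + 3 * r₃ + 6 * r₆ = 24 * m) (h' : s₁ + 2 * s₂ + 3 * s₃ + 6 * s₆ = 24 * k)
    (hmk : k = 0 ∨ (m = 0 ∧ k = 1)) :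
    ∃ l, Tendsto (fun z => logDeriv (etaQuot r₁ r₂ r₃ r₆) z / etaQuot s₁ s₂ s₃ s₆ z) atInf (𝓝 l) ∧
      (k = 0 → l = 2 * Real.pi * I * m) := by
  have hc : ContinuousAt (logDeriv (eulerQuot r₁ r₂ r₃ r₆)) 0 := by
    have hd := differentiableOn_eulerQuot r₁ r₂ r₃ r₆
    have hb : Metric.ball (0 : ℂ) 1 ∈ 𝓝 (0 : ℂ) := Metric.ball_mem_nhds _ one_pos
    have h2 := ((hd.deriv Metric.isOpen_ball).differentiableAt hb).continuousAt
    exact h2.div (hd.differentiableAt hb).continuousAt (by simp [eulerQuot_zero])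
  have h1 := hc.tendsto.comp tendsto_qc'
  rcases hmk with rfl | ⟨rfl, rfl⟩
  · refine ⟨_, ((((tendsto_qc'.mul h1).const_add (m : ℂ)).const_mul (2 * Real.pi * I : ℂ)).div
      (tendsto_eulerQuot s₁ s₂ s₃ s₆) one_ne_zero).congr' (eventually_pos.mono fun z hz => ?_), ?_⟩
    · dsimp only
      rw [logDeriv_etaQuot h hz, etaQuot_eq h', zpow_zero, one_mul]; rfl
    · intro _; simp
  · refine ⟨_, ((h1.const_mul (2 * Real.pi * I : ℂ)).div
      (tendsto_eulerQuot s₁ s₂ s₃ s₆) one_ne_zero).congr' (eventually_pos.mono fun z hz => ?_), ?_⟩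
    · dsimp only
      have := qc_ne_zero z
      rw [logDeriv_etaQuot h hz, etaQuot_eq h', zpow_one]
      simp only [Function.comp, Pi.div_apply]
      have := eulerQuot_ne_zero s₁ s₂ s₃ s₆ (qc_mem_ball hz)
      push_cast
      field_simp
      ring
    · intro h; omega

lemma logDeriv_etaQuot_add_one {r₁ r₂ r₃ r₆ m : ℤ} (h : r₁ + 2 * r₂ + 3 * r₃ + 6 * r₆ = 24 * m) {z : ℂ}
    (hz : 0 < z.im) : logDeriv (etaQuot r₁ r₂ r₃ r₆) (z + 1) = logDeriv (etaQuot r₁ r₂ r₃ r₆) z := by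
  rw [logDeriv_etaQuot h hz, logDeriv_etaQuot h (by simpa using hz), qc_add_one]

lemma exists_logDeriv_W {r₁ r₂ r₃ r₆ : ℤ} {f y : ℂ → ℂ} {e : ℕ} {s₁ s₂ s₃ s₆ : ℤ}
    (hf : f = etaQuot r₁ r₂ r₃ r₆) {g : ℂ → ℂ}
    (h1 : ∃ c : ℂ, c ≠ 0 ∧ ∀ z : ℂ, 0 < z.im → f (mob (W e) z) = c * den (W e) z ^ (0 : ℤ) * g z)
    (h2 : ∃ c : ℂ, c ≠ 0 ∧ ∀ z : ℂ, 0 < z.im →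
      y (mob (W e) z) = c * den (W e) z ^ (2 : ℤ) * etaQuot s₁ s₂ s₃ s₆ z) :
    ∃ C : ℂ, ∀ z : ℂ, 0 < z.im →
      logDeriv f (mob (W e) z) / y (mob (W e) z) = C * (logDeriv g z / etaQuot s₁ s₂ s₃ s₆ z) := by
  obtain ⟨c, hc, h1⟩ := h1
  obtain ⟨d, hd, h2⟩ := h2
  refine ⟨1 / ((W e).det * d), fun z hz => ?_⟩
  rw [logDeriv_mob (hf ▸ differentiableOn_etaQuot _ _ _ _) (W_det_pos e) (g := g) hc
    (fun z hz => by rw [h1 z hz, zpow_zero, mul_one]) hz, h2 z hz]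
  have h3 := den_ne_zero (W_det_pos e) hz
  have h4 := etaQuot_ne_zero s₁ s₂ s₃ s₆ hz
  have hM' : ((W e).det : ℂ) ≠ 0 := by exact_mod_cast (W_det_pos e).ne'
  rw [show den (W e) z ^ (2 : ℤ) = den (W e) z ^ 2 from zpow_natCast _ 2]
  field_simp

lemma deriv_J_ne_zero {z : ℂ} (hz : 0 < z.im) : deriv J z ≠ 0 := by
  set y := etaQuot 3 3 (-1) (-1) with hy
  have a1 : (-3 : ℤ) + 2 * 3 + 3 * 9 + 6 * (-9) = 24 * (-1) := by norm_num
  have b1 : (3 : ℤ) + 2 * 3 + 3 * (-1) + 6 * (-1) = 24 * 0 := by norm_num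
  have a2 : (3 : ℤ) + 2 * (-3) + 3 * (-9) + 6 * 9 = 24 * 1 := by norm_num
  have a3 : (9 : ℤ) + 2 * (-9) + 3 * (-3) + 6 * 3 = 24 * 0 := by norm_num
  have b3 : (-1 : ℤ) + 2 * (-1) + 3 * 3 + 6 * 3 = 24 * 1 := by norm_num
  have a6 : (-9 : ℤ) + 2 * 9 + 3 * 3 + 6 * (-3) = 24 * 0 := by norm_num
  obtain ⟨C2, h2⟩ := exists_logDeriv_W (r₁ := -3) (r₂ := 3) (r₃ := 9) (r₆ := -9) rfl
    (etaQuot_W_two (by norm_num)) (etaQuot_W_two (r₁ := 3) (r₂ := 3) (r₃ := -1) (r₆ := -1)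
    (k := 2) (by norm_num))
  obtain ⟨C3, h3⟩ := exists_logDeriv_W (r₁ := -3) (r₂ := 3) (r₃ := 9) (r₆ := -9) rfl
    (etaQuot_W_three (by norm_num)) (etaQuot_W_three (r₁ := 3) (r₂ := 3) (r₃ := -1) (r₆ := -1)
    (k := 2) (by norm_num))
  obtain ⟨C6, h6⟩ := exists_logDeriv_W (r₁ := -3) (r₂ := 3) (r₃ := 9) (r₆ := -9) rfl
    (etaQuot_W_six (by norm_num)) (etaQuot_W_six (r₁ := 3) (r₂ := 3) (r₃ := -1) (r₆ := -1)
    (k := 2) (by norm_num))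
  obtain ⟨l1, hl1, hl1'⟩ := tendsto_logDeriv_div a1 b1 (Or.inl rfl)
  obtain ⟨l2, hl2, -⟩ := tendsto_logDeriv_div a2 b1 (Or.inl rfl)
  obtain ⟨l3, hl3, -⟩ := tendsto_logDeriv_div a3 b3 (Or.inr ⟨rfl, rfl⟩)
  obtain ⟨l6, hl6, -⟩ := tendsto_logDeriv_div a6 b3 (Or.inr ⟨rfl, rfl⟩)
  have hinv : Inv (fun z => logDeriv eT z / y z) := by
    intro γ hγ z hz
    refine invariant_of_periodic (f := fun z => logDeriv eT z / y z)
      (fun z hz => ?_) (fun z hz => ?_) (fun z hz => ?_) hγ hz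
    · rw [logDeriv_etaQuot_add_one a1 hz, hy, etaQuot_add_one b1]
    · rw [h3 z hz, h3 _ (by simpa using hz), logDeriv_etaQuot_add_one a3 hz, etaQuot_add_one b3]
    · rw [h6 z hz, h6 _ (by simpa using hz), logDeriv_etaQuot_add_one a6 hz, etaQuot_add_one b3]
  have hb : ∀ e ∈ E6, BddInf (fun z => (fun z => logDeriv eT z / y z) (mob (W e) z)) := by
    refine forall_E6 ?_ ?_ ?_ ?_
    · simp only [W_one, mob_one]
      exact BddInf.of_tendsto hl1
    · exact BddInf.of_tendsto ((hl2.const_mul C2).congr' (eventually_pos.mono fun z hz => (h2 z hz).symm))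
    · exact BddInf.of_tendsto ((hl3.const_mul C3).congr' (eventually_pos.mono fun z hz => (h3 z hz).symm))
    · exact BddInf.of_tendsto ((hl6.const_mul C6).congr' (eventually_pos.mono fun z hz => (h6 z hz).symm))
  have hdiff : DifferentiableOn ℂ (fun z => logDeriv eT z / y z) UH := by
    have hT := differentiableOn_etaQuot (-3) 3 9 (-9)
    exact ((hT.deriv isOpen_UH).div hT fun z hz => etaQuot_ne_zero _ _ _ _ hz).div
      (differentiableOn_etaQuot _ _ _ _) fun z hz => etaQuot_ne_zero _ _ _ _ hz
  obtain ⟨c, hc⟩ := eq_const_of_bdd hdiff hinv hb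
  have hcl : c = l1 := tendsto_nhds_unique (tendsto_const_nhds (x := c))
    (hl1.congr' (eventually_pos.mono fun z hz => hc z hz))
  intro h0
  have h4 : deriv eT z = 0 := by
    rw [← h0]; exact (deriv_sub_const (f := eT) (x := z) 3).symm
  have := hc z hz
  simp only [logDeriv_apply, h4, zero_div] at this
  rw [hcl, hl1' rfl] at this
  simp [Real.pi_ne_zero] at this

/-- The holomorphic part of the expansion of `j₆` at infinity, as a function of `q`. -/
noncomputable def fJ (q : ℂ) : ℂ := dslope (eulerQuot (-3) 3 9 (-9)) 0 q - 3

/-- The `k`-th Fourier coefficient of `j₆`, for `k ≥ 0`. -/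
noncomputable def cJ (k : ℕ) : ℂ := (k.factorial : ℂ)⁻¹ * iteratedDeriv k fJ 0

lemma ball_mem : Metric.ball (0 : ℂ) 1 ∈ 𝓝 (0 : ℂ) := Metric.ball_mem_nhds _ one_pos

lemma differentiableOn_fJ : DifferentiableOn ℂ fJ (Metric.ball 0 1) :=
  ((differentiableOn_dslope ball_mem).mpr
    (differentiableOn_eulerQuot _ _ _ _)).sub_const 3

lemma J_eq (z : ℂ) : J z = (qc z)⁻¹ + fJ (qc z) := by
  have h0 := qc_ne_zero z
  rw [J, eT, etaQuot_eq (m := -1) (by norm_num), fJ, dslope_of_ne _ h0, slope_def_field, eulerQuot_zero,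
    _root_.zpow_neg_one, sub_zero]
  field_simp
  ring

lemma isLittleO_fJ : (fun z => fJ (qc z) - 6 * qc z) =o[atInf] qc := by
  have h := jet_eT.expansion.mul_isBigO (isBigO_refl (fun z => (qc z)⁻¹) atInf)
  refine (h.congr_left fun z => ?_).congr_right fun z => ?_
  · have h1 := J_eq z
    have h0 := qc_ne_zero z
    have h2 : eT z = (qc z)⁻¹ + fJ (qc z) + 3 := by rw [← h1, J]; ring
    rw [h2, zpow_one]
    field_simp
    ring
  · have h0 := qc_ne_zero z
    field_simp

lemma fJ_zero : fJ 0 = 0 := by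
  have h1 := (isLittleO_fJ.isBigO.trans_tendsto tendsto_qc').add (tendsto_qc'.const_mul 6)
  simp only [sub_add_cancel, mul_zero, add_zero] at h1
  exact tendsto_nhds_unique (((differentiableOn_fJ.differentiableAt ball_mem).continuousAt.tendsto).comp
    tendsto_qc') h1

lemma jet_J_sub (t : ℂ) : Jet (fun z => J z - t) 1 1 (-t) (6 - t ^ 2 / 2) := by
  have := jet_of_expansion (F := fun z => J z - t) (C := 1) (a := -t) (b := 6) (N := 1) ?_
  · convert this using 1; ring
  · refine jet_eT.expansion.congr_left fun z => ?_
    simp only [zpow_one, J]; ring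

lemma tendsto_J_sub_mul (t : ℂ) : Tendsto (fun z => (J z - t) * qc z) atInf (𝓝 1) := by
  have h1 := (((differentiableOn_fJ.differentiableAt ball_mem).continuousAt.tendsto).comp
    tendsto_qc').sub_const t
  have h2 := (h1.mul tendsto_qc').const_add 1
  simp only [mul_zero, add_zero] at h2
  refine h2.congr fun z => ?_
  have h0 := qc_ne_zero z
  rw [J_eq]; simp only [Function.comp]; field_simp; ring

lemma tendsto_inv_J_sub (t : ℂ) : Tendsto (fun z => (J z - t)⁻¹ * (qc z)⁻¹) atInf (𝓝 1) := by
  have := (tendsto_J_sub_mul t).inv₀ one_ne_zero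
  rw [inv_one] at this
  exact this.congr fun z => by rw [mul_inv]

lemma tendsto_norm_J : Tendsto (fun z => ‖J z‖) atInf atTop := by
  have h1 := (tendsto_J_sub_mul 0).norm
  have h2 : Tendsto (fun z => ‖qc z‖⁻¹) atInf atTop := by
    refine Filter.Tendsto.inv_tendsto_nhdsGT_zero ?_
    exact tendsto_norm_nhdsNE_zero.comp tendsto_qc
  have h3 := h2.atTop_mul_pos (by norm_num : (0 : ℝ) < ‖(1 : ℂ)‖) h1
  refine h3.congr fun z => ?_
  have h0 := norm_ne_zero_iff.mpr (qc_ne_zero z)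
  rw [norm_mul, sub_zero]; field_simp

/-! ### The hauptmodul of the Fricke group -/

/-- `j₆*` as a rational function of `j₆`. -/
noncomputable def starOf (t : ℂ) : ℂ := t + ∑ e ∈ E6', kE e / (t - tE e)

lemma starOf_eq (t : ℂ) : starOf t = t + (-8 / (t + 3) + 9 / (t + 4) + 72 / (t - 5)) := by
  rw [starOf, E6', Finset.sum_insert (by decide), Finset.sum_insert (by decide), Finset.sum_singleton,
    tE_two, tE_three, tE_six, kE_two, kE_three, kE_six]
  ring

lemma jnStar_six {z : ℂ} (hz : 0 < z.im) : jnStar 6 z = starOf (J z) := by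
  have hV := etaQuot_ne_zero (-4) 8 4 (-8) hz
  have hT := etaQuot_ne_zero (-3) 3 9 (-9) hz
  have hU := etaQuot_ne_zero 5 (-1) 1 (-5) hz
  have hw : (dedekindEta z * dedekindEta (3 * z) / (dedekindEta (2 * z) * dedekindEta (6 * z))) ^ 6
      = etaQuot 6 (-6) 6 (-6) z := by
    simp only [etaQuot, _root_.zpow_neg]
    rw [show ((6 : ℤ)) = ((6 : ℕ) : ℤ) from rfl]
    simp only [zpow_natCast]
    rw [div_pow, mul_pow, mul_pow, div_eq_mul_inv, mul_inv]; ring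
  have hw2 : etaQuot 6 (-6) 6 (-6) z * eV z = eT z * eU z := by
    dsimp only [eT, eU, eV]
    rw [etaQuot_mul hz, etaQuot_mul hz]; norm_num
  have hw3 : etaQuot 6 (-6) 6 (-6) z = (J z + 3) * (J z - 5) / (J z + 4) := by
    rw [eq_div_iff (by rw [J_eq_eV hz]; simpa using hV)]
    have h1 : J z + 4 = eV z := by rw [J_eq_eV hz]; ring
    have h2 : J z - 5 = eU z := by rw [J_eq_eU hz]; ring
    have h3 : J z + 3 = eT z := by rw [J]; ring
    rw [h1, h2, h3, hw2]
  have hs : jnStar 6 z = etaQuot 6 (-6) 6 (-6) z + 6 + 64 / etaQuot 6 (-6) 6 (-6) z := by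
    rw [← hw]
    simp only [jnStar, if_true]
    rw [div_eq_mul_inv (64 : ℂ), ← inv_pow, inv_div]
    norm_num
  have h1 : J z + 4 ≠ 0 := by rw [J_eq_eV hz]; simpa using hV
  have h2 : J z - 5 ≠ 0 := by rw [J_eq_eU hz]; simpa using hU
  have h3 : J z + 3 ≠ 0 := by rw [J]; simpa using hT
  rw [hs, hw3, starOf_eq]
  generalize J z = t at h1 h2 h3
  field_simp
  ring

lemma tendsto_jnStar : Tendsto (fun z => (jnStar 6 z * qc z - 1) / qc z ^ 2) atInf (𝓝 79) := by
  have h1 := isLittleO_fJ.tendsto_div_nhds_zero.add_const 6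
  have h2 := h1.add ((((tendsto_inv_J_sub (-3)).const_mul (-8)).add
    ((tendsto_inv_J_sub (-4)).const_mul 9)).add ((tendsto_inv_J_sub 5).const_mul 72))
  rw [show (0 : ℂ) + 6 + (-8 * 1 + 9 * 1 + 72 * 1) = 79 by norm_num] at h2
  refine h2.congr' (eventually_pos.mono fun z hz => ?_)
  have h0 := qc_ne_zero z
  dsimp only
  rw [jnStar_six hz, starOf_eq, sub_neg_eq_add, sub_neg_eq_add]
  have h3 : fJ (qc z) = J z - (qc z)⁻¹ := by rw [J_eq]; ring
  rw [h3]
  field_simp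
  ring

lemma tendsto_jnStar_mul : Tendsto (fun z => jnStar 6 z * qc z) atInf (𝓝 1) := by
  have h := (tendsto_jnStar.mul (tendsto_qc_pow two_ne_zero)).add_const 1
  rw [mul_zero, zero_add] at h
  refine h.congr fun z => ?_
  have h0 := qc_ne_zero z
  field_simp
  ring

lemma tendsto_jnStar_sq : Tendsto (fun z => jnStar 6 z ^ 2 - (qc z ^ 2)⁻¹) atInf (𝓝 158) := by
  have h := tendsto_jnStar.mul (tendsto_jnStar_mul.add_const 1)
  rw [show (79 : ℂ) * (1 + 1) = 158 by norm_num] at h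
  refine h.congr fun z => ?_
  have h0 := qc_ne_zero z
  field_simp
  ring

lemma tendsto_norm_jnStar : Tendsto (fun z => ‖jnStar 6 z‖) atInf atTop := by
  have h1 := tendsto_jnStar_mul.norm
  have h2 : Tendsto (fun z => ‖qc z‖⁻¹) atInf atTop := by
    refine Filter.Tendsto.inv_tendsto_nhdsGT_zero ?_
    exact tendsto_norm_nhdsNE_zero.comp tendsto_qc
  have h3 := h2.atTop_mul_pos (by norm_num : (0 : ℝ) < ‖(1 : ℂ)‖) h1
  refine h3.congr fun z => ?_
  have h0 := norm_ne_zero_iff.mpr (qc_ne_zero z)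
  rw [norm_mul]; field_simp

/-- A convergent `q`-series without nonpositive terms vanishes at infinity. -/
lemma tendsto_zero_of_hasSum {a : ℕ → ℂ} {g : ℂ → ℂ}
    (h : ∀ z : ℂ, 0 < z.im → HasSum (fun m : ℕ => a m * qc z ^ (m + 1)) (g z)) :
    Tendsto g atInf (𝓝 0) := by
  have h0 := qc_ne_zero I
  have hs := (h I (by simp)).summable.tendsto_atTop_zero.norm.bddAbove_range
  obtain ⟨C, hC⟩ := hs
  have hC' : ∀ m, ‖a m‖ * ‖qc I‖ ^ (m + 1) ≤ C := fun m => by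
    have := hC ⟨m, rfl⟩
    simpa using this
  have hn : 0 < ‖qc I‖ := norm_pos_iff.mpr h0
  have hb : ∀ᶠ z in atInf, ‖qc z‖ ≤ ‖qc I‖ / 2 := by
    have := tendsto_qc'.norm
    rw [norm_zero] at this
    exact this.eventually_le_const (by positivity)
  refine squeeze_zero_norm' (a := fun z => ‖qc z‖ * (2 * C / ‖qc I‖)) ?_ ?_
  · filter_upwards [hb, eventually_pos] with z hz hz0
    have hr : ‖qc z‖ / ‖qc I‖ ≤ 1 / 2 := by
      rw [div_le_iff₀ hn]; linarith
    have hgeo : HasSum (fun m : ℕ => ‖qc z‖ / ‖qc I‖ * C * (1 / 2) ^ m) (‖qc z‖ / ‖qc I‖ * C * 2) :=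
      hasSum_geometric_two.mul_left _
    have := (h z hz0).norm_le_of_bounded hgeo fun m => by
      rw [norm_mul, norm_pow]
      have h1 : ‖qc z‖ ^ (m + 1) = (‖qc z‖ / ‖qc I‖) ^ m * (‖qc z‖ / ‖qc I‖) * ‖qc I‖ ^ (m + 1) := by
        rw [← pow_succ, div_pow]; field_simp
      rw [h1]
      have h2 : (‖qc z‖ / ‖qc I‖) ^ m ≤ (1 / 2) ^ m := pow_le_pow_left₀ (by positivity) hr m
      calc _ = (‖qc z‖ / ‖qc I‖) * (‖a m‖ * ‖qc I‖ ^ (m + 1)) * (‖qc z‖ / ‖qc I‖) ^ m := by ring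
        _ ≤ (‖qc z‖ / ‖qc I‖) * C * (1 / 2) ^ m := by
          have hC0 : 0 ≤ C := le_trans (by positivity) (hC' 0)
          gcongr
          exact hC' m
    calc _ ≤ _ := this
      _ = _ := by ring
  · have := tendsto_qc'.norm.mul_const (2 * C / ‖qc I‖)
    simpa using this

lemma poly_eq {P : Polynomial ℂ} {e : ℤ → ℂ}
    (hP : HasQExp (fun z => Polynomial.eval (jnStar 6 z) P) e (-2))
    (he2 : e (-2) = 1) (he1 : e (-1) = 0) (he0 : e 0 = 0) :
    P = Polynomial.X ^ 2 - Polynomial.C 158 := by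
  have h1 : Tendsto (fun z => Polynomial.eval (jnStar 6 z) P - (qc z ^ 2)⁻¹) atInf (𝓝 0) := by
    refine tendsto_zero_of_hasSum (a := fun m => e (m + 1)) fun z hz => ?_
    have := hP.2 z hz
    rw [← hasSum_nat_add_iff' 3] at this
    simp only [Finset.sum_range_succ, Finset.sum_range_zero] at this
    norm_num [he2, he1, he0] at this
    refine this.congr_fun fun m => ?_
    rw [show (-2 : ℤ) + (m + 3) = ((m + 1 : ℕ) : ℤ) by push_cast; ring, zpow_natCast]
    push_cast; rfl
  set R := P - (Polynomial.X ^ 2 - Polynomial.C 158) with hR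
  have h2 : Tendsto (fun z => Polynomial.eval (jnStar 6 z) R) atInf (𝓝 0) := by
    have := (h1.sub tendsto_jnStar_sq).add_const 158
    rw [zero_sub, neg_add_cancel] at this
    refine this.congr fun z => ?_
    simp only [hR, Polynomial.eval_sub, Polynomial.eval_pow, Polynomial.eval_X, Polynomial.eval_C]
    ring
  have h3 : R.degree ≤ 0 := by
    by_contra hd
    have := Polynomial.tendsto_norm_atTop R (not_le.mp hd) tendsto_norm_jnStar
    exact not_tendsto_atTop_of_tendsto_nhds h2.norm this
  have h4 := Polynomial.eq_C_of_degree_le_zero h3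
  rw [h4] at h2
  simp only [Polynomial.eval_C] at h2
  have h5 := tendsto_nhds_unique h2 tendsto_const_nhds
  rw [← h5, Polynomial.C_0] at h4
  exact sub_eq_zero.mp h4

/-- Equivalence under `Γ₀(6)`. -/
def Eqv (z w : ℂ) : Prop := ∃ γ, InG γ ∧ w = mob γ z

lemma Eqv.symm {z w : ℂ} (hz : 0 < z.im) (h : Eqv z w) : Eqv w z := by
  obtain ⟨γ, hγ, rfl⟩ := h
  exact ⟨_, hγ.adj, (mob_adjugate_mob hγ.det_pos hz).symm⟩

lemma Eqv.trans {x y z : ℂ} (hx : 0 < x.im) (h : Eqv x y) (h' : Eqv y z) : Eqv x z := by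
  obtain ⟨γ, hγ, rfl⟩ := h
  obtain ⟨δ, hδ, rfl⟩ := h'
  exact ⟨_, hδ.mul hγ, (mob_mul _ _ hγ.det_pos hx).symm⟩

lemma Eqv.J_eq {z w : ℂ} (hz : 0 < z.im) (h : Eqv z w) : J w = J z := by
  obtain ⟨γ, hγ, rfl⟩ := h
  exact inv_J γ hγ z hz

lemma inG_translation (k : ℤ) : InG !![1, k; 0, 1] := ⟨by simp, by simp⟩

lemma mob_translation (k : ℤ) (z : ℂ) : mob !![1, k; 0, 1] z = z + k := by simp [mob]

lemma eqv_add_int (z : ℂ) (k : ℤ) : Eqv z (z + k) := ⟨_, inG_translation k, (mob_translation k z).symm⟩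

lemma eqv_W {z w : ℂ} (hz : 0 < z.im) (h : Eqv z w) (e : ℕ) : Eqv (mob (W e) z) (mob (W e) w) := by
  obtain ⟨γ, hγ, rfl⟩ := h
  obtain ⟨N, hN, hNd, hN6⟩ := exists_W_conj e γ hγ.2
  have hw := mob_im_pos (W_det_pos e) hz
  have hNG : InG N := ⟨by rw [hNd, hγ.1], hN6⟩
  refine ⟨N, hNG, ?_⟩
  conv_lhs => rw [← mob_W_W e hz]
  rw [← mob_mul _ _ (W_det_pos e) hw, hN, mob_mul _ _ hNG.det_pos hw,
    mob_W_W e (mob_im_pos hNG.det_pos hw)]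

lemma exists_reduction_strip {z : ℂ} (hz : 0 < z.im) :
    ∃ e ∈ E6, ∃ w : ℂ, 1 / 12 ≤ w.im ∧ w.re ∈ Set.Icc (0 : ℝ) 1 ∧ Eqv (mob (W e) w) z := by
  obtain ⟨e, he, γ, hγ, w, hw, rfl⟩ := exists_reduction hz
  have hw0 : 0 < w.im := by linarith
  have h1 : 0 < (w + (-⌊w.re⌋ : ℤ)).im := by simpa using hw0
  refine ⟨e, he, w + (-⌊w.re⌋ : ℤ), by simpa using hw, ?_, ?_⟩
  · rw [add_re, intCast_re, Int.cast_neg]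
    exact ⟨by linarith [Int.floor_le w.re], by linarith [Int.lt_floor_add_one w.re]⟩
  · refine Eqv.trans (mob_im_pos (W_det_pos e) h1)
      ((eqv_W hw0 (eqv_add_int w _) e).symm (mob_im_pos (W_det_pos e) hw0)) ⟨γ, hγ, rfl⟩

lemma tendsto_J_W {e : ℕ} (he : e ∈ E6') : Tendsto (fun z => J (mob (W e) z)) atInf (𝓝 (tE e)) := by
  have h1 := (((tendsto_inv_J_sub (tE e)).mul tendsto_qc').const_mul (kE e)).const_add (tE e)
  rw [mul_zero, mul_zero, add_zero] at h1
  refine h1.congr' (eventually_pos.mono fun z hz => ?_)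
  have := qc_ne_zero z
  dsimp only
  rw [J_W he hz]
  field_simp

/-- The set of values of `j₆`. -/
def Y : Set ℂ := {t | ∀ e ∈ E6', t ≠ tE e}

lemma J_mem_Y {z : ℂ} (hz : 0 < z.im) : J z ∈ Y := fun _ he => J_ne_tE he hz

lemma E6_cases {e : ℕ} (he : e ∈ E6) : e = 1 ∨ e ∈ E6' := by
  revert he; revert e; decide

lemma eventually_J_W_far {t : ℂ} (ht : t ∈ Y) {e : ℕ} (he : e ∈ E6) :
    ∃ ε > 0, ∀ᶠ w in atInf, ε ≤ ‖J (mob (W e) w) - t‖ := by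
  rcases E6_cases he with rfl | he'
  · refine ⟨1, one_pos, ?_⟩
    filter_upwards [tendsto_norm_J.eventually_ge_atTop (1 + ‖t‖)] with w hw
    rw [W_one, mob_one]
    have := norm_sub_norm_le (J w) t
    linarith
  · have h0 : 0 < ‖tE e - t‖ := norm_pos_iff.mpr (sub_ne_zero.mpr (ht e he').symm)
    refine ⟨‖tE e - t‖ / 2, by positivity, ?_⟩
    exact ((tendsto_J_W he').sub_const t).norm.eventually_const_le (by linarith)

lemma exists_of_eventually_atInf {p : ℂ → Prop} (h : ∀ᶠ w in atInf, p w) :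
    ∃ B : ℝ, ∀ w : ℂ, B ≤ w.im → p w := by
  obtain ⟨B, -, hB⟩ := (atTop_basis.comap Complex.im).eventually_iff.mp h
  exact ⟨B, fun w hw => hB hw⟩

/-- Preimages under `j₆` of points near `t` have representatives in a fixed compact set. -/
lemma exists_compact_preimage {t : ℂ} (ht : t ∈ Y) : ∃ K : Set ℂ, IsCompact K ∧ K ⊆ UH ∧
    ∀ᶠ t' in 𝓝 t, ∀ z : ℂ, 0 < z.im → J z = t' → ∃ w ∈ K, Eqv z w := by
  have h1 : ∀ e ∈ E6, ∃ ε > 0, ∃ B : ℝ, ∀ w : ℂ, B ≤ w.im → ε ≤ ‖J (mob (W e) w) - t‖ := by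
    intro e he
    obtain ⟨ε, hε, h⟩ := eventually_J_W_far ht he
    exact ⟨ε, hε, exists_of_eventually_atInf h⟩
  choose! ε hε B hB using h1
  refine ⟨⋃ e ∈ E6, mob (W e) '' (Set.Icc 0 1 ×ℂ Set.Icc (1 / 12) (B e)), ?_, ?_, ?_⟩
  · refine E6.isCompact_biUnion fun e _ => (isCompact_Icc.reProdIm isCompact_Icc).image_of_continuousOn ?_
    intro w hw
    have hw' : 1 / 12 ≤ w.im := (mem_reProdIm.mp hw).2.1
    exact (differentiableAt_mob (W_det_pos e) (by linarith)).continuousAt.continuousWithinAt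
  · intro z hz
    simp only [Set.mem_iUnion] at hz
    obtain ⟨e, _, w, hw, rfl⟩ := hz
    have hw' : 1 / 12 ≤ w.im := (mem_reProdIm.mp hw).2.1
    exact mob_im_pos (W_det_pos e) (by linarith)
  · have hn : ∀ᶠ t' in 𝓝 t, ∀ e ∈ E6, ‖t' - t‖ < ε e := by
      rw [Filter.eventually_all_finset]
      intro e he
      have : Tendsto (fun t' => ‖t' - t‖) (𝓝 t) (𝓝 0) := by
        simpa using ((tendsto_id (α := ℂ) (x := 𝓝 t)).sub_const t).norm
      exact this.eventually_lt_const (hε e he)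
    filter_upwards [hn] with t' ht' z hz hzt
    obtain ⟨e, he, w, hw, hwr, hwz⟩ := exists_reduction_strip hz
    have hw0 : 0 < w.im := by linarith
    have hW := mob_im_pos (W_det_pos e) hw0
    refine ⟨mob (W e) w, ?_, hwz.symm hW⟩
    simp only [Set.mem_iUnion]
    refine ⟨e, he, w, mem_reProdIm.mpr ⟨hwr, hw, ?_⟩, rfl⟩
    by_contra hlt
    have h2 := hB e he w (not_le.mp hlt).le
    rw [← hwz.J_eq hW, hzt] at h2
    exact absurd (ht' e he) (not_lt.mpr h2)

lemma hasStrictDerivAt_J {z : ℂ} (hz : 0 < z.im) : HasStrictDerivAt J (deriv J z) z :=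
  (differentiableOn_J.analyticAt (UH_mem_nhds hz)).hasStrictDerivAt

lemma map_nhds_J {z : ℂ} (hz : 0 < z.im) : map J (𝓝 z) = 𝓝 (J z) :=
  (hasStrictDerivAt_J hz).map_nhds_eq (deriv_J_ne_zero hz)

lemma J_injOn_nhds {z : ℂ} (hz : 0 < z.im) : ∃ U ∈ 𝓝 z, Set.InjOn J U := by
  refine ⟨_, (hasStrictDerivAt_J hz).eventually_left_inverse (deriv_J_ne_zero hz), ?_⟩
  intro x hx y hy hxy
  change _ = x at hx
  change _ = y at hy
  rw [← hx, ← hy, hxy]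

/-- Only finitely many elements of `Γ₀(6)` move a bounded region to itself. -/
lemma finite_bounded (R δ : ℝ) (hδ : 0 < δ) : {γ : Matrix (Fin 2) (Fin 2) ℤ | InG γ ∧
    ∃ z : ℂ, δ ≤ z.im ∧ ‖z‖ ≤ R ∧ δ ≤ (mob γ z).im ∧ ‖mob γ z‖ ≤ R}.Finite := by
  set S : ℝ := R / δ with hS
  set X : ℝ := (1 + R) * (1 + S) with hX
  set C : ℝ := X + X / δ + X / δ * R with hC
  have hfin : {γ : Fin 2 → Fin 2 → ℤ | ∀ i j, γ i j ∈ Set.Icc (-⌈C⌉) ⌈C⌉}.Finite := by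
    have := Set.Finite.pi' (ι := Fin 2) (κ := fun _ => Fin 2 → ℤ)
      (t := fun _ => {f | ∀ j, f j ∈ Set.Icc (-⌈C⌉) ⌈C⌉})
      fun _ => Set.Finite.pi' fun _ => Set.finite_Icc _ _
    exact this
  refine hfin.subset ?_
  rintro (γ : Matrix (Fin 2) (Fin 2) ℤ) ⟨hγ, z, hz, hzR, hw, hwR⟩
  have hz0 : 0 < z.im := lt_of_lt_of_le hδ hz
  have hd := den_ne_zero hγ.det_pos hz0
  have hR : 0 ≤ R := le_trans (norm_nonneg _) hzR
  have hS0 : 0 ≤ S := by positivity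
  have him := mob_im (M := γ) z
  rw [hγ.1] at him
  have hden : ‖den γ z‖ ≤ 1 + S := by
    have h1 : 0 < ‖den γ z‖ := norm_pos_iff.mpr hd
    have h2 : δ * ‖den γ z‖ ^ 2 ≤ R := by
      have h3 : (mob γ z).im * ‖den γ z‖ ^ 2 = z.im := by
        rw [him]
        rw [Complex.normSq_eq_norm_sq]
        field_simp
        simp
      calc δ * ‖den γ z‖ ^ 2 ≤ (mob γ z).im * ‖den γ z‖ ^ 2 := by gcongr
        _ = z.im := h3
        _ ≤ ‖z‖ := (le_abs_self _).trans (abs_im_le_norm z)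
        _ ≤ R := hzR
    have h4 : ‖den γ z‖ ^ 2 ≤ S := by rw [hS, le_div_iff₀ hδ]; linarith
    nlinarith
  have hnum : ‖(γ 0 0 : ℂ) * z + γ 0 1‖ ≤ R * (1 + S) := by
    have : (γ 0 0 : ℂ) * z + γ 0 1 = mob γ z * den γ z := (div_mul_cancel₀ _ hd).symm
    rw [this, norm_mul]
    gcongr
  have hX0 : 0 ≤ X := by positivity
  have key : ∀ a b : ℤ, ‖(a : ℂ) * z + b‖ ≤ X → |(a : ℝ)| ≤ C ∧ |(b : ℝ)| ≤ C := by
    intro a b hab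
    have ha : |(a : ℝ)| * δ ≤ X := by
      have h1 := (abs_im_le_norm ((a : ℂ) * z + b)).trans hab
      simp only [add_im, mul_im, intCast_re, intCast_im, zero_mul, add_zero] at h1
      rw [abs_mul, abs_of_pos hz0] at h1
      exact le_trans (by gcongr) h1
    have ha' : |(a : ℝ)| ≤ X / δ := by rw [le_div_iff₀ hδ]; exact ha
    have hXδ : 0 ≤ X / δ := by positivity
    have hXR : 0 ≤ X / δ * R := by positivity
    have h3 : ‖(b : ℂ)‖ ≤ X + X / δ * R := by
      rw [show (b : ℂ) = ((a : ℂ) * z + b) - a * z by ring]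
      refine (norm_sub_le _ _).trans ?_
      rw [norm_mul]
      have : ‖(a : ℂ)‖ ≤ X / δ := by simpa using ha'
      gcongr
    have h4 : |(b : ℝ)| ≤ X + X / δ * R := by simpa using h3
    exact ⟨by rw [hC]; linarith, by rw [hC]; linarith⟩
  have hmem : ∀ a : ℤ, |(a : ℝ)| ≤ C → a ∈ Set.Icc (-⌈C⌉) ⌈C⌉ := by
    intro a ha
    have h1 := abs_le.mp ha
    have h2 := Int.le_ceil C
    constructor
    · have : (-⌈C⌉ : ℝ) ≤ a := by linarith [h1.1]
      exact_mod_cast this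
    · have : (a : ℝ) ≤ ⌈C⌉ := by linarith [h1.2]
      exact_mod_cast this
  have k0 := key (γ 0 0) (γ 0 1) (hnum.trans (by rw [hX]; gcongr; linarith))
  have k1 := key (γ 1 0) (γ 1 1) (hden.trans (by rw [hX]; nlinarith))
  intro i j
  fin_cases i <;> fin_cases j
  · exact hmem _ k0.1
  · exact hmem _ k0.2
  · exact hmem _ k1.1
  · exact hmem _ k1.2

lemma eventually_not_eqv {z w : ℂ} (hz : 0 < z.im) (hw : 0 < w.im) (h : ¬ Eqv z w) :
    ∀ᶠ p : ℂ × ℂ in 𝓝 z ×ˢ 𝓝 w, ¬ Eqv p.1 p.2 := by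
  set R : ℝ := ‖z‖ + ‖w‖ + 1 with hR
  set δ : ℝ := min z.im w.im / 2 with hδ
  have hm : 0 < min z.im w.im := lt_min hz hw
  have hδ0 : 0 < δ := by positivity
  have hfin := finite_bounded R δ hδ0
  have hnorm : ∀ x : ℂ, ‖x‖ < R → ∀ᶠ y in 𝓝 x, ‖y‖ ≤ R := fun x hx =>
    (continuous_norm.tendsto x).eventually_le_const hx
  have him : ∀ x : ℂ, δ < x.im → ∀ᶠ y in 𝓝 x, δ ≤ y.im := fun x hx =>
    (continuous_im.tendsto x).eventually_const_le hx
  have hmz : min z.im w.im ≤ z.im := min_le_left _ _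
  have hmw : min z.im w.im ≤ w.im := min_le_right _ _
  have e1 := ((hnorm z (by rw [hR]; linarith [norm_nonneg w])).and
    (him z (by rw [hδ]; linarith))).prod_mk
    ((hnorm w (by rw [hR]; linarith [norm_nonneg z])).and (him w (by rw [hδ]; linarith)))
  have e2 : ∀ᶠ p : ℂ × ℂ in 𝓝 z ×ˢ 𝓝 w, ∀ γ ∈ hfin.toFinset, p.2 ≠ mob γ p.1 := by
    rw [Filter.eventually_all_finset]
    intro γ hγ
    have hγ' : InG γ := (hfin.mem_toFinset.mp hγ).1
    have hc : Tendsto (fun p : ℂ × ℂ => p.2 - mob γ p.1) (𝓝 z ×ˢ 𝓝 w) (𝓝 (w - mob γ z)) :=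
      tendsto_snd.sub ((differentiableAt_mob hγ'.det_pos hz).continuousAt.tendsto.comp tendsto_fst)
    have hne : w - mob γ z ≠ 0 := sub_ne_zero.mpr fun hh => h ⟨γ, hγ', hh⟩
    filter_upwards [hc.eventually_ne hne] with p hp using sub_ne_zero.mp hp
  filter_upwards [e1, e2] with p hp1 hp2
  rintro ⟨γ, hγ, hp⟩
  refine hp2 γ (hfin.mem_toFinset.mpr ⟨hγ, p.1, hp1.1.2, hp1.1.1, ?_, ?_⟩) hp
  · rw [← hp]; exact hp1.2.2
  · rw [← hp]; exact hp1.2.1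

/-- The values taken by `j₆` at two inequivalent points. -/
def badSet : Set ℂ := {t | ∃ z w : ℂ, 0 < z.im ∧ 0 < w.im ∧ J z = t ∧ J w = t ∧ ¬ Eqv z w}

lemma isOpen_badSet : IsOpen badSet := by
  rw [isOpen_iff_mem_nhds]
  rintro t ⟨z, w, hz, hw, hzt, hwt, h⟩
  obtain ⟨p, hp, q, hq, hpq⟩ := Filter.eventually_prod_iff.mp (eventually_not_eqv hz hw h)
  have h1 : J '' {x | p x ∧ 0 < x.im} ∈ 𝓝 t := by
    rw [← hzt, ← map_nhds_J hz]
    exact image_mem_map (hp.and (UH_mem_nhds hz))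
  have h2 : J '' {x | q x ∧ 0 < x.im} ∈ 𝓝 t := by
    rw [← hwt, ← map_nhds_J hw]
    exact image_mem_map (hq.and (UH_mem_nhds hw))
  filter_upwards [h1, h2]
  rintro s ⟨x, ⟨hx, hx0⟩, rfl⟩ ⟨y, ⟨hy, hy0⟩, hxy⟩
  exact ⟨x, y, hx0, hy0, rfl, hxy, hpq hx hy⟩

lemma mem_badSet_of_closure {t : ℂ} (ht : t ∈ Y) (h : t ∈ closure badSet) : t ∈ badSet := by
  obtain ⟨K, hK, hKU, hev⟩ := exists_compact_preimage ht
  obtain ⟨s, hs, hst⟩ := mem_closure_iff_seq_limit.mp h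
  have h1 : ∀ᶠ n in atTop, ∃ p : ℂ × ℂ, p ∈ K ×ˢ K ∧ J p.1 = s n ∧ J p.2 = s n ∧ ¬ Eqv p.1 p.2 := by
    filter_upwards [hst.eventually hev] with n hn
    obtain ⟨z, w, hz, hw, hzt, hwt, hne⟩ := hs n
    obtain ⟨z', hz', hzz⟩ := hn z hz hzt
    obtain ⟨w', hw', hww⟩ := hn w hw hwt
    refine ⟨(z', w'), ⟨hz', hw'⟩, by rw [hzz.J_eq hz, hzt], by rw [hww.J_eq hw, hwt], fun hzw => hne ?_⟩
    exact (hzz.trans hz hzw).trans hz (hww.symm hw)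
  obtain ⟨N, hN⟩ := eventually_atTop.mp h1
  have h2 : ∀ n, ∃ p : ℂ × ℂ, p ∈ K ×ˢ K ∧ J p.1 = s (n + N) ∧ J p.2 = s (n + N) ∧ ¬ Eqv p.1 p.2 :=
    fun n => hN (n + N) (Nat.le_add_left _ _)
  choose p hpK hp1 hp2 hpe using h2
  obtain ⟨⟨z, w⟩, ⟨hzK, hwK⟩, φ, hφ, hlim⟩ := (hK.prod hK).tendsto_subseq hpK
  have hz : 0 < z.im := hKU hzK
  have hw : 0 < w.im := hKU hwK
  have hlz : Tendsto (fun n => (p (φ n)).1) atTop (𝓝 z) := (continuous_fst.tendsto _).comp hlim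
  have hlw : Tendsto (fun n => (p (φ n)).2) atTop (𝓝 w) := (continuous_snd.tendsto _).comp hlim
  have hsl : Tendsto (fun n => s (φ n + N)) atTop (𝓝 t) :=
    hst.comp ((tendsto_add_atTop_nat N).comp hφ.tendsto_atTop)
  have hJc : ∀ {x : ℂ}, 0 < x.im → Tendsto J (𝓝 x) (𝓝 (J x)) := fun hx =>
    (differentiableOn_J.differentiableAt (UH_mem_nhds hx)).continuousAt
  have hzt : J z = t := tendsto_nhds_unique ((hJc hz).comp hlz)
    (hsl.congr fun n => (hp1 (φ n)).symm)
  have hwt : J w = t := tendsto_nhds_unique ((hJc hw).comp hlw)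
    (hsl.congr fun n => (hp2 (φ n)).symm)
  by_contra hbad
  have hE : Eqv w z := by
    by_contra hne
    exact hbad ⟨w, z, hw, hz, hwt, hzt, hne⟩
  obtain ⟨γ, hγ, hγz⟩ := hE
  obtain ⟨U, hU, hinj⟩ := J_injOn_nhds hz
  have hlw' : Tendsto (fun n => mob γ (p (φ n)).2) atTop (𝓝 z) := by
    rw [hγz]
    exact (differentiableAt_mob hγ.det_pos hw).continuousAt.tendsto.comp hlw
  obtain ⟨n, hn1, hn2⟩ := ((hlz.eventually hU).and (hlw'.eventually hU)).exists
  have hpw : 0 < (p (φ n)).2.im := hKU (hpK (φ n)).2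
  have := hinj hn1 hn2 (by rw [inv_J γ hγ _ hpw, hp1, hp2])
  exact hpe (φ n) (Eqv.symm hpw ⟨γ, hγ, this⟩)

lemma exists_eq_add_int_of_qc_eq {z w : ℂ} (h : qc z = qc w) : ∃ k : ℤ, w = z + k := by
  rw [qc, qc, Complex.exp_eq_exp_iff_exists_int] at h
  obtain ⟨k, hk⟩ := h
  refine ⟨-k, ?_⟩
  have : (2 * Real.pi * I : ℂ) ≠ 0 := Complex.two_pi_I_ne_zero
  apply mul_left_cancel₀ this
  push_cast
  linear_combination -hk

/-- Near infinity `j₆` determines `q`. -/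
lemma exists_J_inj : ∃ B : ℝ, 0 < B ∧ ∀ z w : ℂ, B ≤ z.im → B ≤ w.im → J z = J w → Eqv z w := by
  obtain ⟨C, U, hU, hL⟩ := ((differentiableOn_fJ.analyticAt ball_mem).hasStrictDerivAt
    ).hasStrictFDerivAt.exists_lipschitzOnWith
  have h1 : ∀ᶠ z in atInf, qc z ∈ U := tendsto_qc'.eventually hU
  have h2 : ∀ᶠ z in atInf, ‖qc z‖ * (C + 1) < 1 := by
    have := tendsto_qc'.norm.mul_const ((C : ℝ) + 1)
    rw [norm_zero, zero_mul] at this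
    exact this.eventually_lt_const one_pos
  obtain ⟨B, hB⟩ := exists_of_eventually_atInf (h1.and (h2.and eventually_pos))
  refine ⟨max B 1, by positivity, fun z w hz hw hzw => ?_⟩
  obtain ⟨hzU, hz1, hz0⟩ := hB z ((le_max_left _ _).trans hz)
  obtain ⟨hwU, hw1, hw0⟩ := hB w ((le_max_left _ _).trans hw)
  suffices h : qc z = qc w by
    obtain ⟨k, rfl⟩ := exists_eq_add_int_of_qc_eq h
    exact eqv_add_int z k
  by_contra hne
  have hd := hL.norm_sub_le hzU hwU
  rw [J_eq, J_eq] at hzw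
  have hx := qc_ne_zero z
  have hy := qc_ne_zero w
  have h3 : qc z - qc w = (fJ (qc z) - fJ (qc w)) * (qc z * qc w) := by
    have h4 : fJ (qc z) - fJ (qc w) = (qc w)⁻¹ - (qc z)⁻¹ := by linear_combination hzw
    rw [h4]; field_simp
  have h5 : 0 < ‖qc z - qc w‖ := norm_pos_iff.mpr (sub_ne_zero.mpr hne)
  have h6 : ‖qc z - qc w‖ ≤ C * ‖qc z - qc w‖ * (‖qc z‖ * ‖qc w‖) := by
    conv_lhs => rw [h3, norm_mul, norm_mul]
    gcongr
  have hC : (0 : ℝ) ≤ C := C.2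
  have h7 : ‖qc w‖ < 1 := norm_qc_lt_one hw0
  have h8 : C * (‖qc z‖ * ‖qc w‖) < 1 := by
    have h9 := norm_nonneg (qc z)
    have : ‖qc z‖ * ‖qc w‖ ≤ ‖qc z‖ := mul_le_of_le_one_right h9 h7.le
    nlinarith
  nlinarith

lemma exists_not_mem_badSet : ∃ t ∈ Y, t ∉ badSet := by
  obtain ⟨B, hB0, hB⟩ := exists_J_inj
  set r : ℝ := Real.exp (-2 * Real.pi * (1 / 12)) with hr
  have hr1 : r < 1 := by
    rw [hr, Real.exp_lt_one_iff]; nlinarith [Real.pi_pos]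
  have hqr : ∀ w : ℂ, 1 / 12 ≤ w.im → qc w ∈ Metric.closedBall (0 : ℂ) r := fun w hw => by
    rw [mem_closedBall_zero_iff, norm_qc, hr, Real.exp_le_exp]
    nlinarith [Real.pi_pos]
  have hbd : ∀ g : ℂ → ℂ, DifferentiableOn ℂ g (Metric.ball 0 1) →
      ∃ C, ∀ w : ℂ, 1 / 12 ≤ w.im → ‖g (qc w)‖ ≤ C := by
    intro g hg
    obtain ⟨C, hC⟩ := (isCompact_closedBall (0 : ℂ) r).exists_bound_of_continuousOn
      (hg.continuousOn.mono (Metric.closedBall_subset_ball hr1))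
    exact ⟨C, fun w hw => hC _ (hqr w hw)⟩
  have hW : ∀ e ∈ E6', ∃ C, ∀ w : ℂ, 1 / 12 ≤ w.im → ‖J (mob (W e) w)‖ ≤ C := by
    intro e he
    obtain ⟨g, hg, hgq⟩ := exists_cuspFunction (differentiableOn_comp_mob differentiableOn_J (W_det_pos e))
      (fun z hz => (inv_J.comp_W e).add_one hz) (BddInf.of_tendsto (tendsto_J_W he))
    obtain ⟨C, hC⟩ := hbd g hg
    refine ⟨C, fun w hw => ?_⟩
    rw [hgq w (by linarith)]; exact hC w hw
  choose! C hC using hW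
  obtain ⟨Cf, hCf⟩ := hbd fJ differentiableOn_fJ
  have hlarge := ((tendsto_norm_J.eventually_gt_atTop (Real.exp (2 * Real.pi * B) + Cf)).and
    ((Filter.eventually_all_finset E6').mpr fun e _ => tendsto_norm_J.eventually_gt_atTop (C e))).and
    (eventually_im_gt B)
  obtain ⟨τ, ⟨h1, h2⟩, h3⟩ := hlarge.exists
  have hτ : 0 < τ.im := hB0.trans h3
  have key : ∀ w : ℂ, 0 < w.im → J w = J τ → Eqv τ w := by
    intro w hw hwτ
    obtain ⟨e, he, v, hv, -, hvw⟩ := exists_reduction_strip hw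
    have hv0 : 0 < v.im := by linarith
    have hWv := mob_im_pos (W_det_pos e) hv0
    have hJv : J (mob (W e) v) = J τ := by rw [← hvw.J_eq hWv, hwτ]
    rcases E6_cases he with rfl | he'
    · rw [W_one, mob_one] at hJv hvw
      refine (hB τ v h3.le ?_ hJv.symm).trans hτ hvw
      by_contra hlt
      rw [← hJv, J_eq] at h1
      have h4 := hCf v hv
      have h5 : ‖(qc v)⁻¹‖ ≤ Real.exp (2 * Real.pi * B) := by
        rw [norm_inv, norm_qc, ← Real.exp_neg, Real.exp_le_exp]
        nlinarith [Real.pi_pos]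
      linarith [norm_add_le (qc v)⁻¹ (fJ (qc v))]
    · have := h2 e he'
      rw [← hJv] at this
      linarith [hC e he' v hv]
  refine ⟨J τ, J_mem_Y hτ, ?_⟩
  rintro ⟨z, w, hz, hw, hzt, hwt, hne⟩
  exact hne (((key z hz hzt).symm hτ).trans hz (key w hw hwt))

lemma isPreconnected_Y : IsPreconnected Y := by
  have h : Y = (((E6'.image tE : Finset ℂ) : Set ℂ))ᶜ := by
    ext t
    simp only [Y, Finset.coe_image, Set.mem_compl_iff, Set.mem_image, Finset.mem_coe, not_exists,
      not_and, Set.mem_ofPred_eq]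
    exact ⟨fun h e he hh => h e he hh.symm, fun h e he hh => h e he hh.symm⟩
  rw [h]
  exact ((Finset.countable_toSet _).isPathConnected_compl_of_one_lt_rank
    (by rw [Complex.rank_real_complex]; norm_num)).isConnected.isPreconnected

/-- `j₆` separates the orbits of `Γ₀(6)`. -/
theorem eqv_of_J_eq {z w : ℂ} (hz : 0 < z.im) (hw : 0 < w.im) (h : J z = J w) : Eqv z w := by
  by_contra hne
  have hbad : J z ∈ badSet := ⟨z, w, hz, hw, rfl, h.symm, hne⟩
  obtain ⟨t, htY, ht⟩ := exists_not_mem_badSet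
  have hsub := isPreconnected_Y.subset_left_of_subset_union isOpen_badSet
    (isClosed_closure (s := badSet)).isOpen_compl
    (Set.disjoint_left.mpr fun x hx hx' => hx' (subset_closure hx))
    (fun x hx => by
      by_cases hxc : x ∈ closure badSet
      · exact Or.inl (mem_badSet_of_closure hx hxc)
      · exact Or.inr hxc) ⟨J z, J_mem_Y hz, hbad⟩
  exact ht (hsub htY)

lemma J_not_const (c : ℂ) : ¬ ∀ z : ℂ, 0 < z.im → J z = c := by
  intro h
  obtain ⟨z, hz1, hz2⟩ := ((tendsto_norm_J.eventually_gt_atTop ‖c‖).and eventually_pos).exists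
  rw [h z hz2] at hz1
  exact lt_irrefl _ hz1

/-- Every complex number other than the three finite cuspidal values is a value of `j₆`. -/
theorem exists_J_eq {t : ℂ} (ht : t ∈ Y) : ∃ z : ℂ, 0 < z.im ∧ J z = t := by
  by_contra! hne
  have hd : DifferentiableOn ℂ (fun z => (J z - t)⁻¹) UH :=
    (differentiableOn_J.sub_const t).inv fun z hz => sub_ne_zero.mpr (hne z hz)
  obtain ⟨c, hc⟩ := eq_const_of_bdd hd (fun γ hγ z hz => by simp only [inv_J γ hγ z hz]) fun e he => by
    obtain ⟨ε, hε, h⟩ := eventually_J_W_far ht he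
    refine ⟨ε⁻¹, h.mono fun z hz => ?_⟩
    rw [norm_inv]
    gcongr
  refine J_not_const (c⁻¹ + t) fun z hz => ?_
  rw [← hc z hz, inv_inv]; ring

/-- Representatives of `Γ₀(6)`-cosets of integral matrices of determinant `e * A * D`. -/
def repM (e A D B : ℕ) : Matrix (Fin 2) (Fin 2) ℤ :=
  !![W e 0 0 * A, W e 0 0 / e * B + W e 0 1 * D; W e 1 0 * A, W e 1 0 / e * B + W e 1 1 * D]

lemma repM_one (A D B : ℕ) : repM 1 A D B = !![(A : ℤ), B; 0, D] := by simp [repM, W_one]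

lemma repM_two (A D B : ℕ) : repM 2 A D B = !![2 * (A : ℤ), B - D; 6 * A, 3 * B - 2 * D] := by
  simp [repM, W_two, sub_eq_add_neg]

lemma repM_three (A D B : ℕ) : repM 3 A D B = !![3 * (A : ℤ), B - 2 * D; 6 * A, 2 * B - 3 * D] := by
  simp [repM, W_three, sub_eq_add_neg]

lemma repM_six (A D B : ℕ) : repM 6 A D B = !![0, -(D : ℤ); 6 * A, B] := by
  simp [repM, W_six]

lemma smul_repM {e : ℕ} (he : e ∈ E6) (A D B : ℕ) :
    (e : ℤ) • repM e A D B = W e * !![(e : ℤ) * A, B; 0, e * D] := by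
  refine forall_E6 (p := fun e => (e : ℤ) • repM e A D B = W e * !![(e : ℤ) * A, B; 0, e * D]) ?_ ?_ ?_ ?_ e he
  · ext i j; fin_cases i <;> fin_cases j <;> simp [repM_one, W_one]
  · ext i j; fin_cases i <;> fin_cases j <;> simp [repM_two, W_two, mul_apply] <;> ring
  · ext i j; fin_cases i <;> fin_cases j <;> simp [repM_three, W_three, mul_apply] <;> ring
  · ext i j; fin_cases i <;> fin_cases j <;> simp [repM_six, W_six, mul_apply]

lemma det_repM {e : ℕ} (he : e ∈ E6) (A D B : ℕ) : (repM e A D B).det = e * (A * D) := by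
  refine forall_E6 (p := fun e => (repM e A D B).det = e * (A * D)) ?_ ?_ ?_ ?_ e he
  · simp [repM_one, det_fin_two]
  · simp [repM_two, det_fin_two]; ring
  · simp [repM_three, det_fin_two]; ring
  · simp [repM_six, det_fin_two]; ring

lemma dvd_repM {e : ℕ} (he : e ∈ E6) (A D B : ℕ) : 6 ∣ repM e A D B 1 0 := by
  refine forall_E6 (p := fun e => 6 ∣ repM e A D B 1 0) ?_ ?_ ?_ ?_ e he
  · simp [repM_one]
  · simp [repM_two]
  · simp [repM_three]
  · simp [repM_six]

lemma E6_pos {e : ℕ} (he : e ∈ E6) : 0 < e := by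
  refine forall_E6 (p := fun e => 0 < e) ?_ ?_ ?_ ?_ e he <;> norm_num

lemma mob_repM {e : ℕ} (he : e ∈ E6) {A D B : ℕ} (hA : 0 < A) (hD : 0 < D) {z : ℂ} (hz : 0 < z.im) :
    mob (repM e A D B) z = mob (W e) (((e * A : ℕ) * z + B) / (e * D : ℕ)) := by
  have h0 := E6_pos he
  have hdet : 0 < (!![(e : ℤ) * A, B; 0, e * D]).det := by
    rw [det_fin_two_of, mul_zero, sub_zero]; positivity
  rw [← mob_smul (k := (e : ℤ)) (by positivity) (repM e A D B), smul_repM he, mob_mul _ _ hdet hz]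
  congr 1
  simp [mob]

/-- The pairs `(A, D)` with `e * A * D = n`. -/
def dv (n e : ℕ) : Finset (ℕ × ℕ) := if e ∣ n then (n / e).divisorsAntidiagonal else ∅

lemma mem_dv {n e : ℕ} (hn : 0 < n) {p : ℕ × ℕ} : p ∈ dv n e ↔ e * (p.1 * p.2) = n := by
  unfold dv
  split_ifs with h
  · obtain ⟨k, rfl⟩ := h
    have he := Nat.pos_of_mul_pos_right hn
    have hk : 0 < k := Nat.pos_of_mul_pos_left hn
    rw [Nat.mul_div_cancel_left _ he, Nat.mem_divisorsAntidiagonal]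
    constructor
    · rintro ⟨h, -⟩; rw [h]
    · intro h; exact ⟨Nat.eq_of_mul_eq_mul_left he h, hk.ne'⟩
  · simp only [Finset.notMem_empty, false_iff]
    rintro rfl
    exact h (dvd_mul_right _ _)

/-- Index type of the coset representatives `(e, (A, D), B)`. -/
abbrev Ix := (_ : ℕ) × (_ : ℕ × ℕ) × ℕ

/-- The matrix attached to an index. -/
def Ix.mat (i : Ix) : Matrix (Fin 2) (Fin 2) ℤ := repM i.1 i.2.1.1 i.2.1.2 i.2.2

/-- The indices of all cosets of determinant `n`. -/
def Idx (n : ℕ) : Finset Ix := E6.sigma fun e => (dv n e).sigma fun p => Finset.range (e * p.2)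

/-- The index represents a scalar matrix. -/
def Ix.Scalar (i : Ix) : Prop := i.1 = 1 ∧ i.2.1.1 = i.2.1.2 ∧ i.2.2 = 0

lemma mem_Idx {n : ℕ} (hn : 0 < n) {i : Ix} :
    i ∈ Idx n ↔ i.1 ∈ E6 ∧ i.1 * (i.2.1.1 * i.2.1.2) = n ∧ i.2.2 < i.1 * i.2.1.2 := by
  rw [Idx, Finset.mem_sigma, Finset.mem_sigma, mem_dv hn, Finset.mem_range]

/-- Integral matrices of determinant `n` whose lower left entry is divisible by `6`. -/
def InO (n : ℕ) (M : Matrix (Fin 2) (Fin 2) ℤ) : Prop := M.det = n ∧ 6 ∣ M 1 0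

lemma InO.det_pos {n : ℕ} (hn : 0 < n) {M : Matrix (Fin 2) (Fin 2) ℤ} (hM : InO n M) : 0 < M.det := by
  rw [hM.1]; exact_mod_cast hn

lemma InG.mul_inO {n : ℕ} {γ M : Matrix (Fin 2) (Fin 2) ℤ} (hγ : InG γ) (hM : InO n M) : InO n (γ * M) := by
  refine ⟨by rw [det_mul, hγ.1, hM.1, one_mul], ?_⟩
  simp only [mul_apply, Fin.sum_univ_two]
  exact dvd_add (hγ.2.mul_right _) (hM.2.mul_left _)

lemma InO.mul_inG {n : ℕ} {γ M : Matrix (Fin 2) (Fin 2) ℤ} (hM : InO n M) (hγ : InG γ) : InO n (M * γ) := by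
  refine ⟨by rw [det_mul, hγ.1, hM.1, mul_one], ?_⟩
  simp only [mul_apply, Fin.sum_univ_two]
  exact dvd_add (hM.2.mul_right _) (hγ.2.mul_left _)

lemma inO_mat {n : ℕ} (hn : 0 < n) {i : Ix} (hi : i ∈ Idx n) : InO n i.mat := by
  rw [mem_Idx hn] at hi
  refine ⟨?_, dvd_repM hi.1 _ _ _⟩
  rw [Ix.mat, det_repM hi.1, ← hi.2.1]; push_cast; ring

lemma gcd_eq_one_of_mul_eq_six {s e : ℕ} (h : 6 = s * e) : Nat.gcd s e = 1 := by
  have hs : s ≤ 6 := Nat.le_of_dvd (by norm_num) ⟨e, h⟩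
  have he : e ≤ 6 := Nat.le_of_dvd (by norm_num) ⟨s, by rw [h, mul_comm]⟩
  interval_cases s <;> interval_cases e <;> first | omega | rfl

lemma exists_eq_mul_mat {n : ℕ} (hn : 0 < n) {M : Matrix (Fin 2) (Fin 2) ℤ} (hM : InO n M) :
    ∃ i ∈ Idx n, ∃ γ, InG γ ∧ M = γ * i.mat := by
  obtain ⟨hdet, h6⟩ := hM
  rw [det_fin_two] at hdet
  have hn' : (0 : ℤ) < n := by exact_mod_cast hn
  obtain ⟨a, b, c, d, rfl⟩ : ∃ a b c d, M = !![a, b; c, d] := ⟨_, _, _, _, eta_fin_two M⟩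
  simp only [of_apply, cons_val', cons_val_zero, cons_val_one, cons_val_fin_one] at hdet h6
  have hg : 0 < Int.gcd a c := by
    rw [Int.gcd_pos_iff]
    by_contra! h
    rw [h.1, h.2] at hdet
    omega
  obtain ⟨p, r, hpr, ha, hc⟩ := Int.exists_gcd_one hg
  obtain ⟨s, hs⟩ : ∃ s, s = Int.gcd r 6 := ⟨_, rfl⟩
  obtain ⟨e, he6⟩ : s ∣ 6 := by rw [hs]; exact_mod_cast Int.gcd_dvd_right r 6
  have hE : e ∈ E6 := by
    have : e ∈ Nat.divisors 6 := by rw [Nat.mem_divisors]; exact ⟨⟨s, by rw [he6, mul_comm]⟩, by norm_num⟩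
    have h2 : Nat.divisors 6 = E6 := by decide
    rwa [h2] at this
  have he0 := E6_pos hE
  obtain ⟨r', hr'⟩ : (s : ℤ) ∣ r := by rw [hs]; exact Int.gcd_dvd_left r 6
  have hs0 : (s : ℤ) ≠ 0 := by rintro h; rw [Nat.cast_eq_zero] at h; rw [h] at he6; omega
  have hre : Int.gcd r e = 1 := by
    have h1 : Int.gcd r' e = 1 := by
      have : Int.gcd r 6 = s * Int.gcd r' e := by
        rw [hr', show (6 : ℤ) = s * e by exact_mod_cast he6, Int.gcd_mul_left]; simp
      rw [← hs] at this
      have hs1 : 0 < s := by omega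
      exact Nat.eq_of_mul_eq_mul_left hs1 (by omega)
    have h2 : Int.gcd (s : ℤ) e = 1 := by
      rw [Int.gcd_natCast_natCast]
      exact gcd_eq_one_of_mul_eq_six he6
    rw [hr']
    exact Int.isCoprime_iff_gcd_eq_one.1
      (IsCoprime.mul_left (Int.isCoprime_iff_gcd_eq_one.2 h2) (Int.isCoprime_iff_gcd_eq_one.2 h1))
  obtain ⟨g, hgdef⟩ : ∃ g, g = Int.gcd a c := ⟨_, rfl⟩
  rw [← hgdef] at ha hc hg
  obtain ⟨A, hA⟩ : e ∣ g := by
    have h1 : (6 : ℤ) ∣ r * g := by rw [← hc]; exact h6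
    have h2 : (e : ℤ) ∣ r * g := dvd_trans ⟨s, by rw [show (6 : ℤ) = s * e by exact_mod_cast he6, mul_comm]⟩ h1
    exact_mod_cast (Int.isCoprime_iff_gcd_eq_one.2 (by rwa [Int.gcd_comm])).dvd_of_dvd_mul_left h2
  have hcop : IsCoprime (p * e) r :=
    IsCoprime.mul_left (Int.isCoprime_iff_gcd_eq_one.2 hpr)
      (Int.isCoprime_iff_gcd_eq_one.2 (by rwa [Int.gcd_comm]))
  obtain ⟨u, v, huv⟩ := hcop
  have hgpos : (0 : ℤ) < g := by exact_mod_cast hg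
  have hnD : (n : ℤ) = g * (p * d - r * b) := by rw [← hdet, ha, hc]; ring
  have hDpos : 0 < p * d - r * b := by
    rw [hnD] at hn'
    exact pos_of_mul_pos_right hn' hgpos.le
  obtain ⟨D, hD⟩ : ∃ D : ℕ, (D : ℤ) = p * d - r * b := ⟨_, Int.toNat_of_nonneg hDpos.le⟩
  have hD0 : 0 < D := by omega
  have hm : 0 < (e * D : ℤ) := by positivity
  set B₀ : ℤ := e * u * b + v * d with hB₀
  obtain ⟨k, hk⟩ : ∃ k, k = B₀ / (e * D) := ⟨_, rfl⟩
  obtain ⟨B, hB⟩ : ∃ B : ℕ, (B : ℤ) = B₀ % (e * D) := ⟨_, Int.toNat_of_nonneg (Int.emod_nonneg _ hm.ne')⟩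
  have hBlt : B < e * D := by
    have := Int.emod_lt_of_pos B₀ hm
    rw [← hB] at this
    exact_mod_cast this
  have hBk : (B : ℤ) = B₀ - e * D * k := by
    have := Int.emod_add_mul_ediv B₀ (e * D)
    rw [hB, hk]; linear_combination this
  have h6e : (6 / e : ℕ) = s := by rw [he6]; exact Nat.mul_div_cancel _ he0
  obtain ⟨γ, hγ, hγW⟩ := exists_mul_W hE p (-v + e * p * k) r' (u + r * k) (by
    rw [h6e]
    linear_combination huv - (v - e * p * k) * hr')
  refine ⟨⟨e, (A, D), B⟩, ?_, γ, hγ, ?_⟩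
  · rw [mem_Idx hn]
    refine ⟨hE, ?_, hBlt⟩
    dsimp only
    have : (n : ℤ) = (e * A) * D := by rw [hD, hnD, hA]; push_cast; ring
    rw [← mul_assoc]
    exact_mod_cast this.symm
  · have hee : (e : ℤ) ≠ 0 := by positivity
    have h6 : (6 : ℤ) = s * e := by exact_mod_cast he6
    have hA' : (g : ℤ) = e * A := by exact_mod_cast hA
    have key : (e : ℤ) • !![a, b; c, d] = (e : ℤ) • (γ * repM e A D B) := by
      rw [← mul_smul_comm, smul_repM hE, ← Matrix.mul_assoc, ← hγW]
      ext i j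
      fin_cases i <;> fin_cases j <;>
        simp only [Fin.mk_zero, Fin.mk_one, Matrix.smul_apply, smul_eq_mul, of_apply, cons_val', cons_val_zero, cons_val_one,
          cons_val_fin_one, mul_apply, Fin.sum_univ_two]
      · rw [ha, hA']; ring
      · rw [hBk, hD, hB₀]
        linear_combination (-(e : ℤ) * b) * huv
      · rw [hc, hA', hr', h6]; ring
      · rw [hBk, hD, hB₀, h6]
        linear_combination (-(e : ℤ) * d) * huv + (e * (e * u * b + v * d - e * (p * d - r * b) * k)) * hr'
    ext i j
    have := congrFun (congrFun key i) j
    simp only [Matrix.smul_apply, smul_eq_mul] at this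
    exact mul_left_cancel₀ hee this

lemma gcd_unimodular {a b c d : ℤ} (h : a * d - b * c = 1) (x y : ℤ) :
    Int.gcd (a * x + b * y) (c * x + d * y) = Int.gcd x y := by
  apply Nat.dvd_antisymm
  · apply Int.dvd_gcd
    · have h1 := (Int.gcd_dvd_left (a * x + b * y) (c * x + d * y)).mul_left d
      have h2 := (Int.gcd_dvd_right (a * x + b * y) (c * x + d * y)).mul_left b
      have := dvd_sub h1 h2
      rwa [show d * (a * x + b * y) - b * (c * x + d * y) = x by linear_combination x * h] at this
    · have h1 := (Int.gcd_dvd_left (a * x + b * y) (c * x + d * y)).mul_left c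
      have h2 := (Int.gcd_dvd_right (a * x + b * y) (c * x + d * y)).mul_left a
      have := dvd_sub h2 h1
      rwa [show a * (c * x + d * y) - c * (a * x + b * y) = y by linear_combination y * h] at this
  · apply Int.dvd_gcd
    · exact dvd_add ((Int.gcd_dvd_left x y).mul_left _) ((Int.gcd_dvd_right x y).mul_left _)
    · exact dvd_add ((Int.gcd_dvd_left x y).mul_left _) ((Int.gcd_dvd_right x y).mul_left _)

lemma gcd_repM {e : ℕ} (he : e ∈ E6) (A D B : ℕ) :
    Int.gcd (repM e A D B 0 0) (repM e A D B 1 0) = e * A ∧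
      Int.gcd (6 * repM e A D B 0 0) (repM e A D B 1 0) = 6 * A := by
  refine forall_E6 (p := fun e => Int.gcd (repM e A D B 0 0) (repM e A D B 1 0) = e * A ∧
      Int.gcd (6 * repM e A D B 0 0) (repM e A D B 1 0) = 6 * A) ?_ ?_ ?_ ?_ e he
  · simp [repM_one, Int.natAbs_mul]
  · simp only [repM_two, of_apply, cons_val', cons_val_zero, cons_val_one, cons_val_fin_one,
      ← mul_assoc, Int.gcd_mul_right, Int.natAbs_natCast]
    exact ⟨rfl, rfl⟩
  · simp only [repM_three, of_apply, cons_val', cons_val_zero, cons_val_one, cons_val_fin_one,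
      ← mul_assoc, Int.gcd_mul_right, Int.natAbs_natCast]
    exact ⟨rfl, rfl⟩
  · simp [repM_six, Int.natAbs_mul]

lemma mat_unique {n : ℕ} (hn : 0 < n) {i j : Ix} (hi : i ∈ Idx n) (hj : j ∈ Idx n)
    {γ : Matrix (Fin 2) (Fin 2) ℤ} (hγ : InG γ) (h : i.mat = γ * j.mat) : i = j := by
  obtain ⟨e, ⟨A, D⟩, B⟩ := i
  obtain ⟨e', ⟨A', D'⟩, B'⟩ := j
  rw [mem_Idx hn] at hi hj
  obtain ⟨he, hAD, hB⟩ := hi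
  obtain ⟨he', hAD', hB'⟩ := hj
  dsimp only at he hAD hB he' hAD' hB'
  change repM e A D B = γ * repM e' A' D' B' at h
  obtain ⟨hdet, c, hc⟩ := hγ
  rw [det_fin_two, hc] at hdet
  have h00 : repM e A D B 0 0 = γ 0 0 * repM e' A' D' B' 0 0 + γ 0 1 * repM e' A' D' B' 1 0 := by
    rw [h, mul_apply, Fin.sum_univ_two]
  have h10 : repM e A D B 1 0 = 6 * c * repM e' A' D' B' 0 0 + γ 1 1 * repM e' A' D' B' 1 0 := by
    rw [h, mul_apply, Fin.sum_univ_two, hc]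
  have h01 : repM e A D B 0 1 = γ 0 0 * repM e' A' D' B' 0 1 + γ 0 1 * repM e' A' D' B' 1 1 := by
    rw [h, mul_apply, Fin.sum_univ_two]
  have h11 : repM e A D B 1 1 = 6 * c * repM e' A' D' B' 0 1 + γ 1 1 * repM e' A' D' B' 1 1 := by
    rw [h, mul_apply, Fin.sum_univ_two, hc]
  have g1 := gcd_unimodular hdet (repM e' A' D' B' 0 0) (repM e' A' D' B' 1 0)
  have g2 := gcd_unimodular (a := γ 0 0) (b := 6 * γ 0 1) (c := c) (d := γ 1 1)
    (by linear_combination hdet) (6 * repM e' A' D' B' 0 0) (repM e' A' D' B' 1 0)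
  rw [← h00, ← h10, (gcd_repM he A D B).1, (gcd_repM he' A' D' B').1] at g1
  rw [show γ 0 0 * (6 * repM e' A' D' B' 0 0) + 6 * γ 0 1 * repM e' A' D' B' 1 0
      = 6 * repM e A D B 0 0 by rw [h00]; ring,
    show c * (6 * repM e' A' D' B' 0 0) + γ 1 1 * repM e' A' D' B' 1 0 = repM e A D B 1 0 by
      rw [h10]; ring, (gcd_repM he A D B).2, (gcd_repM he' A' D' B').2] at g2
  obtain rfl : A = A' := by omega
  have hA : 0 < A := by
    rcases Nat.eq_zero_or_pos A with rfl | h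
    · simp at hAD; omega
    · exact h
  obtain rfl : e = e' := Nat.eq_of_mul_eq_mul_right hA g1
  have he0 := E6_pos he
  obtain rfl : D = D' := by
    rw [← hAD'] at hAD
    exact Nat.eq_of_mul_eq_mul_left hA (Nat.eq_of_mul_eq_mul_left he0 hAD)
  have hAz : (A : ℤ) ≠ 0 := by positivity
  obtain ⟨k, hk⟩ : ∃ k : ℤ, (B : ℤ) = B' + (e * D : ℕ) * k := by
    simp only [E6, Finset.mem_insert, Finset.mem_singleton] at he
    clear g1 g2 hAD hAD' hB hB' he' h hn
    generalize γ 0 0 = a at *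
    generalize γ 0 1 = b at *
    generalize γ 1 1 = d at *
    rcases he with rfl | rfl | rfl | rfl
    · simp only [repM_one, of_apply, cons_val', cons_val_zero, cons_val_one, cons_val_fin_one] at h00 h01 h10 h11
      have ha : a = 1 := mul_right_cancel₀ hAz (by linear_combination -h00)
      exact ⟨b, by rw [h01, ha]; push_cast; ring⟩
    · simp only [repM_two, of_apply, cons_val', cons_val_zero, cons_val_one, cons_val_fin_one] at h00 h01 h10 h11
      have ha : a = 1 - 3 * b := mul_right_cancel₀ hAz (by linarith)
      have hd : d = 1 - 2 * c := mul_right_cancel₀ hAz (by linarith)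
      rw [ha] at h01
      rw [ha, hd] at hdet
      obtain ⟨k, hk⟩ : (2 : ℤ) ∣ b := by
        have : 3 * b = 2 * (-c) := by linear_combination -hdet
        omega
      exact ⟨k, by push_cast; rw [hk] at h01; linear_combination h01⟩
    · simp only [repM_three, of_apply, cons_val', cons_val_zero, cons_val_one, cons_val_fin_one] at h00 h01 h10 h11
      have ha : a = 1 - 2 * b := mul_right_cancel₀ hAz (by linarith)
      have hd : d = 1 - 3 * c := mul_right_cancel₀ hAz (by linarith)
      rw [ha] at h01
      rw [ha, hd] at hdet
      obtain ⟨k, hk⟩ : (3 : ℤ) ∣ b := by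
        have : 2 * b = 3 * (-c) := by linear_combination -hdet
        omega
      exact ⟨k, by push_cast; rw [hk] at h01; linear_combination h01⟩
    · simp only [repM_six, of_apply, cons_val', cons_val_zero, cons_val_one, cons_val_fin_one] at h00 h01 h10 h11
      have hd : d = 1 := mul_right_cancel₀ hAz (by linarith)
      exact ⟨-c, by rw [hd] at h11; push_cast; linear_combination h11⟩
  obtain rfl : B = B' := by
    have h1 : (B : ℤ) < (e * D : ℕ) := by exact_mod_cast hB
    have h2 : (B' : ℤ) < (e * D : ℕ) := by exact_mod_cast hB'
    generalize ((e * D : ℕ) : ℤ) = m at *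
    have hk0 : k = 0 := by
      rcases lt_trichotomy k 0 with h | h | h
      · nlinarith
      · exact h
      · nlinarith
    rw [hk0] at hk
    omega
  rfl

instance : DecidablePred Ix.Scalar := fun i =>
  inferInstanceAs (Decidable (i.1 = 1 ∧ i.2.1.1 = i.2.1.2 ∧ i.2.2 = 0))

/-- The indices of the nonscalar cosets of determinant `n`. -/
def Idx' (n : ℕ) : Finset Ix := (Idx n).filter fun i => ¬ i.Scalar

lemma mem_Idx' {n : ℕ} {i : Ix} : i ∈ Idx' n ↔ i ∈ Idx n ∧ ¬ i.Scalar := Finset.mem_filter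

lemma mul_right_cancel_of_det {M M' N : Matrix (Fin 2) (Fin 2) ℤ} (hN : N.det ≠ 0)
    (h : M * N = M' * N) : M = M' := by
  have h' : N.det • M = N.det • M' := by
    have := congrArg (· * N.adjugate) h
    rwa [Matrix.mul_assoc, Matrix.mul_assoc, mul_adjugate, mul_smul_comm, mul_smul_comm, Matrix.mul_one,
      Matrix.mul_one] at this
  ext i j
  have := congrFun (congrFun h' i) j
  rw [Matrix.smul_apply, Matrix.smul_apply, smul_eq_mul, smul_eq_mul] at this
  exact mul_left_cancel₀ hN this

lemma Ix.Scalar.mat {i : Ix} (hi : i.Scalar) : i.mat = (i.2.1.1 : ℤ) • 1 := by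
  obtain ⟨e, ⟨A, D⟩, B⟩ := i
  obtain ⟨h1, h2, h3⟩ := hi
  dsimp only at h1 h2 h3
  subst h1 h2 h3
  rw [Ix.mat, repM_one]
  ext i j
  fin_cases i <;> fin_cases j <;> simp

lemma scalar_of_mat_eq {n : ℕ} (hn : 0 < n) {i : Ix} (hi : i ∈ Idx n)
    {γ : Matrix (Fin 2) (Fin 2) ℤ} (hγ : InG γ) {a : ℤ} (h : i.mat = a • γ) : i.Scalar := by
  have hdet := (inO_mat hn hi).1
  rw [h, det_smul, hγ.1, Fintype.card_fin, mul_one] at hdet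
  obtain ⟨A, hA⟩ := Int.eq_nat_or_neg a
  have hA2 : A * A = n := by
    have : (A * A : ℤ) = n := by rw [← hdet]; rcases hA with h | h <;> rw [h] <;> ring
    exact_mod_cast this
  have hA0 : 0 < A := by
    rcases Nat.eq_zero_or_pos A with h | h
    · simp [h] at hA2; omega
    · exact h
  have hj : (⟨1, (A, A), 0⟩ : Ix) ∈ Idx n := by
    rw [mem_Idx hn]
    exact ⟨by simp [E6], by simpa using hA2, by simpa using hA0⟩
  have hs : Ix.Scalar ⟨1, (A, A), 0⟩ := ⟨rfl, rfl, rfl⟩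
  have hm := hs.mat
  rcases hA with rfl | rfl
  · rw [mat_unique hn hi hj hγ (by rw [h, hm, mul_smul_comm, Matrix.mul_one])]
    exact hs
  · rw [mat_unique hn hi hj hγ.neg (by rw [h, hm, mul_smul_comm, Matrix.mul_one, smul_neg, neg_smul])]
    exact hs

/-- Matrices normalising both the Eichler order and `Γ₀(6)`. -/
structure Normalizes (N : Matrix (Fin 2) (Fin 2) ℤ) : Prop where
  det_pos : 0 < N.det
  order : ∀ M : Matrix (Fin 2) (Fin 2) ℤ, 6 ∣ M 1 0 →
    ∃ M' : Matrix (Fin 2) (Fin 2) ℤ, M * N = N * M' ∧ M'.det = M.det ∧ 6 ∣ M' 1 0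
  group : ∀ g, InG g → ∃ g', InG g' ∧ N * g = g' * N

lemma InG.normalizes {γ : Matrix (Fin 2) (Fin 2) ℤ} (hγ : InG γ) : Normalizes γ where
  det_pos := hγ.det_pos
  order M hM := by
    refine ⟨γ.adjugate * M * γ, ?_, ?_, ?_⟩
    · rw [← Matrix.mul_assoc, ← Matrix.mul_assoc, hγ.mul_adj, Matrix.one_mul]
    · rw [det_mul, det_mul, hγ.adj.1, hγ.1]; ring
    · obtain ⟨c, hc⟩ := hγ.adj.2
      obtain ⟨c', hc'⟩ := hγ.2
      obtain ⟨d, hd⟩ := hM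
      simp only [mul_apply, Fin.sum_univ_two, hc, hc', hd]
      exact ⟨c * M 0 0 * γ 0 0 + c * M 0 1 * c' * 6 + γ 0 0 * γ.adjugate 1 1 * d + c' * γ.adjugate 1 1 * M 1 1,
        by ring⟩
  group g hg := ⟨γ * g * γ.adjugate, (hγ.mul hg).mul hγ.adj, by
    rw [Matrix.mul_assoc _ _ γ, hγ.adj_mul, Matrix.mul_one]⟩

lemma exists_W_sq (e : ℕ) : ∃ k : ℤ, k ≠ 0 ∧ W e * W e = k • 1 := by
  unfold W
  split_ifs
  · exact ⟨-2, by norm_num, by decide⟩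
  · exact ⟨-3, by norm_num, by decide⟩
  · exact ⟨-6, by norm_num, by decide⟩
  · exact ⟨1, by norm_num, by simp⟩

lemma normalizes_W (e : ℕ) : Normalizes (W e) where
  det_pos := W_det_pos e
  order M hM := exists_W_conj e M hM
  group g hg := by
    obtain ⟨N, hN, hNd, hN6⟩ := exists_W_conj e g hg.2
    refine ⟨N, ⟨by rw [hNd, hg.1], hN6⟩, ?_⟩
    obtain ⟨k, -, hk⟩ := exists_W_sq e
    apply mul_right_cancel_of_det (W_det_pos e).ne'
    rw [Matrix.mul_assoc, hN, ← Matrix.mul_assoc, hk, Matrix.mul_assoc, hk, smul_mul_assoc,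
      mul_smul_comm, Matrix.one_mul, Matrix.mul_one]

lemma prod_comp_normalizes {n : ℕ} (hn : 0 < n) {N : Matrix (Fin 2) (Fin 2) ℤ} (hN : Normalizes N)
    {h : ℂ → ℂ} (hh : Inv h) {z : ℂ} (hz : 0 < z.im) :
    ∏ i ∈ Idx' n, h (mob i.mat (mob N z)) = ∏ i ∈ Idx' n, h (mob N (mob i.mat z)) := by
  have key : ∀ i ∈ Idx n, ∃ j ∈ Idx n, ∃ g, InG g ∧ i.mat * N = N * (g * j.mat) := by
    intro i hi
    have hO := inO_mat hn hi
    obtain ⟨M', h1, h2, h3⟩ := hN.order i.mat hO.2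
    obtain ⟨j, hj, g, hg, hM⟩ := exists_eq_mul_mat hn (M := M') ⟨by rw [h2, hO.1], h3⟩
    exact ⟨j, hj, g, hg, by rw [h1, hM]⟩
  choose! σ hσ g hg hmul using key
  have hdet := hN.det_pos.ne'
  have hmaps : Set.MapsTo σ (Idx' n) (Idx' n) := by
    intro i hi
    rw [Finset.mem_coe, mem_Idx'] at hi ⊢
    refine ⟨hσ i hi.1, fun hs => hi.2 ?_⟩
    obtain ⟨g', hg', hgg⟩ := hN.group (g i) (hg i hi.1)
    refine scalar_of_mat_eq hn hi.1 hg' (a := (σ i).2.1.1) (mul_right_cancel_of_det hdet ?_)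
    rw [hmul i hi.1, hs.mat, mul_smul_comm, Matrix.mul_one, mul_smul_comm, hgg, smul_mul_assoc]
  have hinj : Set.InjOn σ (Idx' n) := by
    intro i hi j hj hij
    rw [Finset.mem_coe, mem_Idx'] at hi hj
    obtain ⟨g', hg', hgg⟩ := hN.group (g i * (g j).adjugate) ((hg i hi.1).mul (hg j hj.1).adj)
    refine mat_unique hn hi.1 hj.1 hg' (mul_right_cancel_of_det hdet ?_)
    rw [Matrix.mul_assoc, hmul j hj.1, ← Matrix.mul_assoc, ← hgg, Matrix.mul_assoc, Matrix.mul_assoc,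
      ← Matrix.mul_assoc _ (g j), (hg j hj.1).adj_mul, Matrix.one_mul, hmul i hi.1, hij]
  refine Finset.prod_nbij σ hmaps hinj (Finset.surjOn_of_injOn_of_card_le σ hmaps hinj le_rfl) ?_
  intro i hi
  rw [mem_Idx'] at hi
  have hz' : 0 < (mob (σ i).mat z).im := mob_im_pos ((inO_mat hn (hσ i hi.1)).det_pos hn) hz
  obtain ⟨g', hg', hgg⟩ := hN.group (g i) (hg i hi.1)
  rw [← mob_mul _ _ hN.det_pos hz, hmul i hi.1, ← Matrix.mul_assoc, hgg, Matrix.mul_assoc,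
    mob_mul _ _ (by rw [det_mul]; exact mul_pos hN.det_pos ((inO_mat hn (hσ i hi.1)).det_pos hn)) hz,
    mob_mul _ _ ((inO_mat hn (hσ i hi.1)).det_pos hn) hz]
  exact hh _ hg' _ (mob_im_pos hN.det_pos hz')

/-- The modular polynomial of determinant `n` on the diagonal, with the scalar factor removed. -/
noncomputable def diagF (n : ℕ) (z : ℂ) : ℂ := ∏ i ∈ Idx' n, (J z - J (mob i.mat z))

lemma Idx'_det_pos {n : ℕ} (hn : 0 < n) {i : Ix} (hi : i ∈ Idx' n) : 0 < i.mat.det :=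
  (inO_mat hn (mem_Idx'.1 hi).1).det_pos hn

lemma inv_diagF {n : ℕ} (hn : 0 < n) : Inv (diagF n) := by
  intro γ hγ z hz
  rw [diagF, diagF, prod_comp_normalizes hn hγ.normalizes (h := fun w => J (mob γ z) - J w)
    (fun g hg w hw => by dsimp only; rw [inv_J g hg w hw]) hz]
  refine Finset.prod_congr rfl fun i hi => ?_
  rw [inv_J γ hγ z hz, inv_J γ hγ _ (mob_im_pos (Idx'_det_pos hn hi) hz)]

lemma differentiableOn_diagF {n : ℕ} (hn : 0 < n) : DifferentiableOn ℂ (diagF n) UH := by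
  refine DifferentiableOn.fun_finsetProd fun i hi => ?_
  exact differentiableOn_J.sub (differentiableOn_comp_mob differentiableOn_J (Idx'_det_pos hn hi))

lemma diagF_W {n : ℕ} (hn : 0 < n) {e : ℕ} (he : e ∈ E6') {z : ℂ} (hz : 0 < z.im) :
    diagF n (mob (W e) z) = diagF n z * (-kE e) ^ (Idx' n).card / (J z - tE e) ^ (Idx' n).card *
      (∏ i ∈ Idx' n, (J (mob i.mat z) - tE e))⁻¹ := by
  rw [diagF, prod_comp_normalizes hn (normalizes_W e) (h := fun w => J (mob (W e) z) - J w)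
    (fun g hg w hw => by dsimp only; rw [inv_J g hg w hw]) hz]
  rw [diagF, ← Finset.prod_const, ← Finset.prod_const, ← Finset.prod_mul_distrib, ← Finset.prod_div_distrib,
    ← Finset.prod_inv_distrib, ← Finset.prod_mul_distrib]
  refine Finset.prod_congr rfl fun i hi => ?_
  have hw := mob_im_pos (Idx'_det_pos hn hi) hz
  rw [J_W he hz, J_W he hw]
  have h1 := J_sub_ne_zero he hz
  have h2 := J_sub_ne_zero he hw
  field_simp
  ring

/-- The affine map `z ↦ (a z + B) / m`. -/
noncomputable def aff (a m B : ℕ) (z : ℂ) : ℂ := (a * z + B) / m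

lemma aff_im (a m B : ℕ) (z : ℂ) : (aff a m B z).im = a / m * z.im := by
  rw [aff, div_natCast_im]
  simp
  ring

lemma aff_im_pos {a m : ℕ} (ha : 0 < a) (hm : 0 < m) (B : ℕ) {z : ℂ} (hz : 0 < z.im) :
    0 < (aff a m B z).im := by
  rw [aff_im]; positivity

lemma tendsto_aff {a m : ℕ} (ha : 0 < a) (hm : 0 < m) (B : ℕ) : Tendsto (aff a m B) atInf atInf := by
  rw [tendsto_comap_iff]
  have : Complex.im ∘ aff a m B = fun z => (a / m : ℝ) * z.im := by
    ext z; exact aff_im a m B z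
  rw [this]
  exact Tendsto.const_mul_atTop (by positivity) tendsto_comap

/-- A primitive root of unity. -/
noncomputable def rootU (m : ℕ) : ℂ := exp (2 * Real.pi * I / m)

lemma isPrimitiveRoot_rootU {m : ℕ} (hm : 0 < m) : IsPrimitiveRoot (rootU m) m :=
  Complex.isPrimitiveRoot_exp m hm.ne'

lemma qc_aff {m : ℕ} (a B : ℕ) (z : ℂ) :
    qc (aff a m B z) = rootU m ^ B * qc (aff a m 0 z) := by
  rw [qc, qc, rootU, ← Complex.exp_nat_mul, ← Complex.exp_add]
  congr 1
  simp only [aff]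
  push_cast
  ring

lemma qc_aff_pow {m : ℕ} (hm : 0 < m) (a B : ℕ) (z : ℂ) : qc (aff a m B z) ^ m = qc z ^ a := by
  rw [qc_aff, mul_pow, ← pow_mul, mul_comm B, pow_mul, (isPrimitiveRoot_rootU hm).pow_eq_one, one_pow,
    one_mul, ← qc_natCast_mul, ← qc_natCast_mul]
  congr 1
  have : (m : ℂ) ≠ 0 := by exact_mod_cast hm.ne'
  rw [aff]
  field_simp
  simp

lemma sum_qc_aff_pow {m k : ℕ} (hm : 0 < m) (hk0 : 0 < k) (hk : k < m) (a : ℕ) (z : ℂ) :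
    ∑ B ∈ Finset.range m, qc (aff a m B z) ^ k = 0 := by
  have h1 : ∀ B ∈ Finset.range m, qc (aff a m B z) ^ k = (rootU m ^ k) ^ B * qc (aff a m 0 z) ^ k := by
    intro B _
    rw [qc_aff, mul_pow, ← pow_mul, ← pow_mul, mul_comm B]
  rw [Finset.sum_congr rfl h1, ← Finset.sum_mul]
  have h2 : rootU m ^ k ≠ 1 := (isPrimitiveRoot_rootU hm).pow_ne_one_of_pos_of_lt hk0.ne' hk
  have h3 := mul_neg_geom_sum (rootU m ^ k) m
  rw [← pow_mul, mul_comm k, pow_mul, (isPrimitiveRoot_rootU hm).pow_eq_one, one_pow, sub_self,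
    mul_eq_zero] at h3
  rw [h3.resolve_left (sub_ne_zero.2 h2.symm), zero_mul]

lemma taylor_isLittleO {g : ℂ → ℂ} (hg : AnalyticAt ℂ g 0) (m : ℕ) :
    (fun y => g y - ∑ k ∈ Finset.range (m + 1), iteratedDeriv k g 0 / k.factorial * y ^ k)
      =o[𝓝 0] fun y => y ^ m := by
  have h := hg.hasFPowerSeriesAt.isBigO_sub_partialSum_pow (m + 1)
  have h2 : (fun y : ℂ => g y - ∑ k ∈ Finset.range (m + 1), iteratedDeriv k g 0 / k.factorial * y ^ k)
      =O[𝓝 0] fun y => y ^ (m + 1) := by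
    refine IsBigO.of_norm_right ((h.congr_left fun y => ?_).congr_right fun y => ?_)
    · rw [zero_add, FormalMultilinearSeries.partialSum]
      congr 1
      refine Finset.sum_congr rfl fun k _ => ?_
      rw [FormalMultilinearSeries.ofScalars_apply_eq, smul_eq_mul]
    · rw [norm_pow]
  refine h2.trans_isLittleO ?_
  exact isLittleO_pow_pow (lt_add_one m)

lemma sum_aff_isLittleO {g : ℂ → ℂ} (hg : AnalyticAt ℂ g 0) (hg0 : g 0 = 0) {a m : ℕ} (ha : 0 < a)
    (hm : 0 < m) :
    (fun z => ∑ B ∈ Finset.range m, g (qc (aff a m B z))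
      - m * (iteratedDeriv m g 0 / m.factorial) * qc z ^ a) =o[atInf] fun z => qc z ^ a := by
  have h1 : ∀ B ∈ Finset.range m, (fun z => g (qc (aff a m B z)) - ∑ k ∈ Finset.range (m + 1),
      iteratedDeriv k g 0 / k.factorial * qc (aff a m B z) ^ k) =o[atInf] fun z => qc z ^ a := by
    intro B _
    have h := (taylor_isLittleO hg m).comp_tendsto (tendsto_qc'.comp (tendsto_aff ha hm B))
    refine h.congr_right fun z => ?_
    simp only [Function.comp, qc_aff_pow hm]
  refine (IsLittleO.sum h1).congr_left fun z => ?_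
  rw [Finset.sum_apply, Finset.sum_sub_distrib, Finset.sum_comm]
  congr 1
  rw [Finset.sum_eq_single m]
  · rw [← Finset.mul_sum]
    simp only [qc_aff_pow hm, Finset.sum_const, Finset.card_range, nsmul_eq_mul]
    ring
  · intro k hk hkm
    rcases Nat.eq_zero_or_pos k with rfl | hk0
    · simp [hg0]
    · rw [← Finset.mul_sum, sum_qc_aff_pow hm hk0 (by rw [Finset.mem_range] at hk; omega), mul_zero]
  · intro h; simp at h

lemma prod_one_sub_isLittleO {ι : Type*} (s : Finset ι) {b : ι → ℂ → ℂ}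
    (hb : ∀ i ∈ s, b i =o[atInf] qc) :
    (fun z => ∏ i ∈ s, (1 - b i z) - 1 + ∑ i ∈ s, b i z) =o[atInf] fun z => qc z ^ 2 := by
  classical
  induction s using Finset.induction_on with
  | empty => simp
  | insert i s hi ih =>
    have ih' := ih fun j hj => hb j (Finset.mem_insert_of_mem hj)
    have hS : (fun z => ∑ j ∈ s, b j z) =o[atInf] qc :=
      (IsLittleO.sum fun j hj => hb j (Finset.mem_insert_of_mem hj)).congr_left
        fun z => Finset.sum_apply z s b
    have hq : (fun z => qc z ^ 2) =o[atInf] qc := by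
      have : (fun z => qc z * qc z) =o[atInf] fun z => qc z * 1 :=
        (isBigO_refl _ _).mul_isLittleO ((isLittleO_one_iff ℂ).2 tendsto_qc')
      simpa [← sq] using this
    have hP : (fun z => ∏ j ∈ s, (1 - b j z) - 1) =o[atInf] qc :=
      ((ih'.trans hq).sub hS).congr_left fun z => by ring
    have hmul := (hb i (Finset.mem_insert_self _ _)).mul hP
    refine (ih'.sub (hmul.congr_right fun z => (sq (qc z)).symm)).congr_left fun z => ?_
    rw [Finset.prod_insert hi, Finset.sum_insert hi]
    ring

lemma jet_prod_one_sub {ι : Type*} (s : Finset ι) {b : ι → ℂ → ℂ} {δ : ℂ}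
    (hb : ∀ i ∈ s, b i =o[atInf] qc)
    (hs : (fun z => ∑ i ∈ s, b i z - δ * qc z ^ 2) =o[atInf] fun z => qc z ^ 2) :
    Jet (fun z => ∏ i ∈ s, (1 - b i z)) 1 0 0 (-δ) := by
  have h := jet_of_expansion (F := fun z => ∏ i ∈ s, (1 - b i z)) (C := 1) (a := 0) (b := -δ) (N := 0) ?_
  · simpa using h
  · refine ((prod_one_sub_isLittleO s hb).sub hs).congr_left fun z => ?_
    rw [zpow_zero]
    ring

lemma analyticAt_fJ : AnalyticAt ℂ fJ 0 := differentiableOn_fJ.analyticAt ball_mem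

/-- The function `fJ q / q`. -/
noncomputable def gJ : ℂ → ℂ := dslope fJ 0

lemma fJ_eq (y : ℂ) : fJ y = y * gJ y := by
  have := sub_smul_dslope fJ 0 y
  simpa [fJ_zero, gJ] using this.symm

/-- The difference quotients of `gJ`. -/
noncomputable def sJ (x y : ℂ) : ℂ := (gJ x - gJ y) / (x - y)

/-- The relative correction of `J z - J w` with respect to `q(z)⁻¹ - q(w)⁻¹`. -/
noncomputable def corr (x y : ℂ) : ℂ := x * fJ y + x ^ 2 * y * sJ x y

lemma J_sub_J (z w : ℂ) :
    J z - J w = ((qc z)⁻¹ - (qc w)⁻¹) * (1 - corr (qc z) (qc w)) := by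
  have hx := qc_ne_zero z
  have hy := qc_ne_zero w
  rw [J_eq, J_eq]
  generalize qc z = x at *
  generalize qc w = y at *
  rcases eq_or_ne x y with rfl | hxy
  · simp
  · have := sub_ne_zero.2 hxy
    rw [corr, sJ, fJ_eq x, fJ_eq y]
    field_simp
    ring

lemma sJ_isBigO {w : ℂ → ℂ} (hw : Tendsto w atInf (𝓝 0)) :
    (fun z => sJ (qc z) (w z)) =O[atInf] fun _ => (1 : ℂ) := by
  have h : AnalyticAt ℂ gJ 0 :=
    ((differentiableOn_dslope ball_mem).mpr differentiableOn_fJ).analyticAt ball_mem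
  obtain ⟨K, s, hs, hl⟩ := h.hasStrictDerivAt.hasStrictFDerivAt.exists_lipschitzOnWith
  refine IsBigO.of_bound K ?_
  filter_upwards [tendsto_qc' hs, hw hs] with z hx hy
  rw [sJ, norm_div, norm_one, mul_one]
  refine div_le_of_le_mul₀ (norm_nonneg _) K.2 ?_
  simpa [dist_eq_norm] using hl.dist_le_mul _ hx _ hy

lemma tendsto_fJ {w : ℂ → ℂ} (hw : Tendsto w atInf (𝓝 0)) : Tendsto (fun z => fJ (w z)) atInf (𝓝 0) := by
  have := analyticAt_fJ.continuousAt.tendsto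
  rw [fJ_zero] at this
  exact this.comp hw

lemma corr_sub_isLittleO {w : ℂ → ℂ} (hw : Tendsto w atInf (𝓝 0)) :
    (fun z => corr (qc z) (w z) - qc z * fJ (w z)) =o[atInf] fun z => qc z ^ 2 := by
  have h : (fun z => qc z ^ 2 * (w z * sJ (qc z) (w z))) =o[atInf] fun z => qc z ^ 2 * ((1 : ℂ) * 1) :=
    (isBigO_refl _ _).mul_isLittleO (((isLittleO_one_iff ℂ).2 hw).mul_isBigO (sJ_isBigO hw))
  refine (h.congr_left fun z => ?_).congr_right fun z => ?_
  · rw [corr]; ring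
  · ring

lemma sq_isLittleO : (fun z => qc z ^ 2) =o[atInf] qc := by
  have : (fun z => qc z * qc z) =o[atInf] fun z => qc z * 1 :=
    (isBigO_refl _ _).mul_isLittleO ((isLittleO_one_iff ℂ).2 tendsto_qc')
  simpa [← sq] using this

lemma corr_isLittleO {w : ℂ → ℂ} (hw : Tendsto w atInf (𝓝 0)) :
    (fun z => corr (qc z) (w z)) =o[atInf] qc := by
  have h : (fun z => qc z * fJ (w z)) =o[atInf] fun z => qc z * 1 :=
    (isBigO_refl _ _).mul_isLittleO ((isLittleO_one_iff ℂ).2 (tendsto_fJ hw))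
  simp only [mul_one] at h
  refine (((corr_sub_isLittleO hw).trans sq_isLittleO).add h).congr_left fun z => ?_
  ring

lemma pow_isLittleO {k : ℕ} (hk : 2 < k) : (fun z => qc z ^ k) =o[atInf] fun z => qc z ^ 2 :=
  (isLittleO_pow_pow hk).comp_tendsto tendsto_qc'

lemma tendsto_qc_aff {a m : ℕ} (ha : 0 < a) (hm : 0 < m) (B : ℕ) :
    Tendsto (fun z => qc (aff a m B z)) atInf (𝓝 0) := tendsto_qc'.comp (tendsto_aff ha hm B)

lemma sum_corr_isLittleO {A D : ℕ} (hA : 0 < A) (hD : 0 < D) :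
    (fun z => ∑ B ∈ Finset.range D, corr (qc z) (qc (aff A D B z))
      - (if A = 1 then D * cJ D else 0) * qc z ^ 2) =o[atInf] fun z => qc z ^ 2 := by
  have h1 : (fun z => ∑ B ∈ Finset.range D, (corr (qc z) (qc (aff A D B z)) - qc z * fJ (qc (aff A D B z))))
      =o[atInf] fun z => qc z ^ 2 :=
    (IsLittleO.sum fun B _ => corr_sub_isLittleO (tendsto_qc_aff hA hD B)).congr_left
      fun z => Finset.sum_apply _ _ _
  have h2 := (isBigO_refl qc atInf).mul_isLittleO (sum_aff_isLittleO analyticAt_fJ fJ_zero hA hD)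
  have h3 : (fun z => qc z * qc z ^ A) =O[atInf] fun z => qc z ^ 2 := by
    have : (fun z => qc z ^ (A + 1)) =O[atInf] fun z => qc z ^ 2 := by
      rcases (show A + 1 = 2 ∨ 2 < A + 1 by omega) with h | h
      · rw [h]
      · exact (pow_isLittleO h).isBigO
    exact this.congr_left fun z => by ring
  have h4 : (fun z => D * cJ D * (qc z * qc z ^ A) - (if A = 1 then D * cJ D else 0) * qc z ^ 2)
      =o[atInf] fun z => qc z ^ 2 := by
    split_ifs with h
    · subst h
      exact (isLittleO_zero _ _).congr_left fun z => by ring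
    · have : (fun z => qc z ^ (A + 1)) =o[atInf] fun z => qc z ^ 2 := pow_isLittleO (by omega)
      exact (this.const_mul_left (D * cJ D)).congr_left fun z => by ring
  refine ((h1.add (h2.trans_isBigO h3)).add h4).congr_left fun z => ?_
  rw [Finset.sum_sub_distrib, ← Finset.mul_sum, cJ]
  ring

lemma prod_inv_sub_inv {A D : ℕ} (hD : 0 < D) (z : ℂ) :
    ∏ B ∈ Finset.range D, ((qc z)⁻¹ - (qc (aff A D B z))⁻¹) = ((qc z)⁻¹) ^ D - ((qc z)⁻¹) ^ A := by
  have h := X_pow_sub_C_eq_prod (isPrimitiveRoot_rootU hD).inv (α := (qc (aff A D 0 z))⁻¹)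
    (a := ((qc z)⁻¹) ^ A) hD (by rw [inv_pow, qc_aff_pow hD, inv_pow])
  have h2 := congrArg (Polynomial.eval (qc z)⁻¹) h
  rw [Polynomial.eval_prod] at h2
  simp only [Polynomial.eval_sub, Polynomial.eval_pow, Polynomial.eval_X, Polynomial.eval_C] at h2
  rw [h2]
  refine Finset.prod_congr rfl fun B _ => ?_
  rw [qc_aff A B, mul_inv, inv_pow]

/-- The second order contribution of a pair of exponents at distance one or two. -/
noncomputable def dif (A D : ℕ) : ℂ :=
  (if A = D + 1 ∨ D = A + 1 then 1 / 2 else 0) + (if A = D + 2 ∨ D = A + 2 then 1 else 0)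

lemma jet_one_sub_pow {k : ℕ} (hk : 0 < k) :
    ∃ a, Jet (fun z => 1 - qc z ^ k) 1 0 a (-((if k = 1 then 1 / 2 else 0) + (if k = 2 then 1 else 0))) := by
  refine ⟨-(if k = 1 then 1 else 0), ?_⟩
  have h := jet_of_expansion (F := fun z => 1 - qc z ^ k) (C := 1) (N := 0)
    (a := -(if k = 1 then 1 else 0)) (b := -(if k = 2 then 1 else 0)) ?_
  · convert h using 1
    split_ifs <;> norm_num
  · rcases (show k = 1 ∨ k = 2 ∨ 2 < k by omega) with rfl | rfl | h
    · exact (isLittleO_zero _ _).congr_left fun z => by simp; ring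
    · exact (isLittleO_zero _ _).congr_left fun z => by simp; ring
    · refine (pow_isLittleO h).neg_left.congr_left fun z => ?_
      rw [if_neg (by omega), if_neg (by omega)]
      simp

lemma jet_qc_inv_pow (k : ℕ) : Jet (fun z => ((qc z)⁻¹) ^ k) 1 k 0 0 := by
  refine (near_const 1).congr' (Eventually.of_forall fun z => ?_)
  have := qc_ne_zero z
  simp [this]

/-- `F` has a nondegenerate jet with second order coefficient `L`. -/
def HasL (F : ℂ → ℂ) (L : ℂ) : Prop := ∃ C N a, C ≠ 0 ∧ Jet F C N a L

lemma Jet.hasL {F : ℂ → ℂ} {C a L : ℂ} {N : ℤ} (h : Jet F C N a L) (hC : C ≠ 0) : HasL F L :=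
  ⟨C, N, a, hC, h⟩

lemma HasL.congr' {F G : ℂ → ℂ} {L : ℂ} (h : HasL F L) (hFG : ∀ᶠ z in atInf, F z = G z) : HasL G L := by
  obtain ⟨C, N, a, hC, h⟩ := h
  exact ⟨C, N, a, hC, h.congr' hFG⟩

lemma HasL.mul {F G : ℂ → ℂ} {L M : ℂ} (h : HasL F L) (h' : HasL G M) :
    HasL (fun z => F z * G z) (L + M) := by
  obtain ⟨C, N, a, hC, h⟩ := h
  obtain ⟨D, K, b, hD, h'⟩ := h'
  exact ⟨_, _, _, mul_ne_zero hC hD, h.mul h'⟩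

lemma HasL.prod {ι : Type*} (s : Finset ι) {F : ι → ℂ → ℂ} {L : ι → ℂ}
    (h : ∀ i ∈ s, HasL (F i) (L i)) : HasL (fun z => ∏ i ∈ s, F i z) (∑ i ∈ s, L i) := by
  classical
  induction s using Finset.induction_on with
  | empty => simpa using (jet_const 1).hasL one_ne_zero
  | insert i s hi ih =>
    have := (h i (Finset.mem_insert_self i s)).mul
      (ih fun j hj => h j (Finset.mem_insert_of_mem hj))
    simpa only [Finset.prod_insert hi, Finset.sum_insert hi] using this

lemma HasL.congr_right {F : ℂ → ℂ} {L M : ℂ} (h : HasL F L) (hLM : L = M) : HasL F M := hLM ▸ h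

lemma hasL_pow_sub_pow {A D : ℕ} (h : A ≠ D) :
    HasL (fun z => ((qc z)⁻¹) ^ D - ((qc z)⁻¹) ^ A) (-dif A D) := by
  rcases lt_or_gt_of_ne h with h | h
  · obtain ⟨k, rfl⟩ := Nat.exists_eq_add_of_lt h
    obtain ⟨a, ha⟩ := jet_one_sub_pow (Nat.succ_pos k)
    refine ((((jet_qc_inv_pow (A + k + 1)).mul ha).hasL (by norm_num)).congr'
      (Eventually.of_forall fun z => ?_)).congr_right ?_
    · have := qc_ne_zero z
      rw [add_assoc, pow_add, inv_pow _ (k + 1)]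
      field_simp
    · have h1 : (A = A + k + 1 + 1 ∨ A + k + 1 = A + 1) ↔ k.succ = 1 := by omega
      have h2 : (A = A + k + 1 + 2 ∨ A + k + 1 = A + 2) ↔ k.succ = 2 := by omega
      simp only [dif, h1, h2]
      ring
  · obtain ⟨k, rfl⟩ := Nat.exists_eq_add_of_lt h
    obtain ⟨a, ha⟩ := jet_one_sub_pow (Nat.succ_pos k)
    refine (((((jet_qc_inv_pow (D + k + 1)).mul ha).mul (jet_const (-1))).hasL (by norm_num)).congr'
      (Eventually.of_forall fun z => ?_)).congr_right ?_
    · have := qc_ne_zero z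
      rw [add_assoc, pow_add, inv_pow _ (k + 1)]
      field_simp
      ring
    · have h1 : (D + k + 1 = D + 1 ∨ D = D + k + 1 + 1) ↔ k.succ = 1 := by omega
      have h2 : (D + k + 1 = D + 2 ∨ D = D + k + 1 + 2) ↔ k.succ = 2 := by omega
      simp only [dif, h1, h2]
      ring

lemma hasL_block_one {A D : ℕ} (hA : 0 < A) (hD : 0 < D) (h : A ≠ D) :
    HasL (fun z => ∏ B ∈ Finset.range D, (J z - J (aff A D B z)))
      (-dif A D - (if A = 1 then D * cJ D else 0)) := by
  refine (((hasL_pow_sub_pow h).mul ((jet_prod_one_sub (Finset.range D)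
    (fun B _ => corr_isLittleO (tendsto_qc_aff hA hD B)) (sum_corr_isLittleO hA hD)).hasL one_ne_zero)).congr'
    (Eventually.of_forall fun z => ?_)).congr_right (by ring)
  rw [← prod_inv_sub_inv hD, ← Finset.prod_mul_distrib]
  exact Finset.prod_congr rfl fun B _ => (J_sub_J _ _).symm

lemma aff_self {D : ℕ} (hD : 0 < D) (z : ℂ) : aff D D 0 z = z := by
  have : (D : ℂ) ≠ 0 := by exact_mod_cast hD.ne'
  rw [aff]; field_simp; simp

lemma hasL_block_diag {D : ℕ} (hD : 0 < D) :
    HasL (fun z => ∏ B ∈ (Finset.range D).erase 0, (J z - J (aff D D B z)))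
      (6 - (if D = 1 then D * cJ D else 0)) := by
  have h0 : 0 ∈ Finset.range D := Finset.mem_range.2 hD
  have h1 : (fun z => ∑ B ∈ (Finset.range D).erase 0, corr (qc z) (qc (aff D D B z))
      - ((if D = 1 then D * cJ D else 0) - 6) * qc z ^ 2) =o[atInf] fun z => qc z ^ 2 := by
    have h2 := corr_sub_isLittleO tendsto_qc'
    have h3 := (isBigO_refl qc atInf).mul_isLittleO isLittleO_fJ
    refine (((sum_corr_isLittleO hD hD).sub h2).sub (h3.congr_right fun z => (sq _).symm)).congr_left fun z => ?_
    rw [← Finset.add_sum_erase _ _ h0, aff_self hD]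
    ring
  have hz := isPrimitiveRoot_rootU hD
  refine ((((jet_qc_inv_pow (D - 1)).mul (jet_const (∏ B ∈ (Finset.range D).erase 0,
    (1 - (rootU D ^ B)⁻¹)))).hasL ?_).mul ((jet_prod_one_sub ((Finset.range D).erase 0)
    (fun B _ => corr_isLittleO (tendsto_qc_aff hD hD B)) h1).hasL one_ne_zero)).congr'
    (Eventually.of_forall fun z => ?_) |>.congr_right (by ring)
  · rw [one_mul]
    refine Finset.prod_ne_zero_iff.2 fun B hB => sub_ne_zero.2 fun h => ?_
    rw [Finset.mem_erase, Finset.mem_range] at hB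
    exact hz.pow_ne_one_of_pos_of_lt hB.1 hB.2 (inv_eq_one.1 h.symm)
  · have : (qc z)⁻¹ ^ (D - 1) = ∏ B ∈ (Finset.range D).erase 0, (qc z)⁻¹ := by
      rw [Finset.prod_const, Finset.card_erase_of_mem h0, Finset.card_range]
    rw [this, ← Finset.prod_mul_distrib, ← Finset.prod_mul_distrib]
    refine Finset.prod_congr rfl fun B _ => ?_
    rw [J_sub_J, qc_aff D B, aff_self hD, mul_inv]
    ring

/-- The function of `q` representing `(J - t)⁻¹`. -/
noncomputable def invJ (t q : ℂ) : ℂ := q / (1 + q * fJ q - t * q)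

lemma inv_J_sub (t z : ℂ) : (J z - t)⁻¹ = invJ t (qc z) := by
  have := qc_ne_zero z
  rw [J_eq, invJ, inv_eq_one_div, ← mul_div_mul_left _ _ this]
  congr 1
  · ring
  · field_simp

lemma invJ_zero (t : ℂ) : invJ t 0 = 0 := by simp [invJ]

lemma analyticAt_invJ (t : ℂ) : AnalyticAt ℂ (invJ t) 0 := by
  refine analyticAt_id.div ((analyticAt_const.add (analyticAt_id.mul analyticAt_fJ)).sub
    (analyticAt_const.mul analyticAt_id)) ?_
  simp

lemma tendsto_invJ (t : ℂ) {w : ℂ → ℂ} (hw : Tendsto w atInf (𝓝 0)) :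
    Tendsto (fun z => invJ t (w z)) atInf (𝓝 0) := by
  have := (analyticAt_invJ t).continuousAt.tendsto
  rw [invJ_zero] at this
  exact this.comp hw

lemma invJ_isBigO (t : ℂ) : (fun z => invJ t (qc z)) =O[atInf] qc := by
  have h := ((tendsto_inv_J_sub t).isBigO_one ℂ).mul (isBigO_refl qc atInf)
  simp only [one_mul] at h
  refine h.congr_left fun z => ?_
  have := qc_ne_zero z
  rw [← inv_J_sub]
  field_simp

lemma hasL_block {e : ℕ} (he : e ∈ E6') {A D : ℕ} (hA : 0 < A) (hD : 0 < D) :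
    HasL (fun z => ∏ B ∈ Finset.range (e * D), (J z - J (mob (W e) (aff (e * A) (e * D) B z))))
      ((e * D : ℕ) * (6 - tE e ^ 2 / 2)) := by
  have he2 : 2 ≤ e := forall_E6' (p := fun e => 2 ≤ e) (by norm_num) (by norm_num) (by norm_num) e he
  have ha : 0 < e * A := by positivity
  have hm : 0 < e * D := by positivity
  have hb : ∀ B, (fun z => kE e * (invJ (tE e) (qc z) * invJ (tE e) (qc (aff (e * A) (e * D) B z))))
      =o[atInf] qc := by
    intro B
    have h := (invJ_isBigO (tE e)).mul_isLittleO ((isLittleO_one_iff ℂ).2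
      (tendsto_invJ (tE e) (tendsto_qc_aff ha hm B)))
    simp only [mul_one] at h
    exact h.const_mul_left _
  have hs : (fun z => ∑ B ∈ Finset.range (e * D),
      kE e * (invJ (tE e) (qc z) * invJ (tE e) (qc (aff (e * A) (e * D) B z))) - 0 * qc z ^ 2)
      =o[atInf] fun z => qc z ^ 2 := by
    have h1 := sum_aff_isLittleO (analyticAt_invJ (tE e)) (invJ_zero _) ha hm
    have h2 : (fun z => qc z ^ (e * A)) =o[atInf] qc := by
      have : (fun z => qc z ^ (e * A)) =o[atInf] fun z => qc z ^ 1 :=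
        (isLittleO_pow_pow (by nlinarith)).comp_tendsto tendsto_qc'
      simpa using this
    have h3 := ((h1.isBigO.trans_isLittleO h2).add (h2.const_mul_left ((e * D : ℕ) *
      (iteratedDeriv (e * D) (invJ (tE e)) 0 / (e * D).factorial))))
    refine (((invJ_isBigO (tE e)).mul_isLittleO h3).const_mul_left (kE e)).congr (fun z => ?_) fun z => (sq _).symm
    rw [← Finset.mul_sum, ← Finset.mul_sum]
    ring
  refine ((((jet_J_sub (tE e)).pow (e * D)).hasL (by simp)).mul ((jet_prod_one_sub (Finset.range (e * D))
    (fun B _ => hb B) hs).hasL one_ne_zero)).congr' ?_ |>.congr_right (by ring)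
  filter_upwards [eventually_pos] with z hz
  have h1 : (J z - tE e) ^ (e * D) = ∏ B ∈ Finset.range (e * D), (J z - tE e) := by
    rw [Finset.prod_const, Finset.card_range]
  rw [h1, ← Finset.prod_mul_distrib]
  refine Finset.prod_congr rfl fun B _ => ?_
  have h2 := J_sub_ne_zero he hz
  have h3 := J_sub_ne_zero he (aff_im_pos ha hm B hz)
  rw [J_W he (aff_im_pos ha hm B hz), ← inv_J_sub, ← inv_J_sub]
  field_simp
  ring

/-- The `B`-indices of the nonscalar representatives `(A, B; 0, D)`. -/
def rng (p : ℕ × ℕ) : Finset ℕ := if p.1 = p.2 then (Finset.range p.2).erase 0 else Finset.range p.2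

lemma E6_eq : E6 = insert 1 E6' := rfl

lemma one_notMem_E6' : 1 ∉ E6' := by decide

@[to_additive]
lemma prod_Idx' {M : Type*} [CommMonoid M] (n : ℕ) (f : Ix → M) :
    ∏ i ∈ Idx' n, f i = (∏ p ∈ dv n 1, ∏ B ∈ rng p, f ⟨1, p, B⟩) *
      ∏ e ∈ E6', ∏ p ∈ dv n e, ∏ B ∈ Finset.range (e * p.2), f ⟨e, p, B⟩ := by
  rw [Idx', Finset.prod_filter, Idx, Finset.prod_sigma, E6_eq, Finset.prod_insert one_notMem_E6']
  congr 1
  · rw [Finset.prod_sigma]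
    refine Finset.prod_congr rfl fun p _ => ?_
    rw [← Finset.prod_filter, one_mul, rng]
    refine Finset.prod_congr ?_ fun _ _ => rfl
    ext B
    simp only [Finset.mem_filter, Ix.Scalar]
    split_ifs with h
    · rw [Finset.mem_erase]; tauto
    · tauto
  · refine Finset.prod_congr rfl fun e he => ?_
    rw [Finset.prod_sigma]
    refine Finset.prod_congr rfl fun p _ => Finset.prod_congr rfl fun B _ => ?_
    rw [if_pos]
    rintro ⟨h, -⟩
    exact one_notMem_E6' (h ▸ he)

lemma pos_of_mem_dv {n e : ℕ} (hn : 0 < n) {p : ℕ × ℕ} (hp : p ∈ dv n e) : 0 < p.1 ∧ 0 < p.2 := by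
  rw [mem_dv hn] at hp
  subst hp
  have := Nat.pos_of_mul_pos_left hn
  exact ⟨Nat.pos_of_mul_pos_right this, Nat.pos_of_mul_pos_left this⟩

lemma mob_mat_one {p : ℕ × ℕ} {B : ℕ} (h1 : 0 < p.1) (h2 : 0 < p.2) {z : ℂ} (hz : 0 < z.im) :
    mob (Ix.mat ⟨1, p, B⟩) z = aff p.1 p.2 B z := by
  rw [Ix.mat, mob_repM (e := 1) (by decide) h1 h2 hz, W_one, mob_one, one_mul, one_mul, aff]

lemma mob_mat {e : ℕ} (he : e ∈ E6) {p : ℕ × ℕ} {B : ℕ} (h1 : 0 < p.1) (h2 : 0 < p.2) {z : ℂ} (hz : 0 < z.im) :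
    mob (Ix.mat ⟨e, p, B⟩) z = mob (W e) (aff (e * p.1) (e * p.2) B z) := by
  rw [Ix.mat, mob_repM he h1 h2 hz, aff]

/-- The second order coefficient of `diagF n` at infinity. -/
noncomputable def diagL (n : ℕ) : ℂ :=
  ∑ p ∈ dv n 1, ((if p.1 = p.2 then 6 else 0) - dif p.1 p.2 - (if p.1 = 1 then p.2 * cJ p.2 else 0)) +
    ∑ e ∈ E6', ∑ p ∈ dv n e, (e * p.2 : ℕ) * (6 - tE e ^ 2 / 2)

lemma hasL_diagF {n : ℕ} (hn : 0 < n) : HasL (diagF n) (diagL n) := by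
  have h1 : ∀ p ∈ dv n 1, HasL (fun z => ∏ B ∈ rng p, (J z - J (mob (Ix.mat ⟨1, p, B⟩) z)))
      ((if p.1 = p.2 then 6 else 0) - dif p.1 p.2 - (if p.1 = 1 then p.2 * cJ p.2 else 0)) := by
    intro p hp
    obtain ⟨hA, hD⟩ := pos_of_mem_dv hn hp
    have hc : ∀ᶠ z in atInf, ∏ B ∈ rng p, (J z - J (aff p.1 p.2 B z)) =
        ∏ B ∈ rng p, (J z - J (mob (Ix.mat ⟨1, p, B⟩) z)) :=
      eventually_pos.mono fun z hz => Finset.prod_congr rfl fun B _ => by rw [mob_mat_one hA hD hz]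
    refine HasL.congr' ?_ hc
    obtain ⟨A, D⟩ := p
    dsimp only [rng] at *
    split_ifs with h h' h'
    · subst h; subst h'
      refine (hasL_block_diag hD).congr_right ?_
      simp [dif]
    · subst h
      refine (hasL_block_diag hD).congr_right ?_
      simp [dif, h']
    · subst h'
      refine (hasL_block_one hA hD h).congr_right ?_
      simp
    · refine (hasL_block_one hA hD h).congr_right ?_
      simp [h']
  have h2 : ∀ e ∈ E6', ∀ p ∈ dv n e, HasL (fun z => ∏ B ∈ Finset.range (e * p.2),
      (J z - J (mob (Ix.mat ⟨e, p, B⟩) z))) ((e * p.2 : ℕ) * (6 - tE e ^ 2 / 2)) := by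
    intro e he p hp
    obtain ⟨hA, hD⟩ := pos_of_mem_dv hn hp
    refine (hasL_block he hA hD).congr' (eventually_pos.mono fun z hz => Finset.prod_congr rfl fun B _ => ?_)
    rw [mob_mat (E6'_subset he) hA hD hz]
  refine ((HasL.prod _ h1).mul (HasL.prod _ fun e he => HasL.prod _ (h2 e he))).congr'
    (Eventually.of_forall fun z => ?_)
  rw [diagF, prod_Idx']

/-- `F` is asymptotic to a nonzero multiple of `q ^ (-N)` at infinity. -/
def Ord (F : ℂ → ℂ) (N : ℤ) : Prop := ∃ C, C ≠ 0 ∧ Tendsto (fun z => F z * qc z ^ N) atInf (𝓝 C)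

lemma Ord.congr' {F G : ℂ → ℂ} {N : ℤ} (h : Ord F N) (hFG : ∀ᶠ z in atInf, F z = G z) : Ord G N := by
  obtain ⟨C, hC, h⟩ := h
  exact ⟨C, hC, h.congr' (hFG.mono fun z hz => by rw [hz])⟩

lemma Ord.congr_right {F : ℂ → ℂ} {M N : ℤ} (h : Ord F N) (hMN : N = M) : Ord F M := hMN ▸ h

lemma Ord.mul {F G : ℂ → ℂ} {M N : ℤ} (h : Ord F M) (h' : Ord G N) : Ord (fun z => F z * G z) (M + N) := by
  obtain ⟨C, hC, h⟩ := h
  obtain ⟨D, hD, h'⟩ := h'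
  refine ⟨C * D, mul_ne_zero hC hD, (h.mul h').congr fun z => ?_⟩
  rw [zpow_add₀ (qc_ne_zero z)]
  ring

lemma Ord.inv {F : ℂ → ℂ} {N : ℤ} (h : Ord F N) : Ord (fun z => (F z)⁻¹) (-N) := by
  obtain ⟨C, hC, h⟩ := h
  refine ⟨C⁻¹, inv_ne_zero hC, (h.inv₀ hC).congr fun z => ?_⟩
  rw [_root_.zpow_neg, mul_inv]

lemma ord_of_tendsto {F : ℂ → ℂ} {C : ℂ} (hC : C ≠ 0) (h : Tendsto F atInf (𝓝 C)) : Ord F 0 :=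
  ⟨C, hC, by simpa using h⟩

lemma ord_const {C : ℂ} (hC : C ≠ 0) : Ord (fun _ => C) 0 := ord_of_tendsto hC tendsto_const_nhds

lemma Ord.pow {F : ℂ → ℂ} {N : ℤ} (h : Ord F N) (k : ℕ) : Ord (fun z => F z ^ k) (k * N) := by
  induction k with
  | zero => simpa using ord_const one_ne_zero
  | succ k ih =>
    have := ih.mul h
    simp only [← pow_succ] at this
    exact this.congr_right (by push_cast; ring)

lemma Ord.zpow {F : ℂ → ℂ} {N : ℤ} (h : Ord F N) (k : ℤ) : Ord (fun z => F z ^ k) (k * N) := by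
  rcases Int.eq_nat_or_neg k with ⟨n, rfl | rfl⟩
  · simpa using h.pow n
  · simpa using (h.pow n).inv

lemma Ord.prod {ι : Type*} (s : Finset ι) {F : ι → ℂ → ℂ} {N : ι → ℤ}
    (h : ∀ i ∈ s, Ord (F i) (N i)) : Ord (fun z => ∏ i ∈ s, F i z) (∑ i ∈ s, N i) := by
  classical
  induction s using Finset.induction_on with
  | empty => simpa using ord_const one_ne_zero
  | insert i s hi ih =>
    have := (h i (Finset.mem_insert_self i s)).mul
      (ih fun j hj => h j (Finset.mem_insert_of_mem hj))
    simpa only [Finset.prod_insert hi, Finset.sum_insert hi] using this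

lemma Ord.prod_const {ι : Type*} (s : Finset ι) {F : ι → ℂ → ℂ}
    (h : ∀ i ∈ s, Ord (F i) 0) : Ord (fun z => ∏ i ∈ s, F i z) 0 :=
  (Ord.prod s h).congr_right (by simp)

lemma Jet.ord {F : ℂ → ℂ} {C a L : ℂ} {N : ℤ} (h : Jet F C N a L) (hC : C ≠ 0) : Ord F N := by
  refine ⟨C, hC, ?_⟩
  have h1 : Tendsto (fun z => exp (a * qc z + L * qc z ^ 2)) atInf (𝓝 (exp 0)) := by
    refine (Complex.continuous_exp.tendsto 0).comp ?_
    simpa using (tendsto_qc'.const_mul a).add ((tendsto_qc_pow two_ne_zero).const_mul L)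
  have h2 := (Near.tendsto h).mul h1
  rw [Complex.exp_zero, mul_one] at h2
  refine h2.congr fun z => ?_
  rw [mul_assoc, ← Complex.exp_add]
  simp

lemma ord_J_sub (t : ℂ) : Ord (fun z => J z - t) 1 := (jet_J_sub t).ord one_ne_zero

lemma ord_qc_zpow (k : ℤ) : Ord (fun z => qc z ^ k) (-k) := by
  refine ⟨1, one_ne_zero, tendsto_const_nhds.congr fun z => ?_⟩
  rw [_root_.zpow_neg, mul_inv_cancel₀ (zpow_ne_zero _ (qc_ne_zero z))]

lemma rootU_ne_zero (m : ℕ) : rootU m ≠ 0 := Complex.exp_ne_zero _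

lemma ord_J_aff_mul (t : ℂ) {a m : ℕ} (ha : 0 < a) (hm : 0 < m) (B : ℕ) :
    Ord (fun z => (J (aff a m B z) - t) * qc (aff a m 0 z)) 0 := by
  have h := ((tendsto_J_sub_mul t).comp (tendsto_aff ha hm B)).const_mul ((rootU m ^ B)⁻¹)
  refine ord_of_tendsto (mul_ne_zero (inv_ne_zero (pow_ne_zero _ (rootU_ne_zero m))) one_ne_zero)
    (h.congr fun z => ?_)
  have := pow_ne_zero B (rootU_ne_zero m)
  rw [Function.comp, qc_aff a B]
  field_simp

lemma ord_prod_J_aff (t : ℂ) {a m : ℕ} (ha : 0 < a) (hm : 0 < m) :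
    Ord (fun z => ∏ B ∈ Finset.range m, (J (aff a m B z) - t)) a := by
  refine ((Ord.prod_const (Finset.range m) fun B _ => ord_J_aff_mul t ha hm B).mul
    (ord_qc_zpow (-(a : ℤ)))).congr' (Eventually.of_forall fun z => ?_) |>.congr_right (by ring)
  rw [Finset.prod_mul_distrib, Finset.prod_const, Finset.card_range, qc_aff_pow hm, mul_assoc,
    ← zpow_natCast, ← zpow_add₀ (qc_ne_zero z)]
  simp

lemma ord_prod_rng (t : ℂ) {p : ℕ × ℕ} (h1 : 0 < p.1) (h2 : 0 < p.2) :
    Ord (fun z => ∏ B ∈ rng p, (J (aff p.1 p.2 B z) - t)) (p.1 - if p.1 = p.2 then 1 else 0) := by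
  rw [rng]
  split_ifs with h
  · refine ((ord_prod_J_aff t h1 h2).mul (ord_J_sub t).inv).congr' ?_ |>.congr_right (by ring)
    have h3 : ∀ᶠ z in atInf, J z - t ≠ 0 := by
      have := (tendsto_J_sub_mul t).eventually_ne one_ne_zero
      exact this.mono fun z hz h => hz (by rw [h, zero_mul])
    filter_upwards [h3] with z hz
    rw [← Finset.mul_prod_erase _ _ (Finset.mem_range.2 h2), h, aff_self h2]
    field_simp
  · simpa using ord_prod_J_aff t h1 h2

lemma tE_injOn {e e' : ℕ} (he : e ∈ E6') (he' : e' ∈ E6') (h : e' ≠ e) : tE e' - tE e ≠ 0 := by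
  revert h
  refine forall_E6' (p := fun e => e' ≠ e → tE e' - tE e ≠ 0) ?_ ?_ ?_ e he <;>
  refine forall_E6' (p := fun e' => e' ≠ _ → tE e' - tE _ ≠ 0) ?_ ?_ ?_ e' he' <;>
  simp only [tE_two, tE_three, tE_six] <;> norm_num

/-- The number of scalar matrices among the coset representatives. -/
def sqN (n : ℕ) : ℤ := ∑ p ∈ dv n 1, if p.1 = p.2 then 1 else 0

/-- The sum of `e A` over `e A D = n`. -/
def sgN (n e : ℕ) : ℤ := ∑ p ∈ dv n e, (e * p.1 : ℤ)

lemma ord_cusp {n : ℕ} (hn : 0 < n) {e : ℕ} (he : e ∈ E6') :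
    Ord (fun z => ∏ i ∈ Idx' n, (J (mob i.mat z) - tE e)) (sgN n 1 - sqN n - sgN n e) := by
  have h1 : ∀ p ∈ dv n 1, Ord (fun z => ∏ B ∈ rng p, (J (mob (Ix.mat ⟨1, p, B⟩) z) - tE e))
      (p.1 - if p.1 = p.2 then 1 else 0) := by
    intro p hp
    obtain ⟨hA, hD⟩ := pos_of_mem_dv hn hp
    exact (ord_prod_rng (tE e) hA hD).congr' <| eventually_pos.mono fun z hz =>
      Finset.prod_congr rfl fun B _ => by rw [mob_mat_one hA hD hz]
  have h2 : ∀ e' ∈ E6', ∀ p ∈ dv n e', Ord (fun z => ∏ B ∈ Finset.range (e' * p.2),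
      (J (mob (Ix.mat ⟨e', p, B⟩) z) - tE e)) (if e' = e then -(e * p.1 : ℤ) else 0) := by
    intro e' he' p hp
    obtain ⟨hA, hD⟩ := pos_of_mem_dv hn hp
    have he0 : 0 < e' := E6_pos (E6'_subset he')
    have ha : 0 < e' * p.1 := by positivity
    have hm : 0 < e' * p.2 := by positivity
    have hc : ∀ᶠ z in atInf, ∏ B ∈ Finset.range (e' * p.2), (J (mob (W e') (aff (e' * p.1) (e' * p.2) B z)) - tE e)
        = ∏ B ∈ Finset.range (e' * p.2), (J (mob (Ix.mat ⟨e', p, B⟩) z) - tE e) :=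
      eventually_pos.mono fun z hz => Finset.prod_congr rfl fun B _ => by
        rw [mob_mat (E6'_subset he') hA hD hz]
    refine Ord.congr' ?_ hc
    split_ifs with h
    · subst h
      refine ((ord_const (pow_ne_zero (e' * p.2) (kE_ne_zero e'))).mul
        (ord_prod_J_aff (tE e') ha hm).inv).congr' (eventually_pos.mono fun z hz => ?_) |>.congr_right
          (by push_cast; ring)
      have : kE e' ^ (e' * p.2) = ∏ B ∈ Finset.range (e' * p.2), kE e' := by
        rw [Finset.prod_const, Finset.card_range]
      rw [this, ← Finset.prod_inv_distrib, ← Finset.prod_mul_distrib]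
      refine Finset.prod_congr rfl fun B _ => ?_
      rw [J_W he' (aff_im_pos ha hm B hz)]
      ring
    · refine Ord.prod_const _ fun B _ => ord_of_tendsto (tE_injOn he he' h) ?_
      exact ((tendsto_J_W he').comp (tendsto_aff ha hm B)).sub_const _
  refine ((Ord.prod _ h1).mul (Ord.prod _ fun e he => Ord.prod _ (h2 e he))).congr'
    (Eventually.of_forall fun z => ?_) |>.congr_right ?_
  · rw [prod_Idx']
  · rw [Finset.sum_sub_distrib, Finset.sum_eq_single e]
    · simp [sgN, sqN, sub_eq_add_neg]
    · intro e' _ h; simp [h]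
    · intro h; exact absurd he h

lemma dv_sum_swap (n e : ℕ) (f : ℕ → ℕ → ℤ) : ∑ p ∈ dv n e, f p.1 p.2 = ∑ p ∈ dv n e, f p.2 p.1 := by
  unfold dv
  split_ifs
  · conv_lhs => rw [← Nat.map_swap_divisorsAntidiagonal, Finset.sum_map]
    rfl
  · simp

lemma card_rng {p : ℕ × ℕ} (h : 0 < p.2) : ((rng p).card : ℤ) = p.2 - if p.1 = p.2 then 1 else 0 := by
  rw [rng]
  split_ifs
  · rw [Finset.card_erase_of_mem (Finset.mem_range.2 h), Finset.card_range]; omega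
  · simp

lemma card_Idx' {n : ℕ} (hn : 0 < n) : ((Idx' n).card : ℤ) = sgN n 1 - sqN n + ∑ e ∈ E6', sgN n e := by
  have h := sum_Idx' n fun _ => (1 : ℤ)
  simp only [Finset.sum_const, Finset.card_range, nsmul_eq_mul, mul_one] at h
  rw [h, Finset.sum_congr rfl fun p hp => card_rng (pos_of_mem_dv hn hp).2, Finset.sum_sub_distrib]
  congr 1
  · rw [sgN, sqN, dv_sum_swap n 1 fun a b => ((1 : ℕ) * a : ℤ)]
    simp
  · refine Finset.sum_congr rfl fun e _ => ?_
    rw [sgN, dv_sum_swap n e fun a b => (e * a : ℤ)]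
    push_cast
    rfl

lemma exists_polynomial (N : ℕ) : ∀ {f : ℂ → ℂ}, DifferentiableOn ℂ f UH → Inv f →
    (∀ e ∈ E6', ∃ c, Tendsto (fun z => f (mob (W e) z)) atInf (𝓝 c)) →
    (∃ c, Tendsto (fun z => f z * qc z ^ N) atInf (𝓝 c)) →
    ∃ P : Polynomial ℂ, ∀ z : ℂ, 0 < z.im → f z = P.eval (J z) := by
  induction N with
  | zero =>
    rintro f hf hinv hc ⟨c, h⟩
    obtain ⟨a, ha⟩ := eq_const_of_bdd hf hinv fun e he => by
      rcases E6_cases he with rfl | he'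
      · simp only [W_one, mob_one]
        exact BddInf.of_tendsto (by simpa using h)
      · obtain ⟨c, hc⟩ := hc e he'
        exact BddInf.of_tendsto hc
    exact ⟨Polynomial.C a, fun z hz => by rw [ha z hz, Polynomial.eval_C]⟩
  | succ N ih =>
    rintro f hf hinv hc ⟨c, h⟩
    obtain ⟨g, hg, hgq⟩ := exists_cuspFunction (f := fun z => f z * qc z ^ (N + 1))
      (hf.mul (differentiable_qc.differentiableOn.pow _))
      (fun z hz => by rw [hinv.add_one hz, qc_add_one]) (BddInf.of_tendsto h)
    have hf' : DifferentiableOn ℂ (fun z => f z - c * J z ^ (N + 1)) UH :=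
      hf.sub ((differentiableOn_J.pow _).const_mul c)
    have hd : HasDerivAt (fun q => g q - c * (1 + q * fJ q) ^ (N + 1))
        (deriv (fun q => g q - c * (1 + q * fJ q) ^ (N + 1)) 0) 0 := by
      refine DifferentiableAt.hasDerivAt ?_
      exact (hg.differentiableAt ball_mem).sub ((((differentiableAt_id.mul
        (differentiableOn_fJ.differentiableAt ball_mem)).const_add 1).pow (N + 1)).const_mul c)
    have hg0 : g 0 = c := by
      refine tendsto_nhds_unique (((hg.differentiableAt ball_mem).continuousAt.tendsto).comp tendsto_qc')
        (h.congr' (eventually_pos.mono fun z hz => ?_))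
      exact hgq z hz
    obtain ⟨P, hP⟩ := ih hf' (fun γ hγ z hz => by rw [hinv γ hγ z hz, inv_J γ hγ z hz])
      (fun e he => by
        obtain ⟨a, ha⟩ := hc e he
        exact ⟨_, ha.sub (((tendsto_J_W he).pow (N + 1)).const_mul c)⟩)
      ⟨_, (hd.tendsto_slope.comp tendsto_qc).congr' (eventually_pos.mono fun z hz => by
        have h0 := qc_ne_zero z
        have h1 : J z * qc z = 1 + qc z * fJ (qc z) := by
          rw [J_eq]; field_simp
        simp only [Function.comp, slope_def_field]
        rw [← hgq z hz, ← h1, hg0]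
        field_simp
        ring)⟩
    refine ⟨P + Polynomial.C c * Polynomial.X ^ (N + 1), fun z hz => ?_⟩
    rw [Polynomial.eval_add, ← hP z hz]
    simp

lemma jet_multiset (s : Multiset ℂ) :
    ∃ a, Jet (fun z => (s.map fun t => J z - t).prod) 1 s.card a (s.map fun t => 6 - t ^ 2 / 2).sum := by
  induction s using Multiset.induction_on with
  | empty => exact ⟨0, by simpa using jet_const 1⟩
  | cons t s ih =>
    obtain ⟨a, h⟩ := ih
    refine ⟨-t + a, ?_⟩
    have := (jet_J_sub t).mul h
    simp only [Multiset.map_cons, Multiset.prod_cons, Multiset.sum_cons, Multiset.card_cons]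
    convert this using 1
    · simp
    · push_cast; ring

lemma sum_sq_sub (s : Multiset ℂ) : (s.map fun t : ℂ => t ^ 2 - 31 / 2).sum =
    -2 * (s.map fun t : ℂ => 6 - t ^ 2 / 2).sum - 7 / 2 * (s.card : ℂ) := by
  induction s using Multiset.induction_on with
  | empty => simp
  | cons t s ih =>
    simp only [Multiset.map_cons, Multiset.sum_cons, Multiset.card_cons, ih]
    push_cast
    ring

/-- The exponent of `J - tE e` making `diagF n` holomorphic at the cusps. -/
def kN (n : ℕ) (N : ℤ) (e : ℕ) : ℤ := N - (Idx' n).card - (sgN n 1 - sqN n - sgN n e)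

/-- The modified diagonal function, a polynomial in `J`. -/
noncomputable def diagH (n : ℕ) (N : ℤ) (z : ℂ) : ℂ := diagF n z * ∏ e ∈ E6', (J z - tE e) ^ kN n N e

lemma ord_diagF_W {n : ℕ} (hn : 0 < n) {N : ℤ} (hN : Ord (diagF n) N) {e : ℕ} (he : e ∈ E6') :
    Ord (fun z => diagF n (mob (W e) z)) (kN n N e) := by
  refine (((hN.mul (ord_const (pow_ne_zero (Idx' n).card (neg_ne_zero.2 (kE_ne_zero e))))).mul
    ((ord_J_sub (tE e)).pow (Idx' n).card).inv).mul (ord_cusp hn he).inv).congr'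
    (eventually_pos.mono fun z hz => ?_) |>.congr_right ?_
  · rw [diagF_W hn he hz, div_eq_mul_inv]
  · rw [kN]; ring

lemma ord_diagH_W {n : ℕ} (hn : 0 < n) {N : ℤ} (hN : Ord (diagF n) N) {e : ℕ} (he : e ∈ E6') :
    Ord (fun z => diagH n N (mob (W e) z)) 0 := by
  have h1 : ∀ e' ∈ E6', Ord (fun z => (J (mob (W e) z) - tE e') ^ kN n N e')
      (if e' = e then -kN n N e else 0) := by
    intro e' he'
    split_ifs with h
    · subst h
      have : Ord (fun z => J (mob (W e') z) - tE e') (-1) := by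
        refine ((ord_const (kE_ne_zero e')).mul (ord_J_sub (tE e')).inv).congr'
          (eventually_pos.mono fun z hz => ?_) |>.congr_right (by ring)
        rw [J_W he' hz]
        ring
      exact (this.zpow _).congr_right (by ring)
    · have := ord_of_tendsto (tE_injOn he' he (Ne.symm h)) ((tendsto_J_W he).sub_const (tE e'))
      exact (this.zpow _).congr_right (by ring)
  refine ((ord_diagF_W hn hN he).mul (Ord.prod _ h1)).congr_right ?_
  rw [Finset.sum_ite_eq' E6' e, if_pos he]
  ring

lemma exists_diag_polynomial {n : ℕ} (hn : 0 < n) :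
    ∃ (P : Polynomial ℂ) (N : ℤ), (∀ z : ℂ, 0 < z.im → diagH n N z = P.eval (J z)) ∧
      (∀ e ∈ E6', P.eval (tE e) ≠ 0) ∧
      (P.roots.map fun t : ℂ => t ^ 2 - 31 / 2).sum =
        -2 * diagL n - 7 * sgN n 1 + 7 * sqN n - 10 * sgN n 2 - 3 * sgN n 3 + 6 * sgN n 6 := by
  obtain ⟨C, N, a, hC, hjet⟩ := hasL_diagF hn
  have hN := hjet.ord hC
  have hjH := hjet.mul (Jet.prod E6' fun e _ => (jet_J_sub (tE e)).zpow one_ne_zero (kN n N e))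
  have hCH : C * ∏ e ∈ E6', (1 : ℂ) ^ kN n N e ≠ 0 := by simpa using hC
  have hH := hjH.ord hCH
  have hd : DifferentiableOn ℂ (diagH n N) UH := by
    refine (differentiableOn_diagF hn).mul (DifferentiableOn.fun_finsetProd fun e he => ?_)
    exact (differentiableOn_J.sub_const _).zpow (Or.inl fun z hz => J_sub_ne_zero he hz)
  have hinv : Inv (diagH n N) := fun γ hγ z hz => by
    rw [diagH, diagH, inv_diagF hn γ hγ z hz, inv_J γ hγ z hz]
  obtain ⟨P, hP⟩ := exists_polynomial (N + ∑ e ∈ E6', kN n N e * 1).toNat hd hinv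
    (fun e he => by
      obtain ⟨c, -, h⟩ := ord_diagH_W hn hN he
      exact ⟨c, by simpa using h⟩)
    (by
      obtain ⟨c, -, h⟩ := hH
      set K : ℤ := N + ∑ e ∈ E6', kN n N e * 1
      have h1 : ∃ c', Tendsto (fun z => qc z ^ (-K).toNat) atInf (𝓝 c') :=
        ⟨_, tendsto_qc'.pow (-K).toNat⟩
      obtain ⟨c', h1⟩ := h1
      refine ⟨_, (h.mul h1).congr fun z => ?_⟩
      rw [← zpow_natCast, ← zpow_natCast, mul_assoc, ← zpow_add₀ (qc_ne_zero z), diagH]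
      congr 2
      omega)
  have hroot : ∀ e ∈ E6', P.eval (tE e) ≠ 0 := fun e he => by
    obtain ⟨c, hc, h⟩ := ord_diagH_W hn hN he
    have h2 := (P.continuous.tendsto (tE e)).comp (tendsto_J_W he)
    have h3 : Tendsto (fun z => P.eval (J (mob (W e) z))) atInf (𝓝 c) :=
      h.congr' (eventually_pos.mono fun z hz => by
        dsimp only
        rw [zpow_zero, mul_one, hP _ (mob_im_pos (W_det_pos e) hz)])
    rw [tendsto_nhds_unique h2 h3]
    exact hc
  refine ⟨P, N, hP, hroot, ?_⟩
  have hP0 : P ≠ 0 := fun h => hroot 2 (by decide) (by simp [h])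
  obtain ⟨b, hb⟩ := jet_multiset P.roots
  have hjP : Jet (diagH n N) (P.leadingCoeff * 1) (0 + P.roots.card) (0 + b)
      (0 + (P.roots.map fun t => 6 - t ^ 2 / 2).sum) := by
    refine ((jet_const P.leadingCoeff).mul hb).congr' (eventually_pos.mono fun z hz => ?_)
    rw [hP z hz]
    conv_rhs => rw [(IsAlgClosed.splits P).eq_prod_roots]
    rw [Polynomial.eval_mul, Polynomial.eval_C, Polynomial.eval_multiset_prod, Multiset.map_map]
    congr 2
    refine Multiset.map_congr rfl fun t _ => ?_
    simp
  obtain ⟨h1, -, h2⟩ := hjP.unique hjH (by simpa using hP0) hCH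
  have h4 : (P.roots.card : ℂ) = (N + ∑ e ∈ E6', kN n N e * 1 : ℤ) := by
    rw [← h1]; push_cast; ring
  rw [zero_add] at h2
  rw [sum_sq_sub, h4, h2]
  have h5 : ((Idx' n).card : ℂ) = ((sgN n 1 - sqN n + ∑ e ∈ E6', sgN n e : ℤ) : ℂ) := by
    rw [← card_Idx' hn]; simp
  simp only [E6', kN] at h5 ⊢
  rw [Finset.sum_insert (by decide), Finset.sum_insert (by decide), Finset.sum_singleton] at h5 ⊢
  rw [Finset.sum_insert (by decide), Finset.sum_insert (by decide), Finset.sum_singleton]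
  push_cast at h5 ⊢
  rw [h5, tE_two, tE_three, tE_six]
  ring

/-- The order of vanishing of `f` at `z` is `m`. -/
def ZOrd (f : ℂ → ℂ) (z : ℂ) (m : ℕ) : Prop :=
  ∃ C : ℂ, C ≠ 0 ∧ Tendsto (fun w => f w / (w - z) ^ m) (𝓝[≠] z) (𝓝 C)

lemma ZOrd.mul {f g : ℂ → ℂ} {z : ℂ} {m k : ℕ} (hf : ZOrd f z m) (hg : ZOrd g z k) :
    ZOrd (fun w => f w * g w) z (m + k) := by
  obtain ⟨C, hC, h⟩ := hf
  obtain ⟨C', hC', h'⟩ := hg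
  refine ⟨C * C', mul_ne_zero hC hC', (h.mul h').congr fun w => ?_⟩
  rw [pow_add, div_mul_div_comm]

lemma zOrd_zero_of_continuousAt {f : ℂ → ℂ} {z : ℂ} (hf : ContinuousAt f z) (h : f z ≠ 0) : ZOrd f z 0 :=
  ⟨f z, h, (hf.tendsto.mono_left nhdsWithin_le_nhds).congr fun w => by simp⟩

lemma zOrd_one_of_hasDerivAt {f : ℂ → ℂ} {z f' : ℂ} (hf : HasDerivAt f f' z) (h0 : f z = 0) (h : f' ≠ 0) :
    ZOrd f z 1 := by
  refine ⟨f', h, hf.tendsto_slope.congr fun w => ?_⟩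
  rw [slope_def_field, h0, sub_zero, pow_one]

lemma ZOrd.prod {ι : Type*} (s : Finset ι) {f : ι → ℂ → ℂ} {z : ℂ} {m : ι → ℕ}
    (h : ∀ i ∈ s, ZOrd (f i) z (m i)) : ZOrd (fun w => ∏ i ∈ s, f i w) z (∑ i ∈ s, m i) := by
  classical
  induction s using Finset.induction_on with
  | empty => exact ⟨1, one_ne_zero, by simp⟩
  | insert a s ha ih =>
    simp only [Finset.prod_insert ha, Finset.sum_insert ha]
    exact (h a (Finset.mem_insert_self a s)).mul (ih fun i hi => h i (Finset.mem_insert_of_mem hi))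

lemma ZOrd.congr {f g : ℂ → ℂ} {z : ℂ} {m : ℕ} (hf : ZOrd f z m) (h : f =ᶠ[𝓝 z] g) : ZOrd g z m := by
  obtain ⟨C, hC, hf⟩ := hf
  refine ⟨C, hC, hf.congr' ?_⟩
  filter_upwards [h.filter_mono nhdsWithin_le_nhds] with w hw
  rw [hw]

lemma ZOrd.le {f : ℂ → ℂ} {z : ℂ} {m k : ℕ} (hf : ZOrd f z m) (hg : ZOrd f z k) : k ≤ m := by
  by_contra! hlt
  obtain ⟨C, hC, h⟩ := hf
  obtain ⟨C', -, h'⟩ := hg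
  have h0 : Tendsto (fun w : ℂ => (w - z) ^ (k - m)) (𝓝[≠] z) (𝓝 0) := by
    have : ContinuousAt (fun w : ℂ => (w - z) ^ (k - m)) z := by fun_prop
    have h1 := this.tendsto.mono_left (nhdsWithin_le_nhds (s := {z}ᶜ))
    rwa [sub_self, zero_pow (by omega)] at h1
  have h1 := h'.mul h0
  rw [mul_zero] at h1
  refine hC (tendsto_nhds_unique h (h1.congr' ?_))
  filter_upwards [self_mem_nhdsWithin] with w hw
  have hw' : w - z ≠ 0 := sub_ne_zero.mpr hw
  rw [div_mul_eq_mul_div, div_eq_div_iff (pow_ne_zero _ hw') (pow_ne_zero _ hw'), mul_assoc, ← pow_add,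
    Nat.sub_add_cancel hlt.le]

lemma ZOrd.unique {f : ℂ → ℂ} {z : ℂ} {m k : ℕ} (hf : ZOrd f z m) (hg : ZOrd f z k) : m = k :=
  le_antisymm (hg.le hf) (hf.le hg)

lemma zOrd_J_sub {z : ℂ} (hz : 0 < z.im) : ZOrd (fun w => J w - J z) z 1 :=
  zOrd_one_of_hasDerivAt ((hasStrictDerivAt_J hz).hasDerivAt.sub_const _) (sub_self _) (deriv_J_ne_zero hz)

lemma zOrd_polynomial {P : Polynomial ℂ} (hP : P ≠ 0) {z : ℂ} (hz : 0 < z.im) :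
    ZOrd (fun w => P.eval (J w)) z (P.rootMultiplicity (J z)) := by
  obtain ⟨Q, hQ, hd⟩ := Polynomial.exists_eq_pow_rootMultiplicity_mul_and_not_dvd P hP (J z)
  have hQ0 : Q.eval (J z) ≠ 0 := fun h => hd (Polynomial.dvd_iff_isRoot.mpr h)
  have hJc : ContinuousAt J z := (hasStrictDerivAt_J hz).hasDerivAt.continuousAt
  have h1 : ZOrd (fun w => Q.eval (J w)) z 0 :=
    zOrd_zero_of_continuousAt (Q.continuous.continuousAt.comp hJc) hQ0
  have h2 := (ZOrd.prod (Finset.range (P.rootMultiplicity (J z))) fun _ _ => zOrd_J_sub hz).mul h1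
  simp only [Finset.prod_const, Finset.sum_const, Finset.card_range, smul_eq_mul, mul_one, add_zero] at h2
  refine h2.congr (Eventually.of_forall fun w => ?_)
  dsimp only
  conv_rhs => rw [hQ]
  simp

lemma mob_eq_self_iff {M : Matrix (Fin 2) (Fin 2) ℤ} (hM : 0 < M.det) {z : ℂ} (hz : 0 < z.im) :
    mob M z = z ↔ (M 1 1 - M 0 0 : ℝ) = -2 * M 1 0 * z.re ∧ (M 0 1 : ℝ) = -(M 1 0 * normSq z) := by
  have hd := den_ne_zero hM hz
  rw [mob]
  change _ / den M z = z ↔ _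
  rw [div_eq_iff hd, den, Complex.ext_iff]
  simp only [add_re, mul_re, add_im, mul_im, intCast_re, intCast_im, normSq_apply, zero_mul, sub_zero,
    add_zero]
  constructor
  · rintro ⟨h1, h2⟩
    have h3 : (M 1 1 - M 0 0 : ℝ) = -2 * M 1 0 * z.re := by
      apply mul_left_cancel₀ hz.ne'
      linear_combination -h2
    exact ⟨h3, by linear_combination h1 + z.re * h3⟩
  · rintro ⟨h1, h2⟩
    exact ⟨by linear_combination h2 - z.re * h1, by linear_combination -z.im * h1⟩

lemma four_det_of_mob_eq_self {M : Matrix (Fin 2) (Fin 2) ℤ} (hM : 0 < M.det) {z : ℂ} (hz : 0 < z.im)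
    (h : mob M z = z) : (4 * M.det - (M 0 0 + M 1 1) ^ 2 : ℝ) = 4 * (M 1 0 * z.im) ^ 2 := by
  obtain ⟨h1, h2⟩ := (mob_eq_self_iff hM hz).1 h
  rw [det_fin_two]
  rw [normSq_apply] at h2
  push_cast
  linear_combination (-(M 1 1 - M 0 0 : ℝ) + 2 * M 1 0 * z.re) * h1 - 4 * M 1 0 * h2

lemma eq_smul_one_of_fix {M : Matrix (Fin 2) (Fin 2) ℤ} (hM : 0 < M.det) {z : ℂ} (hz : 0 < z.im)
    (h : mob M z = z) (hc : M 1 0 = 0) : M = (M 0 0) • 1 := by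
  obtain ⟨h1, h2⟩ := (mob_eq_self_iff hM hz).1 h
  rw [hc] at h1 h2
  have h3 : M 1 1 = M 0 0 := by
    have : (M 1 1 : ℝ) = M 0 0 := by linear_combination h1 + (by simp : (-2 * ((0:ℤ):ℝ) * z.re) = 0)
    exact_mod_cast this
  have h4 : M 0 1 = 0 := by
    have : (M 0 1 : ℝ) = 0 := by rw [h2]; simp
    exact_mod_cast this
  ext i j
  fin_cases i <;> fin_cases j <;> simp [hc, h3, h4]

lemma InG.eq_one_or_neg_one {γ : Matrix (Fin 2) (Fin 2) ℤ} (hγ : InG γ) {z : ℂ} (hz : 0 < z.im)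
    (h : mob γ z = z) : γ = 1 ∨ γ = -1 := by
  have h4 := four_det_of_mob_eq_self hγ.det_pos hz h
  have hdet := hγ.1
  by_cases hc : γ 1 0 = 0
  · have h5 := eq_smul_one_of_fix hγ.det_pos hz h hc
    rw [h5, det_smul, Fintype.card_fin, det_one, mul_one] at hdet
    rcases Int.isUnit_iff.mp (IsUnit.of_mul_eq_one _ ((sq _).symm.trans hdet)) with h6 | h6
    · left; rw [h5, h6, one_smul]
    · right; rw [h5, h6, neg_one_smul]
  · exfalso
    obtain ⟨k, hk⟩ := hγ.2
    have hlt : (γ 0 0 + γ 1 1) ^ 2 < 4 := by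
      have h5 : (0 : ℝ) < 4 * (γ 1 0 * z.im) ^ 2 := by
        have : (γ 1 0 * z.im : ℝ) ≠ 0 := mul_ne_zero (by exact_mod_cast hc) hz.ne'
        positivity
      rw [← h4, hdet, Int.cast_one] at h5
      have : ((γ 0 0 + γ 1 1 : ℤ) : ℝ) ^ 2 < 4 := by push_cast; linarith
      exact_mod_cast this
    have hT : γ 0 0 + γ 1 1 = -1 ∨ γ 0 0 + γ 1 1 = 0 ∨ γ 0 0 + γ 1 1 = 1 := by
      have h1 : γ 0 0 + γ 1 1 < 2 := by nlinarith
      have h2 : -2 < γ 0 0 + γ 1 1 := by nlinarith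
      omega
    rw [det_fin_two, hk] at hdet
    have hdet' := congrArg (Int.cast : ℤ → ZMod 6) hdet
    push_cast at hdet'
    rw [show (6 : ZMod 6) = 0 from rfl, zero_mul, mul_zero, sub_zero] at hdet'
    have key : ∀ a d : ZMod 6, a + d = -1 ∨ a + d = 0 ∨ a + d = 1 → a * d ≠ 1 := by decide
    refine key _ _ ?_ hdet'
    rcases hT with h | h | h <;> have h' := congrArg (Int.cast : ℤ → ZMod 6) h <;> push_cast at h' <;> tauto

lemma exists_fix_of_J_eq {n : ℕ} (hn : 0 < n) {i : Ix} (hi : i ∈ Idx' n) {z : ℂ} (hz : 0 < z.im)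
    (h : J z = J (mob i.mat z)) :
    ∃ γ, InG γ ∧ mob (γ * i.mat) z = z ∧ 0 < (γ * i.mat) 1 0 := by
  have hdet := Idx'_det_pos hn hi
  obtain ⟨γ, hγ, hfix⟩ := eqv_of_J_eq (mob_im_pos hdet hz) hz h.symm
  rw [← mob_mul _ _ hdet hz] at hfix
  have hpos : 0 < (γ * i.mat).det := by rw [det_mul, hγ.1, one_mul]; exact hdet
  have hne : (γ * i.mat) 1 0 ≠ 0 := by
    intro hc
    have h1 := eq_smul_one_of_fix hpos hz hfix.symm hc
    refine (mem_Idx'.1 hi).2 (scalar_of_mat_eq hn (mem_Idx'.1 hi).1 hγ.adj (a := (γ * i.mat) 0 0) ?_)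
    have h2 : γ.adjugate * (γ * i.mat) = γ.adjugate * ((γ * i.mat) 0 0 • 1) := congrArg (γ.adjugate * ·) h1
    rwa [← Matrix.mul_assoc, hγ.adj_mul, Matrix.one_mul, mul_smul_comm, Matrix.mul_one] at h2
  rcases lt_or_gt_of_ne hne with h0 | h0
  · refine ⟨-γ, hγ.neg, ?_, ?_⟩
    · rw [Matrix.neg_mul, mob_neg]; exact hfix.symm
    · rw [Matrix.neg_mul, Matrix.neg_apply]; omega
  · exact ⟨γ, hγ, hfix.symm, h0⟩

lemma zOrd_factor {n : ℕ} (hn : 0 < n) {i : Ix} (hi : i ∈ Idx' n) {z : ℂ} (hz : 0 < z.im) :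
    ZOrd (fun w => J w - J (mob i.mat w)) z (if J z = J (mob i.mat z) then 1 else 0) := by
  have hdet := Idx'_det_pos hn hi
  have hd : ∀ {M : Matrix (Fin 2) (Fin 2) ℤ}, 0 < M.det → HasDerivAt (fun w => J w - J (mob M w))
      (deriv J z - deriv J (mob M z) * (M.det / den M z ^ 2)) z := fun hM =>
    (hasStrictDerivAt_J hz).hasDerivAt.sub
      (((hasStrictDerivAt_J (mob_im_pos hM hz)).hasDerivAt).comp z (hasDerivAt_mob hM hz))
  split_ifs with h
  · obtain ⟨γ, hγ, hfix, hc⟩ := exists_fix_of_J_eq hn hi hz h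
    have hMd : (γ * i.mat).det = n := by rw [det_mul, hγ.1, one_mul, (inO_mat hn (mem_Idx'.1 hi).1).1]
    have hM : 0 < (γ * i.mat).det := by rw [hMd]; exact_mod_cast hn
    have h1 := hd hM
    refine (zOrd_one_of_hasDerivAt h1 (by rw [hfix, sub_self]) ?_).congr ?_
    · rw [hfix]
      have hden := den_ne_zero hM hz
      have hJ := deriv_J_ne_zero hz
      intro h0
      have h2 : den (γ * i.mat) z ^ 2 = (γ * i.mat).det := by
        have h0' : deriv J z * (den (γ * i.mat) z ^ 2 - (γ * i.mat).det) = 0 := by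
          field_simp at h0
          linear_combination h0
        exact sub_eq_zero.mp ((mul_eq_zero.mp h0').resolve_left hJ)
      have him := mob_im (M := γ * i.mat) z
      rw [hfix] at him
      have h3 : normSq (den (γ * i.mat) z) = (γ * i.mat).det := by
        have : normSq (den (γ * i.mat) z) ≠ 0 := by simpa using hden
        field_simp at him
        exact him
      have h4 : den (γ * i.mat) z = (starRingEnd ℂ) (den (γ * i.mat) z) := by
        apply mul_left_cancel₀ hden
        rw [mul_conj, h3, ← sq, h2]; simp
      have h5 := conj_eq_iff_im.mp h4.symm
      rw [den] at h5
      simp only [add_im, mul_im, intCast_re, intCast_im, zero_mul, add_zero] at h5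
      rcases mul_eq_zero.mp h5 with h6 | h6
      · exact hc.ne' (by exact_mod_cast h6)
      · exact hz.ne' h6
    · filter_upwards [UH_mem_nhds hz] with w hw
      rw [mob_mul _ _ hdet hw, inv_J γ hγ _ (mob_im_pos hdet hw)]
  · exact zOrd_zero_of_continuousAt (hd hdet).continuousAt (sub_ne_zero.mpr h)

lemma rootMultiplicity_diag {n : ℕ} (hn : 0 < n) {P : Polynomial ℂ} {N : ℤ} (hP : P ≠ 0)
    (h : ∀ z, 0 < z.im → diagH n N z = P.eval (J z)) {z : ℂ} (hz : 0 < z.im) :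
    P.rootMultiplicity (J z) = ((Idx' n).filter fun i => J z = J (mob i.mat z)).card := by
  classical
  have h1 : ZOrd (fun w => diagH n N w) z (P.rootMultiplicity (J z)) := by
    refine (zOrd_polynomial hP hz).congr ?_
    filter_upwards [UH_mem_nhds hz] with w hw
    exact (h w hw).symm
  have hJc : ContinuousAt J z := (hasStrictDerivAt_J hz).hasDerivAt.continuousAt
  have h2 : ZOrd (fun w => ∏ e ∈ E6', (J w - tE e) ^ kN n N e) z 0 := by
    have : ∀ e ∈ E6', ZOrd (fun w => (J w - tE e) ^ kN n N e) z 0 := fun e he =>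
      zOrd_zero_of_continuousAt ((hJc.sub continuousAt_const).zpow₀ _ (Or.inl (J_sub_ne_zero he hz)))
        (zpow_ne_zero _ (J_sub_ne_zero he hz))
    simpa using ZOrd.prod E6' this
  have h3 := (ZOrd.prod (Idx' n) fun i hi => zOrd_factor hn hi hz).mul h2
  rw [h1.unique h3, Finset.card_filter, add_zero]

/-- `z` is a fixed point of a matrix of the Eichler order with determinant `n` and trace `r`. -/
def Fix (n : ℕ) (r : ℤ) (z : ℂ) : Prop :=
  ∃ M : Matrix (Fin 2) (Fin 2) ℤ, InO n M ∧ mob M z = z ∧ 0 < M 1 0 ∧ M 0 0 + M 1 1 = r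

/-- The traces of the elliptic matrices of determinant `n`. -/
noncomputable def traces (n : ℕ) : Finset ℤ := (Finset.Icc (-(2 * n + 1) : ℤ) (2 * n + 1)).filter fun r => r ^ 2 < 4 * n

lemma mem_traces {n : ℕ} {r : ℤ} : r ∈ traces n ↔ r ^ 2 < 4 * n := by
  rw [traces, Finset.mem_filter, Finset.mem_Icc]
  refine ⟨fun h => h.2, fun h => ⟨⟨?_, ?_⟩, h⟩⟩ <;> nlinarith

lemma trace_mem_traces {n : ℕ} (hn : 0 < n) {M : Matrix (Fin 2) (Fin 2) ℤ} (hM : InO n M) {z : ℂ}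
    (hz : 0 < z.im) (h : mob M z = z) (hc : 0 < M 1 0) : M 0 0 + M 1 1 ∈ traces n := by
  rw [mem_traces]
  have h1 := four_det_of_mob_eq_self (hM.det_pos hn) hz h
  rw [hM.1] at h1
  have h2 : (0 : ℝ) < M 1 0 * z.im := mul_pos (by exact_mod_cast hc) hz
  have h3 : ((M 0 0 + M 1 1 : ℤ) : ℝ) ^ 2 < 4 * n := by push_cast at h1 ⊢; nlinarith
  exact_mod_cast h3

lemma fix_unique {n : ℕ} (hn : 0 < n) {M M' : Matrix (Fin 2) (Fin 2) ℤ} (hM : InO n M) (hM' : InO n M')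
    {z : ℂ} (hz : 0 < z.im) (h : mob M z = z) (h' : mob M' z = z) (hc : 0 < M 1 0) (hc' : 0 < M' 1 0)
    (ht : M 0 0 + M 1 1 = M' 0 0 + M' 1 1) : M = M' := by
  have h1 := four_det_of_mob_eq_self (hM.det_pos hn) hz h
  have h2 := four_det_of_mob_eq_self (hM'.det_pos hn) hz h'
  have htR : (M 0 0 + M 1 1 : ℝ) = M' 0 0 + M' 1 1 := by exact_mod_cast ht
  have p1 : (0 : ℝ) < M 1 0 := by exact_mod_cast hc
  have p2 : (0 : ℝ) < M' 1 0 := by exact_mod_cast hc'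
  have h3 : (M 1 0 : ℝ) = M' 1 0 := by
    rw [hM.1] at h1
    rw [hM'.1, ← htR, h1] at h2
    have h4 := mul_left_cancel₀ four_ne_zero h2
    exact mul_right_cancel₀ hz.ne' ((sq_eq_sq₀ (mul_pos p1 hz).le (mul_pos p2 hz).le).mp h4)
  obtain ⟨a1, a2⟩ := (mob_eq_self_iff (hM.det_pos hn) hz).1 h
  obtain ⟨b1, b2⟩ := (mob_eq_self_iff (hM'.det_pos hn) hz).1 h'
  have e00 : (M 0 0 : ℝ) = M' 0 0 := by linear_combination htR / 2 - a1 / 2 + b1 / 2 + z.re * h3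
  have e11 : (M 1 1 : ℝ) = M' 1 1 := by linear_combination htR - e00
  have e01 : (M 0 1 : ℝ) = M' 0 1 := by rw [a2, b2, h3]
  ext i j
  fin_cases i <;> fin_cases j
  · exact_mod_cast e00
  · exact_mod_cast e01
  · exact_mod_cast h3
  · exact_mod_cast e11

open Classical in
lemma card_fix {n : ℕ} (hn : 0 < n) {z : ℂ} (hz : 0 < z.im) :
    ((Idx' n).filter fun i => J z = J (mob i.mat z)).card = ((traces n).filter fun r => Fix n r z).card := by
  have key : ∀ i, i ∈ (Idx' n).filter (fun i => J z = J (mob i.mat z)) →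
      ∃ γ, InG γ ∧ mob (γ * i.mat) z = z ∧ 0 < (γ * i.mat) 1 0 := fun i hi =>
    exists_fix_of_J_eq hn (Finset.mem_filter.1 hi).1 hz (Finset.mem_filter.1 hi).2
  choose! γ hγ hfix hc using key
  have hO : ∀ i ∈ (Idx' n).filter (fun i => J z = J (mob i.mat z)), InO n (γ i * i.mat) := fun i hi =>
    (hγ i hi).mul_inO (inO_mat hn (mem_Idx'.1 (Finset.mem_filter.1 hi).1).1)
  refine Finset.card_nbij (fun i => (γ i * i.mat) 0 0 + (γ i * i.mat) 1 1) ?_ ?_ ?_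
  · intro i hi
    exact Finset.mem_filter.2 ⟨trace_mem_traces hn (hO i hi) hz (hfix i hi) (hc i hi),
      _, hO i hi, hfix i hi, hc i hi, rfl⟩
  · intro i hi j hj hij
    have h1 := fix_unique hn (hO i hi) (hO j hj) hz (hfix i hi) (hfix j hj) (hc i hi) (hc j hj) hij
    refine mat_unique hn (mem_Idx'.1 (Finset.mem_filter.1 hi).1).1 (mem_Idx'.1 (Finset.mem_filter.1 hj).1).1
      ((hγ i hi).adj.mul (hγ j hj)) ?_
    rw [Matrix.mul_assoc, ← h1, ← Matrix.mul_assoc, (hγ i hi).adj_mul, Matrix.one_mul]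
  · intro r hr
    obtain ⟨hr, M, hM, hMz, hMc, rfl⟩ := Finset.mem_filter.1 hr
    obtain ⟨i, hi, δ, hδ, hMi⟩ := exists_eq_mul_mat hn hM
    have hdet := (inO_mat hn hi).det_pos hn
    have hiz := mob_im_pos hdet hz
    have hns : ¬ i.Scalar := by
      intro hs
      have hA := hs.mat
      rw [hA, mul_smul_comm, Matrix.mul_one] at hMi
      have hA0 : (i.2.1.1 : ℤ) ≠ 0 := by
        intro h0
        rw [h0, zero_smul] at hMi
        rw [hMi] at hMc
        simp at hMc
      rw [hMi, mob_smul hA0] at hMz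
      rcases hδ.eq_one_or_neg_one hz hMz with rfl | rfl <;> rw [hMi] at hMc <;> simp at hMc
    have hJ : J z = J (mob i.mat z) := by
      conv_lhs => rw [← hMz, hMi, mob_mul _ _ hdet hz, inv_J δ hδ _ hiz]
    have hi' : i ∈ (Idx' n).filter (fun i => J z = J (mob i.mat z)) :=
      Finset.mem_filter.2 ⟨mem_Idx'.2 ⟨hi, hns⟩, hJ⟩
    refine ⟨i, hi', ?_⟩
    have h1 : γ i * i.mat = γ i * δ.adjugate * M := by
      rw [hMi, Matrix.mul_assoc, ← Matrix.mul_assoc _ δ, hδ.adj_mul, Matrix.one_mul]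
    have h2 := hfix i hi'
    have h3 := hc i hi'
    dsimp only
    rw [h1] at h2 h3 ⊢
    rw [mob_mul _ _ (hM.det_pos hn) hz, hMz] at h2
    rcases ((hγ i hi').mul hδ.adj).eq_one_or_neg_one hz h2 with h | h
    · rw [h, Matrix.one_mul]
    · rw [h, Matrix.neg_mul, Matrix.one_mul, Matrix.neg_apply] at h3
      omega

lemma Fix.of_J_eq {n : ℕ} (hn : 0 < n) {r : ℤ} {z w : ℂ} (hz : 0 < z.im) (hw : 0 < w.im) (h : J w = J z)
    (hf : Fix n r w) : Fix n r z := by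
  obtain ⟨M, hM, hMw, hc, ht⟩ := hf
  obtain ⟨γ, hγ, rfl⟩ := eqv_of_J_eq hw hz h
  have hMd := hM.det_pos hn
  have hback := mob_adjugate_mob hγ.det_pos hw
  have hden : den (γ * M * γ.adjugate) (mob γ w) = den M w := by
    rw [den_mul _ _ hγ.adj.det_pos hz, hback, den_mul _ _ hMd hw, hMw]
    have h1 := den_mul γ γ.adjugate hγ.adj.det_pos hz
    rw [hγ.mul_adj, hback] at h1
    have h2 : den 1 (mob γ w) = 1 := by simp [den]
    rw [h2] at h1
    linear_combination -den M w * h1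
  have hO : InO n (γ * M * γ.adjugate) := (hγ.mul_inO hM).mul_inG hγ.adj
  refine ⟨_, hO, ?_, ?_, ?_⟩
  · rw [mob_mul _ _ hγ.adj.det_pos hz, hback, mob_mul _ _ hMd hw, hMw]
  · have h1 := congrArg Complex.im hden
    simp only [den, add_im, mul_im, intCast_re, intCast_im, zero_mul, add_zero] at h1
    have h2 : (0 : ℝ) < ((γ * M * γ.adjugate) 1 0 : ℤ) * (mob γ w).im := by
      rw [h1]; exact mul_pos (by exact_mod_cast hc) hw
    exact_mod_cast pos_of_mul_pos_left h2 hz.le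
  · have h1 := Matrix.trace_mul_cycle γ M γ.adjugate
    rw [hγ.adj_mul, Matrix.one_mul, trace_fin_two, trace_fin_two] at h1
    rw [h1, ht]

/-- Gram matrices of positive definite real binary quadratic forms. -/
structure PDef (Q : Matrix (Fin 2) (Fin 2) ℝ) : Prop where
  symm : Q 1 0 = Q 0 1
  pos : 0 < Q 0 0
  det_pos : 0 < Q.det

lemma cmPointC_re (Q : Matrix (Fin 2) (Fin 2) ℝ) : (cmPointC Q).re = -Q 0 1 / Q 0 0 := by
  rw [cmPointC, div_ofReal_re]; simp

lemma cmPointC_im (Q : Matrix (Fin 2) (Fin 2) ℝ) : (cmPointC Q).im = Real.sqrt Q.det / Q 0 0 := by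
  rw [cmPointC, div_ofReal_im]; simp

lemma PDef.im_pos {Q : Matrix (Fin 2) (Fin 2) ℝ} (hQ : PDef Q) : 0 < (cmPointC Q).im := by
  rw [cmPointC_im]
  exact div_pos (Real.sqrt_pos.mpr hQ.det_pos) hQ.pos

/-- The defining equation of the CM point. -/
def IsRootOf (Q : Matrix (Fin 2) (Fin 2) ℝ) (z : ℂ) : Prop := Q 0 0 * z ^ 2 + 2 * Q 0 1 * z + Q 1 1 = 0

lemma isRootOf_iff {Q : Matrix (Fin 2) (Fin 2) ℝ} {z : ℂ} (hz : 0 < z.im) :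
    IsRootOf Q z ↔ Q 0 1 = -(Q 0 0 * z.re) ∧ Q 1 1 = Q 0 0 * normSq z := by
  rw [IsRootOf, Complex.ext_iff]
  simp only [add_re, mul_re, add_im, mul_im, ofReal_re, ofReal_im, normSq_apply, zero_mul, sub_zero, sq,
    add_zero, zero_re, zero_im, re_ofNat, im_ofNat, mul_zero]
  constructor
  · rintro ⟨h1, h2⟩
    have h3 : Q 0 1 = -(Q 0 0 * z.re) := by
      apply mul_left_cancel₀ hz.ne'
      linear_combination h2 / 2
    exact ⟨h3, by linear_combination h1 - 2 * z.re * h3⟩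
  · rintro ⟨h1, h2⟩
    exact ⟨by linear_combination h2 + 2 * z.re * h1, by linear_combination 2 * z.im * h1⟩

lemma PDef.isRootOf_iff {Q : Matrix (Fin 2) (Fin 2) ℝ} (hQ : PDef Q) {z : ℂ} (hz : 0 < z.im) :
    IsRootOf Q z ↔ cmPointC Q = z := by
  have hp := hQ.pos
  have hs := Real.sq_sqrt hQ.det_pos.le
  have hdet := det_fin_two Q
  rw [hQ.symm] at hdet
  rw [LevelSix.isRootOf_iff hz, Complex.ext_iff, cmPointC_re, cmPointC_im, normSq_apply]
  constructor
  · rintro ⟨h1, h2⟩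
    refine ⟨by rw [h1]; field_simp, ?_⟩
    rw [div_eq_iff hp.ne', Real.sqrt_eq_iff_mul_self_eq_of_pos (mul_pos hz hp), hdet, h1, h2]
    ring
  · rintro ⟨h1, h2⟩
    rw [← h1, ← h2]
    constructor
    · field_simp
    · field_simp
      linear_combination -hs - hdet

lemma PDef.isRootOf {Q : Matrix (Fin 2) (Fin 2) ℝ} (hQ : PDef Q) : IsRootOf Q (cmPointC Q) :=
  (hQ.isRootOf_iff hQ.im_pos).mpr rfl

lemma det_formMat (a b c : ℤ) : (formMat a b c).det = (4 * a * c - b ^ 2) / 4 := by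
  rw [formMat, det_fin_two_of]; ring

lemma pDef_formMat {a b c : ℤ} (ha : 0 < a) (h : b ^ 2 < 4 * a * c) : PDef (formMat a b c) where
  symm := by simp [formMat]
  pos := by simpa [formMat] using ha
  det_pos := by
    rw [det_formMat]
    have : (b : ℝ) ^ 2 < 4 * a * c := by exact_mod_cast h
    linarith

lemma pDef_of_mem {d : ℤ} (hd : 0 < d) {Q : Matrix (Fin 2) (Fin 2) ℝ} (hQ : Q ∈ QdN d 6) : PDef Q := by
  obtain ⟨a, b, c, rfl, ha, hdisc, -⟩ := hQ
  exact pDef_formMat ha (by linarith)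

/-- The singular moduli of discriminant `-d`. -/
def Jd (d : ℤ) : Set ℂ := {t | ∃ Q ∈ QdN d 6, J (cmPointC Q) = t}

lemma mem_Jd_iff {n : ℕ} (hn : 0 < n) {r : ℤ} (hr : r ^ 2 < 4 * n) {t : ℂ} :
    t ∈ Jd (4 * n - r ^ 2) ↔ ∃ z : ℂ, 0 < z.im ∧ J z = t ∧ Fix n r z := by
  constructor
  · rintro ⟨Q, ⟨a, b, c, rfl, ha, hdisc, h6⟩, rfl⟩
    have hQ : PDef (formMat a b c) := pDef_formMat ha (by linarith)
    refine ⟨_, hQ.im_pos, rfl, ?_⟩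
    have heven : Even (r - b) := by
      have h1 : Even (r ^ 2 - b ^ 2) := ⟨2 * (n - a * c), by linarith⟩
      rcases Int.even_or_odd r with hr | hr <;> rcases Int.even_or_odd b with hb | hb
      · exact hr.sub hb
      · exact absurd h1 (Int.not_even_iff_odd.mpr ((hr.pow_of_ne_zero two_ne_zero).sub_odd hb.pow))
      · exact absurd h1 (Int.not_even_iff_odd.mpr (hr.pow.sub_even (hb.pow_of_ne_zero two_ne_zero)))
      · exact hr.sub_odd hb
    obtain ⟨k, hk⟩ := heven
    have hr' : r = b + 2 * k := by omega
    have hdet : (!![k, -c; a, b + k] : Matrix (Fin 2) (Fin 2) ℤ).det = n := by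
      rw [det_fin_two_of]
      rw [hr'] at hdisc
      linarith
    refine ⟨!![k, -c; a, b + k], ⟨hdet, by exact_mod_cast h6⟩, ?_, ha, ?_⟩
    · rw [mob_eq_self_iff (by rw [hdet]; exact_mod_cast hn) hQ.im_pos]
      obtain ⟨h1, h2⟩ := (isRootOf_iff hQ.im_pos).mp hQ.isRootOf
      simp only [formMat, of_apply, cons_val', cons_val_zero, cons_val_one, cons_val_fin_one] at h1 h2 ⊢
      push_cast
      exact ⟨by linear_combination 2 * h1, by linear_combination -h2⟩
    · simp only [of_apply, cons_val', cons_val_zero, cons_val_one, cons_val_fin_one]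
      linarith
  · rintro ⟨z, hz, rfl, M, hM, hMz, hc, ht⟩
    have hdet := hM.1
    rw [det_fin_two] at hdet
    have hdisc : (M 1 1 - M 0 0) ^ 2 - 4 * M 1 0 * (-M 0 1) = -(4 * n - r ^ 2) := by
      rw [← hdet, ← ht]; ring
    have hQ : PDef (formMat (M 1 0) (M 1 1 - M 0 0) (-M 0 1)) := pDef_formMat hc (by linarith)
    refine ⟨_, ⟨M 1 0, M 1 1 - M 0 0, -M 0 1, rfl, hc, hdisc, by exact_mod_cast hM.2⟩, ?_⟩
    congr 1
    rw [← hQ.isRootOf_iff hz, isRootOf_iff hz]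
    obtain ⟨h1, h2⟩ := (mob_eq_self_iff (hM.det_pos hn) hz).mp hMz
    simp only [formMat, of_apply, cons_val', cons_val_zero, cons_val_one, cons_val_fin_one]
    push_cast
    exact ⟨by linear_combination h1 / 2, by linear_combination -h2⟩

lemma J_mem_Jd_iff {n : ℕ} (hn : 0 < n) {r : ℤ} (hr : r ^ 2 < 4 * n) {z : ℂ} (hz : 0 < z.im) :
    J z ∈ Jd (4 * n - r ^ 2) ↔ Fix n r z := by
  rw [mem_Jd_iff hn hr]
  exact ⟨fun ⟨w, hw, h, hf⟩ => hf.of_J_eq hn hz hw h, fun h => ⟨z, hz, rfl, h⟩⟩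

lemma Jd_subset_Y {d : ℤ} (hd : 0 < d) : Jd d ⊆ Y := by
  rintro _ ⟨Q, hQ, rfl⟩
  exact J_mem_Y (pDef_of_mem hd hQ).im_pos

theorem sum_singular_moduli {n : ℕ} (hn : 0 < n) :
    (∀ r ∈ traces n, (Jd (4 * n - r ^ 2)).Finite) ∧
    ∑ r ∈ traces n, ∑ᶠ t ∈ Jd (4 * n - r ^ 2), (t ^ 2 - 31 / 2 : ℂ) =
      -2 * diagL n - 7 * sgN n 1 + 7 * sqN n - 10 * sgN n 2 - 3 * sgN n 3 + 6 * sgN n 6 := by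
  classical
  obtain ⟨P, N, hP, hPt, hsum⟩ := exists_diag_polynomial hn
  have hP0 : P ≠ 0 := by
    rintro rfl
    exact hPt 2 (by simp [E6']) (by simp)
  have hmult : ∀ z : ℂ, 0 < z.im →
      P.rootMultiplicity (J z) = ((traces n).filter fun r => J z ∈ Jd (4 * n - r ^ 2)).card := by
    intro z hz
    rw [rootMultiplicity_diag hn hP0 hP hz, card_fix hn hz]
    congr 1
    exact Finset.filter_congr fun r hr => (J_mem_Jd_iff hn (mem_traces.mp hr) hz).symm
  have hset : ∀ r ∈ traces n, Jd (4 * n - r ^ 2) =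
      ↑(P.roots.toFinset.filter fun t => t ∈ Jd (4 * n - r ^ 2)) := by
    intro r hr
    ext t
    rw [Finset.coe_filter, Set.mem_ofPred_eq, Multiset.mem_toFinset]
    refine ⟨fun ht => ⟨?_, ht⟩, fun ht => ht.2⟩
    obtain ⟨z, hz, rfl, hf⟩ := (mem_Jd_iff hn (mem_traces.mp hr)).mp ht
    rw [← Multiset.count_pos, Polynomial.count_roots, hmult z hz, Finset.card_pos]
    exact ⟨r, Finset.mem_filter.mpr ⟨hr, ht⟩⟩
  refine ⟨fun r hr => by rw [hset r hr]; exact Finset.finite_toSet _, ?_⟩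
  rw [← hsum, Finset.sum_multiset_map_count]
  have h1 : ∀ r ∈ traces n, ∑ᶠ t ∈ Jd (4 * n - r ^ 2), (t ^ 2 - 31 / 2 : ℂ) =
      ∑ t ∈ P.roots.toFinset, if t ∈ Jd (4 * n - r ^ 2) then (t ^ 2 - 31 / 2 : ℂ) else 0 := by
    intro r hr
    rw [← Finset.sum_filter]
    conv_lhs => rw [hset r hr]
    exact finsum_mem_coe_finset _ _
  rw [Finset.sum_congr rfl h1, Finset.sum_comm]
  refine Finset.sum_congr rfl fun t ht => ?_
  have hroot : P.eval t = 0 := (Polynomial.mem_roots hP0).mp (Multiset.mem_toFinset.mp ht)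
  have htY : t ∈ Y := fun e he h => hPt e he (h ▸ hroot)
  obtain ⟨z, hz, rfl⟩ := exists_J_eq htY
  rw [Polynomial.count_roots, hmult z hz, ← Finset.sum_filter, Finset.sum_const]

lemma val_mul (g g' : SL2R) : (g * g').1 = g.1 * g'.1 := rfl

lemma val_inv (g : SL2R) : (g⁻¹).1 = g.1.adjugate := rfl

lemma val_neg (g : SL2R) : (-g).1 = -g.1 := rfl

lemma atkinLehner_mul {k e f h : ℕ} (hk : k * e * f * h = 6) {g g' : SL2R}
    (hg : g ∈ atkinLehnerSet 6 (k * e)) (hg' : g' ∈ atkinLehnerSet 6 (k * f)) :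
    g * g' ∈ atkinLehnerSet 6 (e * f) := by
  obtain ⟨x, y, z, w, hg⟩ := hg
  obtain ⟨x', y', z', w', hg'⟩ := hg'
  have hk0 : (k : ℝ) ≠ 0 := by
    rintro h0
    have : k = 0 := by exact_mod_cast h0
    simp [this] at hk
  have h6 : (k * e * f * h : ℝ) = 6 := by exact_mod_cast congrArg (Nat.cast : ℕ → ℝ) hk
  have hs : (Real.sqrt (k * e : ℕ))⁻¹ * (Real.sqrt (k * f : ℕ))⁻¹ = (Real.sqrt (e * f : ℕ))⁻¹ * (k : ℝ)⁻¹ := by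
    rw [← mul_inv, ← mul_inv, ← Real.sqrt_mul (Nat.cast_nonneg _)]
    have : ((k * e : ℕ) : ℝ) * (k * f : ℕ) = (e * f : ℕ) * (k : ℝ) ^ 2 := by push_cast; ring
    rw [this, Real.sqrt_mul (Nat.cast_nonneg _), Real.sqrt_sq (Nat.cast_nonneg _)]
  refine ⟨k * x * x' + h * y * z', e * x * y' + f * y * w', f * z * x' + e * w * z', h * z * y' + k * w * w', ?_⟩
  rw [val_mul, hg, hg', smul_mul_smul_comm, hs, mul_smul]
  congr 1
  rw [inv_smul_eq_iff₀ hk0]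
  ext i j
  fin_cases i <;> fin_cases j <;> simp [mul_apply, Fin.sum_univ_two]
  · linear_combination -(y * z' : ℝ) * h6
  · ring
  · ring
  · linear_combination -(z * y' : ℝ) * h6

lemma atkinLehner_inv {e : ℕ} {g : SL2R} (hg : g ∈ atkinLehnerSet 6 e) : g⁻¹ ∈ atkinLehnerSet 6 e := by
  obtain ⟨x, y, z, w, hg⟩ := hg
  refine ⟨w, -y, -z, x, ?_⟩
  rw [val_inv, hg, adjugate_fin_two]
  ext i j
  fin_cases i <;> fin_cases j <;> simp

lemma atkinLehner_neg {e : ℕ} {g : SL2R} (hg : g ∈ atkinLehnerSet 6 e) : -g ∈ atkinLehnerSet 6 e := by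
  obtain ⟨x, y, z, w, hg⟩ := hg
  refine ⟨-x, -y, -z, -w, ?_⟩
  rw [val_neg, hg]
  ext i j
  fin_cases i <;> fin_cases j <;> simp

lemma atkinLehner_one : (1 : SL2R) ∈ atkinLehnerSet 6 1 := by
  refine ⟨1, 0, 0, 1, ?_⟩
  ext i j
  fin_cases i <;> fin_cases j <;> simp

lemma gamma0_subset : (Gamma0SL2R 6 : Set SL2R) ⊆ atkinLehnerSet 6 1 := by
  rintro _ ⟨γ, hγ, rfl⟩
  have h6 : (6 : ℤ) ∣ γ.1 1 0 := by
    have := CongruenceSubgroup.Gamma0_mem.mp hγ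
    exact_mod_cast (ZMod.intCast_zmod_eq_zero_iff_dvd _ 6).mp this
  obtain ⟨c, hc⟩ := h6
  refine ⟨γ.1 0 0, γ.1 0 1, c, γ.1 1 1, ?_⟩
  ext i j
  fin_cases i <;> fin_cases j <;> simp [hc, mul_comm]

lemma exists_common : ∀ e ∈ E6, ∀ f ∈ E6, ∃ k e' f' h : ℕ,
    e = k * e' ∧ f = k * f' ∧ k * e' * f' * h = 6 ∧ e' * f' ∈ E6 := by
  have : ∀ e ∈ E6, ∀ f ∈ E6, ∃ k < 7, ∃ e' < 7, ∃ f' < 7, ∃ h < 7,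
    e = k * e' ∧ f = k * f' ∧ k * e' * f' * h = 6 ∧ e' * f' ∈ E6 := by decide
  intro e he f hf
  obtain ⟨k, -, e', -, f', -, h, -, hh⟩ := this e he f hf
  exact ⟨k, e', f', h, hh⟩

lemma mem_FrickeGroup {g : SL2R} : g ∈ FrickeGroup 6 ↔ ∃ e ∈ E6, g ∈ atkinLehnerSet 6 e := by
  constructor
  · intro hg
    induction hg using Subgroup.closure_induction with
    | mem g hg =>
      rcases hg with hg | hg
      · exact ⟨1, by decide, gamma0_subset hg⟩
      · simp only [Set.mem_iUnion] at hg
        obtain ⟨e, ⟨he, -⟩, hg⟩ := hg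
        have : e ∈ Nat.divisors 6 := Nat.mem_divisors.mpr ⟨he, by norm_num⟩
        rw [show Nat.divisors 6 = E6 by decide] at this
        exact ⟨e, this, hg⟩
    | one => exact ⟨1, by decide, atkinLehner_one⟩
    | mul g g' _ _ h h' =>
      obtain ⟨e, he, hg⟩ := h
      obtain ⟨f, hf, hg'⟩ := h'
      obtain ⟨k, e', f', h, rfl, rfl, hk, hef⟩ := exists_common e he f hf
      exact ⟨_, hef, atkinLehner_mul hk hg hg'⟩
    | inv g _ h =>
      obtain ⟨e, he, hg⟩ := h
      exact ⟨e, he, atkinLehner_inv hg⟩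
  · rintro ⟨e, he, hg⟩
    refine Subgroup.subset_closure (Or.inr ?_)
    simp only [Set.mem_iUnion]
    have : ∀ e ∈ E6, e ∣ 6 ∧ Nat.Coprime e (6 / e) := by decide
    exact ⟨e, this e he, hg⟩

lemma E6_mul_div {e : ℕ} (he : e ∈ E6) : e * (6 / e) = 6 := by
  revert he; revert e; decide

lemma atkinLehner_det {e : ℕ} (he : e ∈ E6) {x y z w : ℤ}
    (h : ((Real.sqrt e)⁻¹ • !![(x : ℝ) * e, (y : ℝ); (z : ℝ) * (6 : ℕ), (w : ℝ) * e]).det = 1) :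
    x * w * e - y * z * (6 / e : ℕ) = 1 := by
  have he0 : (e : ℝ) ≠ 0 := by exact_mod_cast (E6_pos he).ne'
  have h6 : (e : ℝ) * (6 / e : ℕ) = (6 : ℕ) := by exact_mod_cast congrArg (Nat.cast : ℕ → ℝ) (E6_mul_div he)
  rw [det_smul, Fintype.card_fin, inv_pow, Real.sq_sqrt (Nat.cast_nonneg _), det_fin_two_of, ← h6,
    inv_mul_eq_iff_eq_mul₀ he0] at h
  have h' : (x * w * e - y * z * (6 / e : ℕ) : ℝ) = 1 := by
    apply mul_left_cancel₀ he0
    linear_combination h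
  generalize 6 / e = k at h' ⊢
  exact_mod_cast h'

lemma moebius_eq_mob {e : ℕ} (he : e ∈ E6) {g : SL2R} {x y z w : ℤ}
    (hg : g.1 = (Real.sqrt e)⁻¹ • !![(x : ℝ) * e, (y : ℝ); (z : ℝ) * (6 : ℕ), (w : ℝ) * e]) (τ : ℂ) :
    moebius g τ = mob !![e * x, y; 6 * z, e * w] τ := by
  have he0 : ((Real.sqrt e : ℝ) : ℂ)⁻¹ ≠ 0 := by
    have : (0 : ℝ) < e := by exact_mod_cast E6_pos he
    simpa using (Real.sqrt_pos.mpr this).ne'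
  rw [moebius, hg, mob]
  simp only [Matrix.smul_apply, smul_eq_mul, of_apply, cons_val', cons_val_zero, cons_val_one,
    cons_val_fin_one]
  push_cast
  rw [← mul_div_mul_left (e * x * τ + y : ℂ) _ he0]
  congr 1 <;> ring

lemma exists_moebius_eq {e : ℕ} (he : e ∈ E6) {g : SL2R} (hg : g ∈ atkinLehnerSet 6 e) :
    ∃ γ, InG γ ∧ ∀ τ, 0 < τ.im → moebius g τ = mob γ (mob (W e) τ) := by
  obtain ⟨x, y, z, w, hg⟩ := hg
  have hd := atkinLehner_det he (by rw [← hg]; exact g.2)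
  obtain ⟨γ, hγ, h⟩ := exists_mul_W he x y z w hd
  exact ⟨γ, hγ, fun τ hτ => by rw [moebius_eq_mob he hg, h, mob_mul _ _ (W_det_pos e) hτ]⟩

lemma exists_eq_mul_W {e : ℕ} (he : e ∈ E6) {γ : Matrix (Fin 2) (Fin 2) ℤ} (hγ : InG γ) :
    ∃ x y z w : ℤ, γ * W e = !![e * x, y; 6 * z, e * w] := by
  obtain ⟨c, hc⟩ := hγ.2
  refine forall_E6 (p := fun e => ∃ x y z w : ℤ, γ * W e = !![e * x, y; 6 * z, e * w]) ?_ ?_ ?_ ?_ e he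
  · refine ⟨γ 0 0, γ 0 1, c, γ 1 1, ?_⟩
    rw [W_one, Matrix.mul_one, eta_fin_two γ, hc]; simp
  · refine ⟨γ 0 0 + 3 * γ 0 1, -γ 0 0 - 2 * γ 0 1, 2 * c + γ 1 1, - 3 * c - γ 1 1, ?_⟩
    rw [W_two]; ext i j
    fin_cases i <;> fin_cases j <;> simp [mul_apply, Fin.sum_univ_two, hc] <;> ring
  · refine ⟨γ 0 0 + 2 * γ 0 1, -2 * γ 0 0 - 3 * γ 0 1, 3 * c + γ 1 1, - 4 * c - γ 1 1, ?_⟩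
    rw [W_three]; ext i j
    fin_cases i <;> fin_cases j <;> simp [mul_apply, Fin.sum_univ_two, hc] <;> ring
  · refine ⟨γ 0 1, -γ 0 0, γ 1 1, -c, ?_⟩
    rw [W_six]; ext i j
    fin_cases i <;> fin_cases j <;> simp [mul_apply, Fin.sum_univ_two, hc] <;> ring

lemma exists_atkinLehner {e : ℕ} (he : e ∈ E6) {γ : Matrix (Fin 2) (Fin 2) ℤ} (hγ : InG γ) :
    ∃ g ∈ atkinLehnerSet 6 e, ∀ τ, 0 < τ.im → moebius g τ = mob γ (mob (W e) τ) := by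
  obtain ⟨x, y, z, w, h⟩ := exists_eq_mul_W he hγ
  have hdet := congrArg det h
  rw [det_mul, hγ.1, one_mul, W_det he, det_fin_two_of] at hdet
  have he0 : (e : ℝ) ≠ 0 := by exact_mod_cast (E6_pos he).ne'
  have hd : ((Real.sqrt e)⁻¹ • !![(x : ℝ) * e, (y : ℝ); (z : ℝ) * (6 : ℕ), (w : ℝ) * e]).det = 1 := by
    rw [det_smul, Fintype.card_fin, inv_pow, Real.sq_sqrt (Nat.cast_nonneg _), det_fin_two_of,
      inv_mul_eq_iff_eq_mul₀ he0]
    have : (e : ℝ) = e * x * (e * w) - y * (6 * z) := by exact_mod_cast hdet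
    push_cast
    linear_combination -this
  refine ⟨⟨_, hd⟩, ⟨x, y, z, w, rfl⟩, fun τ hτ => ?_⟩
  rw [← mob_mul _ _ (W_det_pos e) hτ, h]
  exact moebius_eq_mob he rfl τ

lemma sq_ne_mul_sq : ∀ e ∈ E6, ∀ f ∈ E6, e ≠ f → ∀ p s : ℤ, p ^ 2 = e * f * s ^ 2 → s = 0 := by
  intro e he f hf hne p s h
  by_contra hs
  obtain ⟨m, rfl⟩ : s ∣ p := (Int.pow_dvd_pow_iff two_ne_zero).mp ⟨e * f, by rw [h]; ring⟩
  have h1 : m ^ 2 = e * f := by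
    apply mul_right_cancel₀ (pow_ne_zero 2 hs)
    rw [← h]; ring
  have h2 : m.natAbs ^ 2 = e * f := by zify; rw [sq_abs]; exact h1
  have hm : m.natAbs < 7 := by
    have : ∀ e ∈ E6, ∀ f ∈ E6, e * f ≤ 36 := by decide
    nlinarith [this e he f hf]
  have : ∀ e ∈ E6, ∀ f ∈ E6, e ≠ f → ∀ m < 7, m ^ 2 ≠ e * f := by decide
  exact this e he f hf hne _ hm h2

lemma atkinLehner_disjoint {e f : ℕ} (he : e ∈ E6) (hf : f ∈ E6) {g : SL2R} (hg : g ∈ atkinLehnerSet 6 e)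
    (hg' : g ∈ atkinLehnerSet 6 f) : e = f := by
  by_contra hne
  obtain ⟨x, y, z, w, h⟩ := hg
  obtain ⟨x', y', z', w', h'⟩ := hg'
  have he0 : (0 : ℝ) < e := by exact_mod_cast E6_pos he
  have hf0 : (0 : ℝ) < f := by exact_mod_cast E6_pos hf
  have hse := Real.sq_sqrt he0.le
  have hsf := Real.sq_sqrt hf0.le
  have hse0 := Real.sqrt_pos.mpr he0
  have hsf0 := Real.sqrt_pos.mpr hf0
  have heq := h.symm.trans h'
  have hdet := atkinLehner_det he (by rw [← h]; exact g.2)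
  have h00 := congrFun (congrFun heq 0) 0
  have h01 := congrFun (congrFun heq 0) 1
  simp only [Matrix.smul_apply, smul_eq_mul, of_apply, cons_val', cons_val_zero, cons_val_one,
    cons_val_fin_one] at h00 h01
  rw [inv_mul_eq_iff_eq_mul₀ hse0.ne'] at h00 h01
  field_simp at h00 h01
  have hx : x = 0 := by
    refine sq_ne_mul_sq e he f hf hne (f * x') x ?_
    have : ((f * x' : ℝ)) ^ 2 = e * f * x ^ 2 := by
      apply mul_left_cancel₀ he0.ne'
      linear_combination -(x * e * Real.sqrt f + Real.sqrt e * x' * f) * h00 - (x' * f : ℝ) ^ 2 * hse +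
        (x * e : ℝ) ^ 2 * hsf
    exact_mod_cast this
  have hy : y = 0 := by
    refine sq_ne_mul_sq e he f hf hne (e * y') y ?_
    have : ((e * y' : ℝ)) ^ 2 = e * f * y ^ 2 := by
      linear_combination -e * (Real.sqrt f * y + Real.sqrt e * y') * h01 - e * (y' : ℝ) ^ 2 * hse +
        e * (y : ℝ) ^ 2 * hsf
    exact_mod_cast this
  rw [hx, hy] at hdet
  simp at hdet

/-- The involution of the `j₆`-line induced by `W_e`. -/
noncomputable def AL (e : ℕ) (t : ℂ) : ℂ := if e = 1 then t else tE e + kE e / (t - tE e)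

lemma AL_one (t : ℂ) : AL 1 t = t := if_pos rfl
lemma AL_two (t : ℂ) : AL 2 t = -3 + -8 / (t + 3) := by
  rw [AL, if_neg (by decide), tE_two]; simp [kE]
lemma AL_three (t : ℂ) : AL 3 t = -4 + 9 / (t + 4) := by
  rw [AL, if_neg (by decide), tE_three]; simp [kE]
lemma AL_six (t : ℂ) : AL 6 t = 5 + 72 / (t - 5) := by
  rw [AL, if_neg (by decide), tE_six]; simp [kE]

lemma J_mob_W {e : ℕ} (he : e ∈ E6) {z : ℂ} (hz : 0 < z.im) : J (mob (W e) z) = AL e (J z) := by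
  rcases E6_cases he with rfl | h
  · rw [W_one, mob_one, AL_one]
  · rw [J_W h hz, AL, if_neg (by rintro rfl; revert h; decide)]

lemma AL_mem_Y {e : ℕ} (he : e ∈ E6) {t : ℂ} (ht : t ∈ Y) : AL e t ∈ Y := by
  obtain ⟨z, hz, rfl⟩ := exists_J_eq ht
  rw [← J_mob_W he hz]
  exact J_mem_Y (mob_im_pos (W_det_pos e) hz)

lemma AL_AL {e : ℕ} (he : e ∈ E6) {t : ℂ} (ht : t ∈ Y) : AL e (AL e t) = t := by
  obtain ⟨z, hz, rfl⟩ := exists_J_eq ht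
  rw [← J_mob_W he hz, ← J_mob_W he (mob_im_pos (W_det_pos e) hz), mob_W_W e hz]

lemma Y_ne {t : ℂ} (ht : t ∈ Y) : t + 3 ≠ 0 ∧ t + 4 ≠ 0 ∧ t - 5 ≠ 0 := by
  have h2 := ht 2 (by decide)
  have h3 := ht 3 (by decide)
  have h6 := ht 6 (by decide)
  rw [tE_two] at h2
  rw [tE_three] at h3
  rw [tE_six] at h6
  exact ⟨fun h => h2 (by linear_combination h), fun h => h3 (by linear_combination h),
    fun h => h6 (by linear_combination h)⟩

lemma AL_two_three {t : ℂ} (ht : t ∈ Y) : AL 2 (AL 3 t) = AL 6 t := by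
  obtain ⟨h2, h3, h6⟩ := Y_ne ht
  rw [AL_two, AL_six, AL_three]
  have key : -4 + 9 / (t + 4) + 3 = -(t - 5) / (t + 4) := by field_simp; ring
  rw [key]
  field_simp
  ring

lemma AL_three_two {t : ℂ} (ht : t ∈ Y) : AL 3 (AL 2 t) = AL 6 t := by
  have h2 := AL_mem_Y (e := 2) (by decide) ht
  have h3 := AL_mem_Y (e := 3) (by decide) h2
  have h := AL_two_three h3
  rw [AL_AL (by decide) h2, AL_AL (by decide) ht] at h
  conv_rhs => rw [h]
  rw [AL_AL (by decide) h3]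

lemma AL_two_six {t : ℂ} (ht : t ∈ Y) : AL 2 (AL 6 t) = AL 3 t := by
  rw [← AL_two_three ht, AL_AL (by decide) (AL_mem_Y (by decide) ht)]

lemma AL_three_six {t : ℂ} (ht : t ∈ Y) : AL 3 (AL 6 t) = AL 2 t := by
  rw [← AL_three_two ht, AL_AL (by decide) (AL_mem_Y (by decide) ht)]

lemma AL_six_two {t : ℂ} (ht : t ∈ Y) : AL 6 (AL 2 t) = AL 3 t := by
  rw [← AL_three_two (AL_mem_Y (by decide) ht), AL_AL (by decide) ht]

lemma AL_six_three {t : ℂ} (ht : t ∈ Y) : AL 6 (AL 3 t) = AL 2 t := by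
  rw [← AL_two_three (AL_mem_Y (by decide) ht), AL_AL (by decide) ht]

lemma AL_comp {e : ℕ} (he : e ∈ E6) {f : ℕ} (hf : f ∈ E6) {t : ℂ} (ht : t ∈ Y) :
    ∃ g ∈ E6, AL e (AL f t) = AL g t := by
  revert e f
  have h1 : 1 ∈ E6 := by decide
  have h2 : 2 ∈ E6 := by decide
  have h3 : 3 ∈ E6 := by decide
  have h6 : 6 ∈ E6 := by decide
  have hf1 : ∀ f ∈ E6, ∃ g ∈ E6, AL 1 (AL f t) = AL g t := fun f hf => ⟨f, hf, AL_one _⟩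
  have hsq : ∀ f ∈ E6, ∃ g ∈ E6, AL f (AL f t) = AL g t := fun f hf =>
    ⟨1, h1, by rw [AL_AL hf ht, AL_one]⟩
  have he1 : ∀ e ∈ E6, ∃ g ∈ E6, AL e (AL 1 t) = AL g t := fun e he => ⟨e, he, by rw [AL_one]⟩
  intro e he f hf
  revert hf; revert f
  refine forall_E6 (p := fun e => ∀ {f : ℕ}, f ∈ E6 → ∃ g ∈ E6, AL e (AL f t) = AL g t) ?_ ?_ ?_ ?_ e he
  · exact fun hf => hf1 _ hf
  · exact fun {f} hf => forall_E6 (p := fun f => ∃ g ∈ E6, AL 2 (AL f t) = AL g t) (he1 2 h2) (hsq 2 h2)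
      ⟨6, h6, AL_two_three ht⟩ ⟨3, h3, AL_two_six ht⟩ f hf
  · exact fun {f} hf => forall_E6 (p := fun f => ∃ g ∈ E6, AL 3 (AL f t) = AL g t) (he1 3 h3)
      ⟨6, h6, AL_three_two ht⟩ (hsq 3 h3) ⟨2, h2, AL_three_six ht⟩ f hf
  · exact fun {f} hf => forall_E6 (p := fun f => ∃ g ∈ E6, AL 6 (AL f t) = AL g t) (he1 6 h6)
      ⟨3, h3, AL_six_two ht⟩ ⟨2, h2, AL_six_three ht⟩ (hsq 6 h6) f hf

lemma sum_E6 {β : Type*} [AddCommMonoid β] (f : ℕ → β) : ∑ e ∈ E6, f e = f 1 + (f 2 + (f 3 + f 6)) := by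
  rw [E6, Finset.sum_insert (by decide), Finset.sum_insert (by decide), Finset.sum_insert (by decide),
    Finset.sum_singleton]

lemma starOf_sq {t : ℂ} (ht : t ∈ Y) : starOf t ^ 2 - 158 = ∑ e ∈ E6, (AL e t ^ 2 - 31 / 2) := by
  obtain ⟨h2, h3, h6⟩ := Y_ne ht
  rw [starOf_eq, sum_E6, AL_one, AL_two, AL_three, AL_six]
  field_simp
  ring

lemma starOf_AL {e : ℕ} (he : e ∈ E6) {t : ℂ} (ht : t ∈ Y) : starOf (AL e t) = starOf t := by
  have h : ∀ t, starOf t = AL 1 t + AL 2 t + AL 3 t + AL 6 t + 2 := by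
    intro t
    rw [starOf_eq, AL_one, AL_two, AL_three, AL_six]; ring
  refine forall_E6 (p := fun e => starOf (AL e t) = starOf t) ?_ ?_ ?_ ?_ e he
  · rw [AL_one]
  · rw [h, h, AL_one, AL_one, AL_AL (by decide) ht, AL_three_two ht, AL_six_two ht]; ring
  · rw [h, h, AL_one, AL_one, AL_AL (by decide) ht, AL_two_three ht, AL_six_three ht]; ring
  · rw [h, h, AL_one, AL_one, AL_AL (by decide) ht, AL_two_six ht, AL_three_six ht]; ring

open Classical in
/-- The orbit of `t` under the Atkin–Lehner involutions. -/
noncomputable def orb (t : ℂ) : Finset ℂ := E6.image fun e => AL e t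

lemma mem_orb {t s : ℂ} : s ∈ orb t ↔ ∃ e ∈ E6, AL e t = s := by
  rw [orb, Finset.mem_image]

open Classical in
lemma card_insert_aux {t u v w : ℂ} (r1 : v = w ↔ u = t) (r2 : u = w ↔ v = t) (r3 : u = v ↔ w = t) :
    ({t, u, v, w} : Finset ℂ).card * ((if t = t then 1 else 0) + ((if u = t then 1 else 0) +
      ((if v = t then 1 else 0) + if w = t then 1 else 0))) = 4 := by
  by_cases a : u = t
  · obtain rfl := r1.mpr a
    subst a
    by_cases b : v = u
    · simp [b]
    · simp [b, Ne.symm b]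
  · by_cases b : v = t
    · obtain rfl := r2.mpr b
      subst b
      simp [a, Ne.symm a]
    · by_cases c : w = t
      · obtain rfl := r3.mpr c
        subst c
        simp [a, Ne.symm a]
      · simp [a, b, c, r1, r2, r3, Ne.symm a, Ne.symm b, Ne.symm c]

open Classical in
lemma card_orb_mul {t : ℂ} (ht : t ∈ Y) :
    (orb t).card * (E6.filter fun e => AL e t = t).card = 4 := by
  have h2 := AL_mem_Y (e := 2) (by decide) ht
  have h3 := AL_mem_Y (e := 3) (by decide) ht
  have e23 := AL_two_three ht
  have e32 := AL_three_two ht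
  have e26 := AL_two_six ht
  have e36 := AL_three_six ht
  have e62 := AL_six_two ht
  have e63 := AL_six_three ht
  have hinj : ∀ e ∈ E6, ∀ x ∈ Y, ∀ y ∈ Y, AL e x = AL e y → x = y := fun e he x hx y hy h => by
    rw [← AL_AL he hx, h, AL_AL he hy]
  have r1 : AL 3 t = AL 6 t ↔ AL 2 t = t := by
    rw [← e32]
    exact ⟨fun h => (hinj 3 (by decide) _ ht _ h2 h).symm, fun h => by rw [h]⟩
  have r2 : AL 2 t = AL 6 t ↔ AL 3 t = t := by
    rw [← e23]
    exact ⟨fun h => (hinj 2 (by decide) _ ht _ h3 h).symm, fun h => by rw [h]⟩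
  have r3 : AL 2 t = AL 3 t ↔ AL 6 t = t := by
    rw [← e26]
    exact ⟨fun h => (hinj 2 (by decide) _ ht _ (AL_mem_Y (by decide) ht) h).symm, fun h => by rw [h]⟩
  rw [Finset.card_filter, sum_E6, orb, E6, Finset.image_insert, Finset.image_insert, Finset.image_insert,
    Finset.image_singleton, AL_one]
  exact card_insert_aux r1 r2 r3

lemma conj_apply (Q g : Matrix (Fin 2) (Fin 2) ℝ) (i j : Fin 2) : (gᵀ * Q * g) i j =
    (g 0 i * Q 0 0 + g 1 i * Q 1 0) * g 0 j + (g 0 i * Q 0 1 + g 1 i * Q 1 1) * g 1 j := by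
  simp only [mul_apply, Fin.sum_univ_two, transpose_apply]

lemma PDef.conj {Q : Matrix (Fin 2) (Fin 2) ℝ} (hQ : PDef Q) (g : SL2R) : PDef ((g.1)ᵀ * Q * g.1) where
  symm := by
    rw [conj_apply, conj_apply, hQ.symm]; ring
  pos := by
    rw [conj_apply, hQ.symm]
    have hg := g.2
    rw [det_fin_two] at hg
    have hd := hQ.det_pos
    rw [det_fin_two, hQ.symm] at hd
    apply pos_of_mul_pos_right _ hQ.pos.le
    have h1 : Q 0 0 * ((g.1 0 0 * Q 0 0 + g.1 1 0 * Q 0 1) * g.1 0 0 +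
        (g.1 0 0 * Q 0 1 + g.1 1 0 * Q 1 1) * g.1 1 0) =
        (Q 0 0 * g.1 0 0 + Q 0 1 * g.1 1 0) ^ 2 + (Q 0 0 * Q 1 1 - Q 0 1 * Q 0 1) * g.1 1 0 ^ 2 := by ring
    rw [h1]
    by_cases hc : g.1 1 0 = 0
    · have ha : g.1 0 0 ≠ 0 := by
        intro ha
        rw [ha, hc] at hg
        simp at hg
      rw [hc]
      have := mul_ne_zero hQ.pos.ne' ha
      have : 0 < (Q 0 0 * g.1 0 0) ^ 2 := by positivity
      simpa using this
    · have : 0 < (Q 0 0 * Q 1 1 - Q 0 1 * Q 0 1) * g.1 1 0 ^ 2 := by positivity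
      positivity
  det_pos := by
    rw [det_mul, det_mul, det_transpose, g.2]; simpa using hQ.det_pos

lemma moebius_den_ne_zero (g : SL2R) {z : ℂ} (hz : 0 < z.im) :
    (g.1 1 0 : ℝ) * z + ((g.1 1 1 : ℝ) : ℂ) ≠ 0 := by
  intro h
  have h1 := congrArg Complex.im h
  simp only [add_im, mul_im, ofReal_re, ofReal_im, zero_mul, add_zero, zero_im] at h1
  have hc : g.1 1 0 = 0 := (mul_eq_zero.mp h1).resolve_right hz.ne'
  have h2 := congrArg Complex.re h
  rw [hc] at h2
  simp only [ofReal_re, ofReal_zero, zero_mul, zero_re, zero_add] at h2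
  have hg := g.2
  rw [det_fin_two, hc, h2] at hg
  simp at hg

lemma isRootOf_conj {Q : Matrix (Fin 2) (Fin 2) ℝ} (hQ : Q 1 0 = Q 0 1) (g : SL2R) {z : ℂ} (hz : 0 < z.im) :
    IsRootOf ((g.1)ᵀ * Q * g.1) z ↔ IsRootOf Q (moebius g z) := by
  have hd := moebius_den_ne_zero g hz
  rw [IsRootOf, IsRootOf, moebius]
  have h : ((((g.1)ᵀ * Q * g.1) 0 0 : ℝ) : ℂ) * z ^ 2 + 2 * (((g.1)ᵀ * Q * g.1) 0 1 : ℝ) * z +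
      (((g.1)ᵀ * Q * g.1) 1 1 : ℝ) = ((g.1 1 0 : ℝ) * z + ((g.1 1 1 : ℝ) : ℂ)) ^ 2 *
      (Q 0 0 * (((g.1 0 0 : ℝ) * z + ((g.1 0 1 : ℝ) : ℂ)) / ((g.1 1 0 : ℝ) * z + ((g.1 1 1 : ℝ) : ℂ))) ^ 2 +
        2 * Q 0 1 * (((g.1 0 0 : ℝ) * z + ((g.1 0 1 : ℝ) : ℂ)) / ((g.1 1 0 : ℝ) * z + ((g.1 1 1 : ℝ) : ℂ))) +
        Q 1 1) := by
    have key : ∀ A B C N D : ℂ, D ≠ 0 → D ^ 2 * (A * (N / D) ^ 2 + 2 * B * (N / D) + C) =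
        A * N ^ 2 + 2 * B * N * D + C * D ^ 2 := by
      intro A B C N D hD
      field_simp
    rw [conj_apply, conj_apply, conj_apply, hQ, key _ _ _ _ _ hd]
    push_cast
    ring
  rw [h, mul_eq_zero, or_iff_right (pow_ne_zero 2 hd)]

lemma moebius_im_pos {e : ℕ} (he : e ∈ E6) {g : SL2R} (hg : g ∈ atkinLehnerSet 6 e) {z : ℂ} (hz : 0 < z.im) :
    0 < (moebius g z).im := by
  obtain ⟨γ, hγ, h⟩ := exists_moebius_eq he hg
  rw [h z hz]
  exact mob_im_pos hγ.det_pos (mob_im_pos (W_det_pos e) hz)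

lemma J_moebius {e : ℕ} (he : e ∈ E6) {g : SL2R} (hg : g ∈ atkinLehnerSet 6 e) {z : ℂ} (hz : 0 < z.im) :
    J (moebius g z) = AL e (J z) := by
  obtain ⟨γ, hγ, h⟩ := exists_moebius_eq he hg
  rw [h z hz, inv_J γ hγ _ (mob_im_pos (W_det_pos e) hz), J_mob_W he hz]

lemma cmPointC_conj_iff {Q : Matrix (Fin 2) (Fin 2) ℝ} (hQ : PDef Q) {e : ℕ} (he : e ∈ E6) {g : SL2R}
    (hg : g ∈ atkinLehnerSet 6 e) {z : ℂ} (hz : 0 < z.im) :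
    cmPointC ((g.1)ᵀ * Q * g.1) = z ↔ cmPointC Q = moebius g z := by
  rw [← (hQ.conj g).isRootOf_iff hz, isRootOf_conj hQ.symm g hz, hQ.isRootOf_iff (moebius_im_pos he hg hz)]

lemma PDef.ext {Q Q' : Matrix (Fin 2) (Fin 2) ℝ} (hQ : PDef Q) (hQ' : PDef Q') (hd : Q.det = Q'.det)
    (h : cmPointC Q = cmPointC Q') : Q = Q' := by
  have him := congrArg Complex.im h
  rw [cmPointC_im, cmPointC_im, hd] at him
  have hs := Real.sqrt_pos.mpr hQ'.det_pos
  have h00 : Q 0 0 = Q' 0 0 := by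
    have h1 := hQ.pos.ne'
    have h2 := hQ'.pos.ne'
    field_simp at him
    linarith
  obtain ⟨a1, a2⟩ := (LevelSix.isRootOf_iff hQ.im_pos).mp hQ.isRootOf
  obtain ⟨b1, b2⟩ := (LevelSix.isRootOf_iff hQ'.im_pos).mp hQ'.isRootOf
  rw [h, h00] at a1 a2
  have h01 : Q 0 1 = Q' 0 1 := a1.trans b1.symm
  have h11 : Q 1 1 = Q' 1 1 := a2.trans b2.symm
  ext i j
  fin_cases i <;> fin_cases j
  · exact h00
  · exact h01
  · exact hQ.symm.trans (h01.trans hQ'.symm.symm)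
  · exact h11

lemma det_of_mem {d : ℤ} {Q : Matrix (Fin 2) (Fin 2) ℝ} (hQ : Q ∈ QdN d 6) : Q.det = d / 4 := by
  obtain ⟨a, b, c, rfl, -, h, -⟩ := hQ
  rw [det_formMat]
  have : (b ^ 2 - 4 * a * c : ℝ) = -d := by exact_mod_cast h
  linarith

lemma conj_mem {d : ℤ} (hd : 0 < d) {Q : Matrix (Fin 2) (Fin 2) ℝ} (hQ : Q ∈ QdN d 6) {e : ℕ} (he : e ∈ E6)
    {g : SL2R} (hg : g ∈ atkinLehnerSet 6 e) : (g.1)ᵀ * Q * g.1 ∈ QdN d 6 := by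
  have hP := (pDef_of_mem hd hQ).conj g
  have hdet := det_of_mem hQ
  have hdet' : ((g.1)ᵀ * Q * g.1).det = d / 4 := by rw [det_mul, det_mul, det_transpose, g.2, hdet]; ring
  obtain ⟨a, b, c, rfl, -, -, k, hk⟩ := hQ
  obtain ⟨x, y, z, w, hg⟩ := hg
  have he0 : (e : ℝ) ≠ 0 := by exact_mod_cast (E6_pos he).ne'
  obtain ⟨h, hh⟩ : ∃ h : ℕ, e * h = 6 := ⟨_, E6_mul_div he⟩
  have hhR : (e * h : ℝ) = 6 := by exact_mod_cast hh
  have ha : (a : ℝ) = 6 * k := by exact_mod_cast hk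
  have hs : (Real.sqrt e)⁻¹ ^ 2 * e = 1 := by
    rw [inv_pow, Real.sq_sqrt (Nat.cast_nonneg _), inv_mul_cancel₀ he0]
  have heq : (g.1)ᵀ * formMat a b c * g.1 = formMat (6 * (k * e * x ^ 2 + b * x * z + h * c * z ^ 2))
      (2 * a * x * y + b * (e * x * w + h * y * z) + 12 * c * z * w)
      (k * h * y ^ 2 + b * y * w + c * e * w ^ 2) := by
    rw [hg]
    generalize (Real.sqrt e)⁻¹ = s at hs
    ext i j
    rw [conj_apply]
    fin_cases i <;> fin_cases j <;>
      simp only [formMat, ha, Matrix.smul_apply, of_apply, cons_val', cons_val_zero, cons_val_one,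
        cons_val_fin_one, smul_eq_mul, Fin.zero_eta, Fin.mk_one, Int.cast_mul, Int.cast_add, Int.cast_pow,
        Int.cast_natCast, Int.cast_ofNat, Nat.cast_ofNat]
    · linear_combination (6 * k * e * x ^ 2 + 6 * b * x * z + 6 * h * c * z ^ 2 : ℝ) * hs -
        6 * c * z ^ 2 * s ^ 2 * hhR
    · linear_combination (6 * k * x * y + b / 2 * (e * x * w + h * y * z) + 6 * c * z * w : ℝ) * hs -
        b / 2 * y * z * s ^ 2 * hhR
    · linear_combination (6 * k * x * y + b / 2 * (e * x * w + h * y * z) + 6 * c * z * w : ℝ) * hs -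
        b / 2 * y * z * s ^ 2 * hhR
    · linear_combination (k * h * y ^ 2 + b * y * w + c * e * w ^ 2 : ℝ) * hs - k * y ^ 2 * s ^ 2 * hhR
  rw [heq] at hP hdet' ⊢
  refine ⟨_, _, _, rfl, ?_, ?_, ⟨_, rfl⟩⟩
  · have := hP.pos
    simp only [formMat, of_apply, cons_val', cons_val_zero, cons_val_fin_one] at this
    exact_mod_cast this
  · rw [det_formMat] at hdet'
    have h4 := (div_left_inj' (by norm_num : (4 : ℝ) ≠ 0)).mp hdet'
    rw [← neg_inj, neg_neg, neg_sub]
    exact_mod_cast h4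

lemma im_pos_of_mem {d : ℤ} (hd : 0 < d) {Q : Matrix (Fin 2) (Fin 2) ℝ} (hQ : Q ∈ QdN d 6) :
    0 < (cmPointC Q).im := (pDef_of_mem hd hQ).im_pos

lemma exists_conj_of_J_eq {d : ℤ} (hd : 0 < d) {Q Q' : Matrix (Fin 2) (Fin 2) ℝ} (hQ : Q ∈ QdN d 6)
    (hQ' : Q' ∈ QdN d 6) {e : ℕ} (he : e ∈ E6) (h : J (cmPointC Q) = AL e (J (cmPointC Q'))) :
    ∃ g ∈ atkinLehnerSet 6 e, Q' = (g.1)ᵀ * Q * g.1 := by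
  have hz := im_pos_of_mem hd hQ
  have hz' := im_pos_of_mem hd hQ'
  rw [← J_mob_W he hz'] at h
  obtain ⟨γ, hγ, h1⟩ := eqv_of_J_eq (mob_im_pos (W_det_pos e) hz') hz h.symm
  obtain ⟨g, hg, h2⟩ := exists_atkinLehner he hγ
  refine ⟨g, hg, ?_⟩
  have hP := pDef_of_mem hd hQ
  refine (pDef_of_mem hd hQ').ext (hP.conj g) ?_ ?_
  · rw [det_of_mem hQ', det_of_mem (conj_mem hd hQ he hg)]
  · refine ((cmPointC_conj_iff hP he hg hz').mpr ?_).symm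
    rw [h1, h2 _ hz']

lemma J_cmPointC_conj {d : ℤ} (hd : 0 < d) {Q : Matrix (Fin 2) (Fin 2) ℝ} (hQ : Q ∈ QdN d 6)
    {e : ℕ} (he : e ∈ E6) {g : SL2R} (hg : g ∈ atkinLehnerSet 6 e) :
    J (cmPointC Q) = AL e (J (cmPointC ((g.1)ᵀ * Q * g.1))) := by
  have hP := pDef_of_mem hd hQ
  have hz' := (hP.conj g).im_pos
  rw [← J_moebius he hg hz', (cmPointC_conj_iff hP he hg hz').mp rfl]

lemma formRel_iff {d : ℤ} (hd : 0 < d) (Q Q' : QdN d 6) : formRel (FrickeGroup 6) (QdN d 6) Q Q' ↔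
    ∃ e ∈ E6, J (cmPointC Q.1) = AL e (J (cmPointC Q'.1)) := by
  constructor
  · rintro ⟨g, hg, h⟩
    obtain ⟨e, he, hg⟩ := mem_FrickeGroup.mp hg
    exact ⟨e, he, by rw [h]; exact J_cmPointC_conj hd Q.2 he hg⟩
  · rintro ⟨e, he, h⟩
    obtain ⟨g, hg, h⟩ := exists_conj_of_J_eq hd Q.2 Q'.2 he h
    exact ⟨g, mem_FrickeGroup.mpr ⟨e, he, hg⟩, h⟩

lemma AL_mem_Jd {d : ℤ} (hd : 0 < d) {e : ℕ} (he : e ∈ E6) {t : ℂ} (ht : t ∈ Jd d) : AL e t ∈ Jd d := by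
  obtain ⟨Q, hQ, rfl⟩ := ht
  obtain ⟨g, hg, -⟩ := exists_atkinLehner he InG.one
  refine ⟨_, conj_mem hd hQ he hg, ?_⟩
  rw [J_cmPointC_conj hd hQ he hg, AL_AL he]
  exact J_mem_Y ((pDef_of_mem hd hQ).conj g).im_pos

lemma eq_one_or_neg_one_of_moebius {g : SL2R} (hg : g ∈ atkinLehnerSet 6 1) {z : ℂ} (hz : 0 < z.im)
    (h : moebius g z = z) : g = 1 ∨ g = -1 := by
  obtain ⟨x, y, u, w, hg⟩ := hg
  have hd := atkinLehner_det (e := 1) (by decide) (by rw [← hg]; exact g.2)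
  rw [moebius_eq_mob (e := 1) (by decide) hg] at h
  have hγ : InG !![(1 : ℕ) * x, y; 6 * u, (1 : ℕ) * w] := by
    refine ⟨?_, ⟨u, rfl⟩⟩
    rw [det_fin_two_of]
    push_cast at hd ⊢
    linarith
  rcases hγ.eq_one_or_neg_one hz h with h1 | h1
  · left
    have h00 := congrFun (congrFun h1 0) 0
    have h01 := congrFun (congrFun h1 0) 1
    have h10 := congrFun (congrFun h1 1) 0
    have h11 := congrFun (congrFun h1 1) 1
    simp at h00 h01 h10 h11
    apply Subtype.ext
    rw [hg, h00, h01, h10, h11]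
    ext i j
    fin_cases i <;> fin_cases j <;> simp
  · right
    have h00 := congrFun (congrFun h1 0) 0
    have h01 := congrFun (congrFun h1 0) 1
    have h10 := congrFun (congrFun h1 1) 0
    have h11 := congrFun (congrFun h1 1) 1
    simp at h00 h01 h10 h11
    apply Subtype.ext
    rw [hg, h00, h01, h10, h11, val_neg]
    ext i j
    fin_cases i <;> fin_cases j <;> simp

lemma ne_neg_self (g : SL2R) : g ≠ -g := by
  intro h
  have h1 : g.1 = -g.1 := congrArg Subtype.val h
  have h2 : g.1 = 0 := by
    ext i j
    exact self_eq_neg.mp (congrFun (congrFun h1 i) j)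
  have h3 := g.2
  rw [h2, det_fin_two] at h3
  simp at h3

open Classical in
lemma stabOrder_eq {d : ℤ} (hd : 0 < d) {Q : Matrix (Fin 2) (Fin 2) ℝ} (hQ : Q ∈ QdN d 6) :
    stabOrder (FrickeGroup 6) Q = (E6.filter fun e => AL e (J (cmPointC Q)) = J (cmPointC Q)).card := by
  set E := E6.filter fun e => AL e (J (cmPointC Q)) = J (cmPointC Q) with hE
  have hP := pDef_of_mem hd hQ
  have hE6 : ∀ e : E, e.1 ∈ E6 := fun e => (Finset.mem_filter.mp e.2).1
  have hex : ∀ e : E, ∃ g ∈ atkinLehnerSet 6 e.1, Q = (g.1)ᵀ * Q * g.1 := fun e =>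
    exists_conj_of_J_eq hd hQ hQ (hE6 e) (Finset.mem_filter.mp e.2).2.symm
  choose g hg hgQ using hex
  have hneg : ∀ g : SL2R, ((-g).1)ᵀ * Q * (-g).1 = (g.1)ᵀ * Q * g.1 := fun g => by
    rw [val_neg, transpose_neg, Matrix.neg_mul, Matrix.neg_mul, Matrix.mul_neg, neg_neg]
  let F : E × Bool → { g : SL2R // g ∈ FrickeGroup 6 ∧ (g.1)ᵀ * Q * g.1 = Q } := fun p =>
    if p.2 then ⟨g p.1, mem_FrickeGroup.mpr ⟨_, hE6 p.1, hg p.1⟩, (hgQ p.1).symm⟩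
    else ⟨-g p.1, mem_FrickeGroup.mpr ⟨_, hE6 p.1, atkinLehner_neg (hg p.1)⟩, by rw [hneg]; exact (hgQ p.1).symm⟩
  have hF : ∀ p, (F p).1 = if p.2 then g p.1 else -g p.1 := by
    rintro ⟨e, b⟩
    cases b <;> rfl
  have hFm : ∀ p, (F p).1 ∈ atkinLehnerSet 6 p.1.1 := by
    rintro ⟨e, b⟩
    cases b
    · exact atkinLehner_neg (hg e)
    · exact hg e
  have hbij : Function.Bijective F := by
    constructor
    · rintro ⟨e, b⟩ ⟨e', b'⟩ h
      have h1 : e = e' := by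
        apply Subtype.ext
        refine atkinLehner_disjoint (hE6 e) (hE6 e') (hFm (e, b)) ?_
        rw [h]
        exact hFm (e', b')
      subst h1
      have h2 := congrArg Subtype.val h
      rw [hF, hF] at h2
      have := ne_neg_self (g e)
      cases b <;> cases b' <;> simp_all
    · rintro ⟨u, hu, huQ⟩
      obtain ⟨e, he, hue⟩ := mem_FrickeGroup.mp hu
      have heE : e ∈ E := by
        refine Finset.mem_filter.mpr ⟨he, ?_⟩
        have := J_cmPointC_conj hd hQ he hue
        rw [huQ] at this
        exact this.symm
      have h1 : u * (g ⟨e, heE⟩)⁻¹ ∈ atkinLehnerSet 6 (1 * 1) := by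
        refine atkinLehner_mul (k := e) (h := 6 / e) ?_ (by rwa [mul_one]) ?_
        · rw [mul_one, mul_one, E6_mul_div he]
        · rw [mul_one]
          exact atkinLehner_inv (hg ⟨e, heE⟩)
      rw [one_mul] at h1
      have h2 : ((u * (g ⟨e, heE⟩)⁻¹).1)ᵀ * Q * (u * (g ⟨e, heE⟩)⁻¹).1 = Q := by
        have hinv : (g ⟨e, heE⟩).1 * ((g ⟨e, heE⟩)⁻¹).1 = 1 := by
          rw [← val_mul, mul_inv_cancel]; rfl
        have hinvT := congrArg transpose hinv
        rw [transpose_mul, transpose_one] at hinvT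
        rw [val_mul, transpose_mul]
        calc (((g ⟨e, heE⟩)⁻¹).1)ᵀ * (u.1)ᵀ * Q * (u.1 * ((g ⟨e, heE⟩)⁻¹).1)
            = (((g ⟨e, heE⟩)⁻¹).1)ᵀ * ((u.1)ᵀ * Q * u.1) * ((g ⟨e, heE⟩)⁻¹).1 := by
              simp only [Matrix.mul_assoc]
          _ = (((g ⟨e, heE⟩)⁻¹).1)ᵀ * (((g ⟨e, heE⟩).1)ᵀ * Q * (g ⟨e, heE⟩).1) * ((g ⟨e, heE⟩)⁻¹).1 := by
              rw [huQ, ← hgQ]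
          _ = ((((g ⟨e, heE⟩)⁻¹).1)ᵀ * ((g ⟨e, heE⟩).1)ᵀ) * Q *
                ((g ⟨e, heE⟩).1 * ((g ⟨e, heE⟩)⁻¹).1) := by
              simp only [Matrix.mul_assoc]
          _ = Q := by rw [hinvT, hinv, Matrix.one_mul, Matrix.mul_one]
      have h3 := (cmPointC_conj_iff hP (by decide) h1 hP.im_pos).mp (by rw [h2])
      rcases eq_one_or_neg_one_of_moebius h1 hP.im_pos h3.symm with h4 | h4
      · refine ⟨(⟨e, heE⟩, true), Subtype.ext ?_⟩
        rw [hF]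
        exact (mul_inv_eq_one.mp h4).symm
      · refine ⟨(⟨e, heE⟩, false), Subtype.ext ?_⟩
        rw [hF]
        have := mul_inv_eq_iff_eq_mul.mp h4
        rw [neg_one_mul] at this
        simpa using this.symm
  rw [stabOrder, ← Nat.card_congr (Equiv.ofBijective F hbij), Nat.card_prod, Nat.card_eq_fintype_card,
    Fintype.card_coe, Nat.card_eq_fintype_card, Fintype.card_bool, Nat.mul_div_cancel _ (by norm_num)]

lemma formRel_equivalence {d : ℤ} (hd : 0 < d) : Equivalence (formRel (FrickeGroup 6) (QdN d 6)) where
  refl Q := (formRel_iff hd _ _).mpr ⟨1, by decide, by rw [AL_one]⟩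
  symm {Q Q'} h := by
    obtain ⟨e, he, h⟩ := (formRel_iff hd _ _).mp h
    exact (formRel_iff hd _ _).mpr ⟨e, he, by rw [h, AL_AL he (J_mem_Y (im_pos_of_mem hd Q'.2))]⟩
  trans {Q Q' Q''} h h' := by
    obtain ⟨e, he, h⟩ := (formRel_iff hd _ _).mp h
    obtain ⟨e', he', h'⟩ := (formRel_iff hd _ _).mp h'
    obtain ⟨g, hg, h''⟩ := AL_comp he he' (J_mem_Y (im_pos_of_mem hd Q''.2))
    exact (formRel_iff hd _ _).mpr ⟨g, hg, by rw [h, h', h'']⟩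

lemma quot_eq_of_J_eq {d : ℤ} (hd : 0 < d) {O O' : Quot (formRel (FrickeGroup 6) (QdN d 6))} {e : ℕ}
    (he : e ∈ E6) (h : J (cmPointC (Quot.out O).1) = AL e (J (cmPointC (Quot.out O').1))) : O = O' := by
  rw [← Quot.out_eq O, ← Quot.out_eq O']
  exact Quot.sound ((formRel_iff hd _ _).mpr ⟨e, he, h⟩)

lemma orb_subset_Jd {d : ℤ} (hd : 0 < d) {t s : ℂ} (ht : t ∈ Jd d) (hs : s ∈ orb t) : s ∈ Jd d := by
  obtain ⟨e, he, rfl⟩ := mem_orb.mp hs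
  exact AL_mem_Jd hd he ht

/-- The trace over the classes of the Fricke group, as a sum over the singular moduli of `Γ₀(6)`. -/
lemma classTrace_eq {d : ℤ} (hd : 0 < d) (hfin : (Jd d).Finite) {f : ℂ → ℂ}
    (hf : ∀ z, 0 < z.im → f z = starOf (J z) ^ 2 - 158) :
    classTrace (FrickeGroup 6) f (QdN d 6) = ∑ᶠ t ∈ Jd d, (t ^ 2 - 31 / 2) := by
  classical
  set T : Quot (formRel (FrickeGroup 6) (QdN d 6)) → ℂ := fun O => J (cmPointC (Quot.out O).1) with hT
  have hTJ : ∀ O, T O ∈ Jd d := fun O => ⟨_, (Quot.out O).2, rfl⟩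
  have hTY : ∀ O, T O ∈ Y := fun O => Jd_subset_Y hd (hTJ O)
  have hinj : Function.Injective T := fun O O' h =>
    quot_eq_of_J_eq hd (e := 1) (by decide) (by rw [AL_one]; exact h)
  have : Finite (Quot (formRel (FrickeGroup 6) (QdN d 6))) := by
    have := hfin.to_subtype
    exact Finite.of_injective (fun O => (⟨T O, hTJ O⟩ : Jd d)) fun O O' h => hinj (congrArg Subtype.val h)
  have := Fintype.ofFinite (Quot (formRel (FrickeGroup 6) (QdN d 6)))
  have hterm : ∀ O : Quot (formRel (FrickeGroup 6) (QdN d 6)),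
      f (cmPointC (Quot.out O).1) / (stabOrder (FrickeGroup 6) (Quot.out O).1 : ℂ) =
      4⁻¹ * ∑ s ∈ orb (T O), (starOf s ^ 2 - 158) := by
    intro O
    rw [hf _ (im_pos_of_mem hd (Quot.out O).2), stabOrder_eq hd (Quot.out O).2]
    have h1 : ∀ s ∈ orb (T O), (starOf s ^ 2 - 158) = starOf (T O) ^ 2 - 158 := by
      intro s hs
      obtain ⟨e, he, rfl⟩ := mem_orb.mp hs
      rw [starOf_AL he (hTY O)]
    rw [Finset.sum_congr rfl h1, Finset.sum_const, nsmul_eq_mul]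
    have hc := card_orb_mul (hTY O)
    have hc' : ((orb (T O)).card : ℂ) * ((E6.filter fun e => AL e (T O) = T O).card : ℂ) = 4 := by
      exact_mod_cast hc
    have h0 : ((E6.filter fun e => AL e (T O) = T O).card : ℂ) ≠ 0 := by
      intro h0
      rw [h0, mul_zero] at hc'
      norm_num at hc'
    change (starOf (T O) ^ 2 - 158) / ((E6.filter fun e => AL e (T O) = T O).card : ℂ) = _
    rw [div_eq_iff h0]
    linear_combination (-(starOf (T O) ^ 2 - 158) / 4) * hc'
  have hbU : hfin.toFinset = Finset.univ.biUnion fun O => orb (T O) := by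
    ext t
    rw [Set.Finite.mem_toFinset, Finset.mem_biUnion]
    constructor
    · rintro ⟨Q, hQ, rfl⟩
      refine ⟨Quot.mk _ ⟨Q, hQ⟩, Finset.mem_univ _, ?_⟩
      have h := (formRel_equivalence hd).eqvGen_iff.mp
        (Quot.eqvGen_exact (Quot.out_eq (Quot.mk (formRel (FrickeGroup 6) (QdN d 6)) ⟨Q, hQ⟩)))
      obtain ⟨e, he, h⟩ := (formRel_iff hd _ _).mp ((formRel_equivalence hd).symm h)
      refine mem_orb.mpr ⟨e, he, h.symm⟩
    · rintro ⟨O, -, hO⟩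
      exact orb_subset_Jd hd (hTJ O) hO
  have hdisj : Set.PairwiseDisjoint ((Finset.univ : Finset (Quot (formRel (FrickeGroup 6) (QdN d 6)))) :
      Set (Quot (formRel (FrickeGroup 6) (QdN d 6)))) fun O => orb (T O) := by
    intro O _ O' _ hne
    refine Finset.disjoint_left.mpr fun s hs hs' => hne ?_
    obtain ⟨e, he, rfl⟩ := mem_orb.mp hs
    obtain ⟨e', he', h'⟩ := mem_orb.mp hs'
    obtain ⟨g, hg, h⟩ := AL_comp he he' (hTY O')
    refine quot_eq_of_J_eq hd hg ?_
    change T O = AL g (T O')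
    rw [← h, h', AL_AL he (hTY O)]
  have hbij : ∀ e ∈ E6, ∑ t ∈ hfin.toFinset, (AL e t ^ 2 - 31 / 2) = ∑ t ∈ hfin.toFinset, (t ^ 2 - 31 / 2) := by
    intro e he
    refine Finset.sum_nbij' (AL e) (AL e) ?_ ?_ ?_ ?_ fun _ _ => rfl
    · exact fun t ht => hfin.mem_toFinset.mpr (AL_mem_Jd hd he (hfin.mem_toFinset.mp ht))
    · exact fun t ht => hfin.mem_toFinset.mpr (AL_mem_Jd hd he (hfin.mem_toFinset.mp ht))
    · exact fun t ht => AL_AL he (Jd_subset_Y hd (hfin.mem_toFinset.mp ht))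
    · exact fun t ht => AL_AL he (Jd_subset_Y hd (hfin.mem_toFinset.mp ht))
  rw [classTrace, finsum_congr hterm, finsum_eq_sum_of_fintype, ← Finset.mul_sum, ← Finset.sum_biUnion hdisj,
    ← hbU, Finset.sum_congr rfl fun t ht => starOf_sq (Jd_subset_Y hd (hfin.mem_toFinset.mp ht)),
    Finset.sum_comm, Finset.sum_congr rfl hbij, Finset.sum_const, finsum_mem_eq_finite_toFinset_sum _ hfin]
  rw [show E6.card = 4 from rfl, nsmul_eq_mul]
  push_cast
  ring

/-- The number of factorizations `n = A D` with `A = D + k`. -/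
def gapN (n k : ℕ) : ℕ := ((dv n 1).filter fun p => p.1 = p.2 + k).card

lemma card_sq_eq {n : ℕ} (hn : 0 < n) (k : ℕ) {I : Finset ℤ} (hI : ∀ r : ℤ, r ^ 2 = 4 * n + k ^ 2 → r ∈ I) :
    (I.filter fun r : ℤ => r ^ 2 = 4 * n + k ^ 2).card = 2 * gapN n k := by
  have h := Finset.card_bij (s := ((dv n 1).filter fun p => p.1 = p.2 + k) ×ˢ (Finset.univ : Finset Bool))
    (t := I.filter fun r : ℤ => r ^ 2 = 4 * n + k ^ 2)
    (fun p _ => if p.2 then (p.1.1 + p.1.2 : ℤ) else -(p.1.1 + p.1.2 : ℤ)) ?_ ?_ ?_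
  · rw [← h, Finset.card_product, gapN, Finset.card_univ, Fintype.card_bool, mul_comm]
  · rintro ⟨⟨A, D⟩, b⟩ hp
    rw [Finset.mem_product, Finset.mem_filter, mem_dv hn] at hp
    obtain ⟨⟨h1, h2⟩, -⟩ := hp
    dsimp only at h1 h2
    rw [one_mul] at h1
    have h3 : (if b then (A + D : ℤ) else -(A + D : ℤ)) ^ 2 = 4 * n + k ^ 2 := by
      rw [← h1, h2]
      cases b <;> simp only [Bool.false_eq_true, if_true, if_false] <;> push_cast <;> ring
    exact Finset.mem_filter.mpr ⟨hI _ h3, h3⟩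
  · rintro ⟨⟨A, D⟩, b⟩ hp ⟨⟨A', D'⟩, b'⟩ hp' h
    rw [Finset.mem_product, Finset.mem_filter, mem_dv hn] at hp hp'
    obtain ⟨⟨h1, h2⟩, -⟩ := hp
    obtain ⟨⟨h1', h2'⟩, -⟩ := hp'
    dsimp only at h1 h2 h1' h2' h
    have hD : 0 < A := Nat.pos_of_ne_zero fun h0 => by rw [h0] at h1; omega
    have hD' : 0 < A' := Nat.pos_of_ne_zero fun h0 => by rw [h0] at h1'; omega
    cases b <;> cases b' <;> simp only [Bool.false_eq_true, if_true, if_false] at h <;>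
      simp only [Prod.mk.injEq, and_true] <;> omega
  · intro r hr
    have hr := (Finset.mem_filter.mp hr).2
    obtain ⟨N, hN⟩ : ∃ N : ℕ, r = N ∨ r = -N := ⟨r.natAbs, Int.natAbs_eq r⟩
    have hN2 : N ^ 2 = 4 * n + k ^ 2 := by
      rcases hN with rfl | rfl
      · exact_mod_cast hr
      · rw [neg_sq] at hr
        exact_mod_cast hr
    have hk : k ≤ N := (Nat.pow_le_pow_iff_left two_ne_zero).mp (by omega)
    obtain ⟨m, rfl⟩ := Nat.exists_eq_add_of_le hk
    have hm : Even m := by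
      have h2 : Even (m ^ 2) := (Nat.even_add.mp (⟨2 * n, by nlinarith⟩ : Even (m ^ 2 + 2 * k * m))).mpr
        ⟨k * m, by ring⟩
      exact (Nat.even_pow.mp h2).1
    obtain ⟨j, rfl⟩ := hm
    have hj : 1 * ((j + k) * j) = n := by nlinarith
    have hmem : (j + k, j) ∈ (dv n 1).filter fun p => p.1 = p.2 + k :=
      Finset.mem_filter.mpr ⟨(mem_dv hn).mpr hj, rfl⟩
    rcases hN with rfl | rfl
    · refine ⟨((j + k, j), true), Finset.mem_product.mpr ⟨hmem, Finset.mem_univ _⟩, ?_⟩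
      simp only [if_true]
      push_cast
      ring
    · refine ⟨((j + k, j), false), Finset.mem_product.mpr ⟨hmem, Finset.mem_univ _⟩, ?_⟩
      simp only [Bool.false_eq_true, if_false]
      push_cast
      ring

lemma gapN_zero (n : ℕ) : (gapN n 0 : ℤ) = sqN n := by
  rw [gapN, sqN, Finset.card_filter]
  push_cast
  rfl

lemma sum_dif (n : ℕ) : ∑ p ∈ dv n 1, dif p.1 p.2 = gapN n 1 + 2 * gapN n 2 := by
  have hk : ∀ k, 0 < k → ∑ p ∈ dv n 1, (if p.1 = p.2 + k ∨ p.2 = p.1 + k then (1 : ℂ) else 0) = 2 * gapN n k := by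
    intro k hk
    have h1 : ∀ p ∈ dv n 1, (if p.1 = p.2 + k ∨ p.2 = p.1 + k then (1 : ℂ) else 0) =
        (((if p.1 = p.2 + k then 1 else 0) + (if p.2 = p.1 + k then 1 else 0) : ℤ) : ℂ) := by
      intro p _
      split_ifs <;> first | omega | simp
    have h2 : ∑ p ∈ dv n 1, (if p.1 = p.2 + k then (1 : ℤ) else 0) = gapN n k := by
      rw [gapN, Finset.card_filter]
      push_cast
      rfl
    rw [Finset.sum_congr rfl h1, ← Int.cast_sum, Finset.sum_add_distrib, h2,
      ← dv_sum_swap n 1 fun a b => if a = b + k then 1 else 0, h2]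
    push_cast
    ring
  have h : ∀ p ∈ dv n 1, dif p.1 p.2 = 1 / 2 * (if p.1 = p.2 + 1 ∨ p.2 = p.1 + 1 then (1 : ℂ) else 0) +
      (if p.1 = p.2 + 2 ∨ p.2 = p.1 + 2 then (1 : ℂ) else 0) := fun p _ => by
    rw [dif, mul_ite, mul_one, mul_zero]
  rw [Finset.sum_congr rfl h, Finset.sum_add_distrib, ← Finset.mul_sum, hk 1 one_pos, hk 2 two_pos]
  ring

lemma diagL_eq {n : ℕ} (hn : 0 < n) : diagL n = 6 * sqN n - (gapN n 1 + 2 * gapN n 2) - n * cJ n +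
    3 / 2 * sgN n 2 - 2 * sgN n 3 - 13 / 2 * sgN n 6 := by
  have h1 : ∀ e : ℕ, ∑ p ∈ dv n e, ((e * p.2 : ℕ) : ℂ) * (6 - tE e ^ 2 / 2) = (6 - tE e ^ 2 / 2) * sgN n e := by
    intro e
    rw [sgN, dv_sum_swap n e fun a b => (e * a : ℤ), ← Finset.sum_mul, mul_comm]
    push_cast
    rfl
  have h2 : ∑ p ∈ dv n 1, (if p.1 = 1 then (p.2 * cJ p.2 : ℂ) else 0) = n * cJ n := by
    rw [Finset.sum_eq_single (1, n)]
    · simp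
    · rintro ⟨A, D⟩ hp hne
      rw [if_neg]
      rintro rfl
      rw [mem_dv hn] at hp
      exact hne (Prod.ext rfl (by simpa using hp))
    · intro h
      exact absurd ((mem_dv hn).mpr (by ring)) h
  have h3 : ∑ p ∈ dv n 1, (if p.1 = p.2 then (6 : ℂ) else 0) = 6 * sqN n := by
    rw [sqN]
    push_cast
    rw [Finset.mul_sum]
    exact Finset.sum_congr rfl fun p _ => by rw [mul_ite, mul_one, mul_zero]
  rw [diagL, Finset.sum_sub_distrib, Finset.sum_sub_distrib, h2, h3, sum_dif,
    Finset.sum_congr rfl fun e _ => h1 e, E6', Finset.sum_insert (by decide), Finset.sum_insert (by decide),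
    Finset.sum_singleton]
  simp only [tE]
  norm_num
  ring

lemma t2Star_pos {P : Polynomial ℂ} (hP : P = Polynomial.X ^ 2 - Polynomial.C 158) {d : ℤ} (hd : 0 < d)
    (hfin : (Jd d).Finite) : t2Star 6 P d = ∑ᶠ t ∈ Jd d, (t ^ 2 - 31 / 2) := by
  rw [t2Star, if_pos hd]
  refine classTrace_eq hd hfin fun z hz => ?_
  rw [hP, jnStar_six hz]
  simp

lemma t2Star_nonpos (P : Polynomial ℂ) {d : ℤ} (hd : d ≤ 0) :
    t2Star 6 P d = (if d = 0 then 5 / 2 else 0) + (if d = -1 then -1 else 0) + if d = -4 then -2 else 0 := by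
  rw [t2Star, if_neg hd.not_gt]
  split_ifs <;> first | omega | simp

/-- The coefficients of `G₂^{(6*)}` of positive index. -/
lemma finsum_t2Star {P : Polynomial ℂ} (hP : P = Polynomial.X ^ 2 - Polynomial.C 158) {n : ℕ} (hn : 0 < n) :
    ∑ᶠ r : ℤ, t2Star 6 P (4 * n - r ^ 2) =
      2 * n * cJ n - 7 * sgN n 1 - 13 * sgN n 2 + sgN n 3 + 19 * sgN n 6 := by
  obtain ⟨hfin, hsum⟩ := sum_singular_moduli hn
  set I : Finset ℤ := Finset.Icc (-(n + 2)) (n + 2) with hI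
  have hmem : ∀ r : ℤ, r ^ 2 ≤ 4 * n + 4 → r ∈ I := fun r hr => by
    rw [hI, Finset.mem_Icc]
    constructor <;> nlinarith
  have hsub : traces n ⊆ I := fun r hr => hmem r (by have := mem_traces.mp hr; omega)
  have hterm : ∀ r : ℤ, t2Star 6 P (4 * n - r ^ 2) =
      (if r ∈ traces n then ∑ᶠ t ∈ Jd (4 * n - r ^ 2), (t ^ 2 - 31 / 2 : ℂ) else 0) +
      ((if r ^ 2 = 4 * n + (0 : ℕ) ^ 2 then 5 / 2 else 0) + (if r ^ 2 = 4 * n + (1 : ℕ) ^ 2 then -1 else 0) +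
        if r ^ 2 = 4 * n + (2 : ℕ) ^ 2 then -2 else 0) := by
    intro r
    by_cases hr : r ^ 2 < 4 * n
    · rw [if_pos (mem_traces.mpr hr), t2Star_pos hP (by omega) (hfin r (mem_traces.mpr hr)),
        if_neg (by push_cast; omega), if_neg (by push_cast; omega), if_neg (by push_cast; omega)]
      ring
    · rw [if_neg fun h => hr (mem_traces.mp h), t2Star_nonpos P (by omega), zero_add]
      congr 1
      · congr 1
        · exact if_congr (by push_cast; omega) rfl rfl
        · exact if_congr (by push_cast; omega) rfl rfl
      · exact if_congr (by push_cast; omega) rfl rfl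
  have hsupp : (Function.support fun r : ℤ => t2Star 6 P (4 * n - r ^ 2)) ⊆ I := by
    intro r hr
    by_contra hI
    have hr2 : ¬ r ^ 2 ≤ 4 * n + 4 := fun h => hI (hmem r h)
    refine hr ?_
    dsimp only
    rw [t2Star_nonpos P (by omega), if_neg (by omega), if_neg (by omega), if_neg (by omega)]
    ring
  have hcount : ∀ (k : ℕ) (c : ℂ), k ≤ 2 →
      ∑ r ∈ I, (if r ^ 2 = 4 * (n : ℤ) + (k : ℕ) ^ 2 then c else 0) = 2 * gapN n k * c := by
    intro k c hk
    rw [← Finset.sum_filter, Finset.sum_const, card_sq_eq hn k, nsmul_eq_mul]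
    · push_cast
      ring
    · intro r hr
      exact hmem r (by rw [hr]; have : (k : ℤ) ≤ 2 := by exact_mod_cast hk
                       nlinarith)
  rw [finsum_eq_sum_of_support_subset _ hsupp, Finset.sum_congr rfl fun r _ => hterm r,
    Finset.sum_add_distrib, Finset.sum_add_distrib, Finset.sum_add_distrib,
    hcount 0 _ (by norm_num), hcount 1 _ (by norm_num), hcount 2 _ le_rfl, Finset.sum_ite_mem,
    Finset.inter_eq_right.mpr hsub, hsum, diagL_eq hn]
  have h0 : (gapN n 0 : ℂ) = sqN n := by exact_mod_cast congrArg (Int.cast : ℤ → ℂ) (gapN_zero n)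
  rw [h0]
  ring

lemma finsum_t2Star_zero (P : Polynomial ℂ) : ∑ᶠ r : ℤ, t2Star 6 P (4 * 0 - r ^ 2) = -7 / 2 := by
  have hsupp : (Function.support fun r : ℤ => t2Star 6 P (4 * 0 - r ^ 2)) ⊆
      (Finset.Icc (-2) 2 : Finset ℤ) := by
    intro r hr
    by_contra hI
    rw [Finset.mem_coe, Finset.mem_Icc] at hI
    have hr2 : 4 < r ^ 2 := by
      by_contra h
      exact hI ⟨by nlinarith, by nlinarith⟩
    refine hr ?_
    dsimp only
    rw [t2Star_nonpos P (by omega), if_neg (by omega), if_neg (by omega), if_neg (by omega)]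
    ring
  rw [finsum_eq_sum_of_support_subset _ hsupp,
    show (Finset.Icc (-2) 2 : Finset ℤ) = {-2, -1, 0, 1, 2} from rfl,
    Finset.sum_congr rfl fun (r : ℤ) _ => t2Star_nonpos P (by nlinarith : 4 * 0 - r ^ 2 ≤ 0)]
  norm_num

lemma finsum_t2Star_neg_one (P : Polynomial ℂ) : ∑ᶠ r : ℤ, t2Star 6 P (4 * (-1) - r ^ 2) = -2 := by
  rw [finsum_congr fun r => t2Star_nonpos P (by nlinarith : 4 * (-1) - r ^ 2 ≤ 0), finsum_eq_single _ 0]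
  · norm_num
  · intro r hr
    have : 0 < r ^ 2 := by positivity
    rw [if_neg (by omega), if_neg (by omega), if_neg (by omega)]
    ring

lemma sgN_mul {e : ℕ} (he : 0 < e) (m : ℕ) : (sgN (e * m) e : ℂ) = e * ∑ d ∈ Nat.divisors m, (d : ℂ) := by
  rw [sgN, dv, if_pos (dvd_mul_right e m), Nat.mul_div_cancel_left _ he, Nat.sum_divisorsAntidiagonal
    (f := fun d _ => (e * d : ℤ))]
  push_cast
  rw [Finset.mul_sum]

lemma sgN_of_not_dvd {n e : ℕ} (h : ¬ e ∣ n) : sgN n e = 0 := by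
  rw [sgN, dv, if_neg h, Finset.sum_empty]

lemma summable_sigma {q : ℂ} (hq : ‖q‖ < 1) :
    Summable fun n : ℕ => (∑ d ∈ Nat.divisors n, (d : ℂ)) * q ^ n := by
  refine Summable.of_norm_bounded (summable_norm_pow_mul_geometric_of_norm_lt_one 2 hq) fun n => ?_
  rw [norm_mul, norm_mul]
  gcongr
  rw [norm_pow, norm_natCast, ← Nat.cast_sum, norm_natCast, sq]
  have h1 := Finset.sum_le_card_nsmul n.divisors (fun d => d) n fun d hd => Nat.divisor_le hd
  exact_mod_cast h1.trans (by rw [smul_eq_mul]; exact Nat.mul_le_mul_right n (Nat.card_divisors_le_self n))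

lemma hasSum_sgN {e : ℕ} (he : 0 < e) {z : ℂ} (hz : 0 < z.im) :
    HasSum (fun n : ℕ => (sgN n e : ℂ) * qc z ^ n) (e * ((1 - E2 (e * z)) / 24)) := by
  have hez : 0 < ((e : ℂ) * z).im := natCast_mul_im_pos he hz
  have hs := summable_sigma (norm_qc_lt_one hez)
  have h1 : (1 - E2 (e * z)) / 24 = ∑' n : ℕ, (∑ d ∈ Nat.divisors n, (d : ℂ)) * qc (e * z) ^ n := by
    rw [hs.tsum_eq_zero_add, E2, Nat.divisors_zero, Finset.sum_empty]
    ring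
  have hinj : Function.Injective fun m : ℕ => e * m := fun a b h => Nat.eq_of_mul_eq_mul_left he h
  rw [h1, ← hinj.hasSum_iff]
  · refine (hs.hasSum.mul_left (e : ℂ)).congr_fun fun m => ?_
    simp only [Function.comp]
    rw [sgN_mul he, qc_natCast_mul, pow_mul, mul_assoc]
  · intro n hn
    rw [sgN_of_not_dvd fun ⟨m, hm⟩ => hn ⟨m, hm.symm⟩]
    simp

lemma hasSum_deriv_fJ {q : ℂ} (hq : q ∈ Metric.ball (0 : ℂ) 1) :
    HasSum (fun k : ℕ => k * cJ k * q ^ k) (q * deriv fJ q) := by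
  have h := hasSum_taylorSeries_on_ball (c := 0) (r := 1) (f := deriv fJ)
    (by simpa using differentiableOn_fJ.deriv Metric.isOpen_ball) (by simpa using hq)
  have h1 : HasSum (fun k : ℕ => ((k + 1 : ℕ) : ℂ) * cJ (k + 1) * q ^ (k + 1)) (q * deriv fJ q) := by
    refine (h.mul_left q).congr_fun fun k => ?_
    rw [cJ, iteratedDeriv_succ', Nat.factorial_succ, sub_zero, smul_eq_mul, smul_eq_mul, pow_succ]
    have h2 : (k.factorial : ℂ) ≠ 0 := by exact_mod_cast k.factorial_ne_zero
    have h3 : ((k + 1 : ℕ) : ℂ) ≠ 0 := by exact_mod_cast k.succ_ne_zero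
    rw [Nat.cast_mul]
    generalize iteratedDeriv k (deriv fJ) 0 = D
    generalize ((k + 1 : ℕ) : ℂ) = a at *
    field_simp
  have h2 := HasSum.zero_add (f := fun k : ℕ => k * cJ k * q ^ k) h1
  rwa [Nat.cast_zero, zero_mul, zero_mul, zero_add] at h2

lemma deriv_J {z : ℂ} (hz : 0 < z.im) :
    (2 * Real.pi * I)⁻¹ * deriv J z = -(qc z)⁻¹ + qc z * deriv fJ (qc z) := by
  have h0 := qc_ne_zero z
  have hf := (differentiableOn_fJ.differentiableAt (Metric.isOpen_ball.mem_nhds (qc_mem_ball hz))).hasDerivAt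
  have h1 := ((hasDerivAt_qc z).inv h0).add (hf.comp z (hasDerivAt_qc z))
  have h2 : J = qc⁻¹ + fJ ∘ qc := funext J_eq
  rw [h2, HasDerivAt.deriv h1]
  have h3 : (2 * Real.pi * I : ℂ) ≠ 0 := two_pi_I_ne_zero
  generalize (2 * Real.pi * I : ℂ) = c at h3
  field_simp

end LevelSix

/-- **Level 6 identity of weight-2 forms.**
`2 j₆'(τ) - G₂^{(6*)}(τ) = (7/24) E₂^{(6)}(τ) + (13/12) E₂^{(3)}(2τ) - (1/8) E₂^{(2)}(3τ)`
on the upper half-plane; in particular `2 j₆' - G₂^{(6*)} ∈ M₂(Γ₀(6))`. -/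
theorem weight_two_identity_six
    (P : Polynomial ℂ) (e : ℤ → ℂ)
    (hP : HasQExp (fun z => Polynomial.eval (jnStar 6 z) P) e (-2))
    (he2 : e (-2) = 1) (he1 : e (-1) = 0) (he0 : e 0 = 0)
    (G : ℂ → ℂ)
    (hG : ∀ τ : ℂ, 0 < τ.im →
      HasSum (fun n : ℕ =>
          (∑ᶠ r : ℤ, t2Star 6 P (4 * ((n : ℤ) - 1) - r ^ 2)) * qc τ ^ ((n : ℤ) - 1))
        (G τ))
    (τ : ℂ) (hτ : 0 < τ.im) :
    2 * ((2 * Real.pi * Complex.I)⁻¹ * deriv (jn 6) τ) - G τ =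
      7 / 24 * E2N 6 τ + 13 / 12 * E2N 3 (2 * τ) - 1 / 8 * E2N 2 (3 * τ) := by
  have hPe := LevelSix.poly_eq hP he2 he1 he0
  have hsg : ∀ k : ℕ, 0 < k → HasSum (fun n : ℕ => (LevelSix.sgN n k : ℂ) * qc τ ^ n)
      (k * ((1 - E2 (k * τ)) / 24)) := fun k hk => LevelSix.hasSum_sgN hk hτ
  have hJ := LevelSix.hasSum_deriv_fJ (LevelSix.qc_mem_ball hτ)
  have hc : HasSum (fun n : ℕ => if n = 0 then (-7 / 2 : ℂ) else 0) (-7 / 2) := hasSum_ite_eq 0 _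
  have hs := ((((((hJ.mul_left 2).sub ((hsg 1 one_pos).mul_left 7)).sub ((hsg 2 two_pos).mul_left 13)).add
    (hsg 3 three_pos)).add ((hsg 6 (by norm_num)).mul_left 19)).add hc)
  have h := (hG τ hτ).unique (HasSum.zero_add (f := fun n : ℕ =>
    (∑ᶠ r : ℤ, t2Star 6 P (4 * ((n : ℤ) - 1) - r ^ 2)) * qc τ ^ ((n : ℤ) - 1)) (hs.congr_fun fun n => by
    rw [Nat.cast_succ, add_sub_cancel_right, zpow_natCast]
    rcases Nat.eq_zero_or_pos n with rfl | hn
    · rw [Nat.cast_zero, LevelSix.finsum_t2Star_zero]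
      simp [LevelSix.sgN, LevelSix.dv]
    · rw [LevelSix.finsum_t2Star hPe hn, if_neg hn.ne']
      ring))
  rw [Nat.cast_zero, zero_sub, LevelSix.finsum_t2Star_neg_one, _root_.zpow_neg_one] at h
  rw [h, LevelSix.jn_six, LevelSix.deriv_J hτ, E2N, E2N, E2N]
  push_cast
  simp only [one_mul]
  rw [show (3 : ℂ) * (2 * τ) = 6 * τ by ring, show (2 : ℂ) * (3 * τ) = 6 * τ by ring]
  ring
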